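/- arXiv:0904.3526 — 2 statements merged into one kernel-verified Lean document; each statement's English description precedes it below -/
import Mathlib

section
/- Let 1 < α < 3/2 be a constant, N a sufficiently large integer, and n an integer with 1 ≤ n ≤ N. Then the number of ordered pairs of primes (p_1, p_2) with p_1 + p_2 = n and Ω(p_1 - 1) > α log L is \ll N L^{γ(α) - 3} (\log L)^6, where L = log N, γ(c) = c - c log c, Ω(k) is the number of prime factors of k counted with multiplicity, and the implied constant depends only on α. -/
open Finset
open scoped Classical

noncomputable section

/-- γ(c) = c - c log c. -/
def gam (c : ℝ) : ℝ := c - c * Real.log c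

/-- Ω(k): the number of prime factors of k counted with multiplicity. -/
def bigOmega (k : ℕ) : ℕ := k.primeFactorsList.length

lemma prime_pow_div_dvd_factorial {p : ℕ} (hp : p.Prime) (n : ℕ) :
    p ^ (n / p) ∣ n.factorial := by
  have h1 : p ^ (n / p) ∣ (p * (n / p)).factorial := by
    rw [hp.pow_dvd_iff_le_factorization (Nat.factorial_ne_zero _),
      Nat.factorization_factorial_mul hp]
    omega
  exact h1.trans (Nat.factorial_dvd_factorial (Nat.mul_div_le n p))

/-- A weak form of Mertens' first theorem. -/
lemma sum_log_div_primesBelow_succ_le (n : ℕ) (hn : 1 ≤ n) :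
    ∑ p ∈ (n + 1).primesBelow, Real.log p / p ≤ 2 * Real.log n := by
  have hdvd : ∏ p ∈ (n + 1).primesBelow, p ^ (n / p) ∣ n.factorial := by
    refine Finset.prod_dvd_of_isRelPrime ?_ fun p hp =>
      prime_pow_div_dvd_factorial (Nat.prime_of_mem_primesBelow hp) n
    intro p hp q hq hpq
    exact Nat.coprime_iff_isRelPrime.1 (Nat.Coprime.pow _ _ ((Nat.coprime_primes
      (Nat.prime_of_mem_primesBelow hp) (Nat.prime_of_mem_primesBelow hq)).2 hpq))
  have hle := (Nat.le_of_dvd (Nat.factorial_pos n) hdvd).trans (Nat.factorial_le_pow n)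
  have hpos : ∀ p ∈ (n + 1).primesBelow, 0 < (p : ℝ) := fun p hp => by
    exact_mod_cast (Nat.prime_of_mem_primesBelow hp).pos
  have hlog : ∑ p ∈ (n + 1).primesBelow, ((n / p : ℕ) : ℝ) * Real.log p ≤ n * Real.log n := by
    have h2 : ((∏ p ∈ (n + 1).primesBelow, p ^ (n / p) : ℕ) : ℝ) ≤ ((n ^ n : ℕ) : ℝ) := by
      exact_mod_cast hle
    push_cast at h2
    have h3 := Real.log_le_log (Finset.prod_pos fun p hp => pow_pos (hpos p hp) _) h2
    rw [Real.log_prod (fun p hp => (pow_pos (hpos p hp) _).ne'), Real.log_pow] at h3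
    simpa [Real.log_pow] using h3
  have hn0 : (0 : ℝ) < n := by exact_mod_cast hn
  have hterm : ∀ p ∈ (n + 1).primesBelow,
      Real.log p / p ≤ (2 / n) * (((n / p : ℕ) : ℝ) * Real.log p) := by
    intro p hp
    have hpp := Nat.prime_of_mem_primesBelow hp
    have hpn : p ≤ n := Nat.lt_succ_iff.1 (Nat.lt_of_mem_primesBelow hp)
    have hp0 := hpos p hp
    have h1 : 1 ≤ n / p := (Nat.one_le_div_iff hpp.pos).2 hpn
    have h2 : n < p * (n / p + 1) := Nat.lt_mul_div_succ n hpp.pos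
    have h3 : (n : ℝ) ≤ p * (2 * ((n / p : ℕ) : ℝ)) := by
      have : n ≤ p * (2 * (n / p)) := h2.le.trans (Nat.mul_le_mul_left _ (by omega))
      exact_mod_cast this
    have hl : 0 ≤ Real.log p := Real.log_natCast_nonneg p
    rw [div_eq_mul_inv, div_mul_eq_mul_div, le_div_iff₀ hn0]
    calc Real.log p * (p : ℝ)⁻¹ * n ≤ Real.log p * (p : ℝ)⁻¹ * (p * (2 * ((n / p : ℕ) : ℝ))) := by
          gcongr
      _ = _ := by field_simp
  calc _ ≤ ∑ p ∈ (n + 1).primesBelow, (2 / n) * (((n / p : ℕ) : ℝ) * Real.log p) :=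
        Finset.sum_le_sum hterm
    _ = (2 / n) * ∑ p ∈ (n + 1).primesBelow, ((n / p : ℕ) : ℝ) * Real.log p := by
        rw [Finset.mul_sum]
    _ ≤ (2 / n) * (n * Real.log n) := by gcongr
    _ = _ := by field_simp

lemma primesBelow_subset_primesBelow {a b : ℕ} (h : a ≤ b) : a.primesBelow ⊆ b.primesBelow := by
  intro p hp
  exact Nat.mem_primesBelow.2 ⟨(Nat.lt_of_mem_primesBelow hp).trans_le h,
    Nat.prime_of_mem_primesBelow hp⟩

lemma sum_log_div_primesBelow_le (y : ℕ) (hy : 1 ≤ y) :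
    ∑ p ∈ y.primesBelow, Real.log p / p ≤ 2 * Real.log y := by
  refine le_trans (Finset.sum_le_sum_of_subset_of_nonneg
    (primesBelow_subset_primesBelow (Nat.le_succ y)) fun p _ _ => ?_)
    (sum_log_div_primesBelow_succ_le y hy)
  exact div_nonneg (Real.log_natCast_nonneg p) (Nat.cast_nonneg p)

/-- The completely multiplicative function `n ↦ n ^ (-s)`. -/
def rpowNegHom (s : ℝ) : ℕ →* ℝ where
  toFun n := (n : ℝ) ^ (-s)
  map_one' := by simp
  map_mul' a b := by
    push_cast
    exact Real.mul_rpow (Nat.cast_nonneg a) (Nat.cast_nonneg b)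

lemma sum_primesBelow_rpow_neg_le {s : ℝ} (hs : 1 < s) (y : ℕ) :
    ∑ p ∈ y.primesBelow, (p : ℝ) ^ (-s) ≤ Real.log (∑' n : ℕ, 1 / (n : ℝ) ^ s) := by
  have hsum0 : Summable fun n : ℕ => 1 / (n : ℝ) ^ s := Real.summable_one_div_nat_rpow.2 hs
  have heq : (fun n : ℕ => 1 / (n : ℝ) ^ s) = fun n : ℕ => rpowNegHom s n := by
    funext n
    simp [rpowNegHom, Real.rpow_neg]
  have hsum : Summable (rpowNegHom s) := by rw [heq] at hsum0; exact hsum0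
  have hnn : ∀ n : ℕ, 0 ≤ rpowNegHom s n := fun n => Real.rpow_nonneg (Nat.cast_nonneg n) _
  have hlt : ∀ p ∈ y.primesBelow, 0 < 1 - rpowNegHom s p := by
    intro p hp
    have := hsum.norm_lt_one (Nat.prime_of_mem_primesBelow hp).one_lt
    rw [Real.norm_of_nonneg (hnn p)] at this
    linarith
  have h1 : ∏ p ∈ y.primesBelow, (1 - rpowNegHom s p)⁻¹ ≤ ∑' n : ℕ, 1 / (n : ℝ) ^ s := by
    rw [EulerProduct.prod_primesBelow_geometric_eq_tsum_smoothNumbers hsum, heq]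
    exact Summable.tsum_subtype_le _ _ hnn hsum
  refine le_trans ?_ (Real.log_le_log (Finset.prod_pos fun p hp => inv_pos.2 (hlt p hp)) h1)
  rw [Real.log_prod (fun p hp => (inv_pos.2 (hlt p hp)).ne')]
  refine Finset.sum_le_sum fun p hp => ?_
  rw [Real.log_inv]
  have := Real.log_le_sub_one_of_pos (hlt p hp)
  have h2 : rpowNegHom s p = (p : ℝ) ^ (-s) := rfl
  linarith

/-- An upper bound as in Mertens' second theorem. -/
lemma exists_sum_inv_primesBelow_le :
    ∃ C : ℝ, 0 < C ∧ ∀ y : ℕ, 3 ≤ y →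
      ∑ p ∈ y.primesBelow, 1 / (p : ℝ) ≤ Real.log (Real.log y) + C := by
  have hev : ∀ᶠ s : ℝ in nhdsWithin 1 (Set.Ioi 1),
      (s - 1) * ∑' n : ℕ, 1 / (n : ℝ) ^ s < 2 :=
    tendsto_sub_mul_tsum_nat_rpow.eventually_lt_const (by norm_num)
  have ht : Filter.Tendsto (fun y : ℕ => 1 + 1 / Real.log (y : ℝ)) Filter.atTop
      (nhdsWithin 1 (Set.Ioi 1)) := by
    refine tendsto_nhdsWithin_iff.2 ⟨?_, ?_⟩
    · have h : Filter.Tendsto (fun y : ℕ => 1 / Real.log (y : ℝ)) Filter.atTop (nhds 0) := by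
        simp_rw [one_div]
        exact (Real.tendsto_log_atTop.comp tendsto_natCast_atTop_atTop).inv_tendsto_atTop
      simpa using h.const_add 1
    · filter_upwards [Filter.eventually_ge_atTop 3] with y hy
      have : 0 < Real.log (y : ℝ) := Real.log_pos (by exact_mod_cast (by omega : 1 < y))
      simp only [Set.mem_Ioi]
      have := one_div_pos.2 this
      linarith
  obtain ⟨y0, hy0⟩ := Filter.eventually_atTop.1 (ht.eventually hev)
  refine ⟨y0 + 2 + Real.log 2, by positivity, fun y hy => ?_⟩
  have hlog1 : 1 < Real.log (y : ℝ) := by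
    rw [Real.lt_log_iff_exp_lt (by positivity)]
    have h3 : (3 : ℝ) ≤ y := by exact_mod_cast hy
    linarith [Real.exp_one_lt_d9]
  have hlog : 0 < Real.log (y : ℝ) := by linarith
  have hll : 0 < Real.log (Real.log y) := Real.log_pos hlog1
  have hl2 : 0 < Real.log 2 := Real.log_pos (by norm_num)
  rcases le_or_gt y0 y with h | h
  · have hb := hy0 y h
    set δ : ℝ := 1 / Real.log y with hδ
    have hδ0 : 0 < δ := one_div_pos.2 hlog
    have hb' : ∑' n : ℕ, 1 / (n : ℝ) ^ (1 + δ) ≤ 2 * Real.log y := by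
      have h1 : δ * ∑' n : ℕ, 1 / (n : ℝ) ^ (1 + δ) < 2 := by simpa using hb
      calc _ = Real.log y * (δ * ∑' n : ℕ, 1 / (n : ℝ) ^ (1 + δ)) := by
            rw [hδ]; field_simp
        _ ≤ Real.log y * 2 := by gcongr
        _ = _ := by ring
    have hpos : 0 < ∑' n : ℕ, 1 / (n : ℝ) ^ (1 + δ) :=
      (Real.summable_one_div_nat_rpow.2 (by linarith)).tsum_pos (fun n => by positivity) 1
        (by simp)
    have h1 := sum_primesBelow_rpow_neg_le (s := 1 + δ) (by linarith) y
    have h2 := Real.log_le_log hpos hb'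
    rw [Real.log_mul (by norm_num) hlog.ne'] at h2
    have h3 : ∀ p ∈ y.primesBelow,
        1 / (p : ℝ) ≤ (p : ℝ) ^ (-(1 + δ)) + δ * (Real.log p / p) := by
      intro p hp
      have hp0 : (0 : ℝ) < p := by exact_mod_cast (Nat.prime_of_mem_primesBelow hp).pos
      have h4 : (p : ℝ) ^ (-(1 + δ)) = (1 / p) * Real.exp (-(δ * Real.log p)) := by
        rw [neg_add, Real.rpow_add hp0, Real.rpow_neg_one, Real.rpow_def_of_pos hp0, one_div]
        congr 2; ring
      have h5 := Real.add_one_le_exp (-(δ * Real.log p))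
      rw [h4]
      calc 1 / (p : ℝ) = (1 / p) * (-(δ * Real.log p) + 1) + δ * (Real.log p / p) := by ring
        _ ≤ _ := by gcongr
    have h6 := Finset.sum_le_sum h3
    rw [Finset.sum_add_distrib, ← Finset.mul_sum] at h6
    have h7 : δ * ∑ p ∈ y.primesBelow, Real.log p / p ≤ 2 := by
      calc _ ≤ δ * (2 * Real.log y) := by
            gcongr; exact sum_log_div_primesBelow_le y (by omega)
        _ = 2 := by rw [hδ]; field_simp
    have : (0 : ℝ) ≤ y0 := Nat.cast_nonneg _
    linarith
  · have h1 : ∑ p ∈ y.primesBelow, 1 / (p : ℝ) ≤ ∑ p ∈ y.primesBelow, (1 : ℝ) := by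
      refine Finset.sum_le_sum fun p hp => ?_
      have : (1 : ℝ) ≤ p := by exact_mod_cast (Nat.prime_of_mem_primesBelow hp).one_le
      exact (div_le_one (by linarith)).2 this
    have h2 : (y.primesBelow.card : ℝ) ≤ y := by
      exact_mod_cast (Finset.card_filter_le _ _).trans (by simp)
    have h3 : (y : ℝ) ≤ y0 := by exact_mod_cast h.le
    simp only [sum_const, nsmul_eq_mul, mul_one] at h1
    linarith

/-- An upper bound as in Mertens' third theorem. -/
lemma prod_one_sub_inv_primesBelow_le (y : ℕ) (hy : 2 ≤ y) :
    ∏ p ∈ y.primesBelow, (1 - 1 / (p : ℝ)) ≤ 1 / Real.log y := by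
  have hlt : ∀ {p : ℕ}, p.Prime → ‖rpowNegHom 1 p‖ < 1 := by
    intro p hp
    have h1 : (1 : ℝ) < p := by exact_mod_cast hp.one_lt
    simp only [rpowNegHom, MonoidHom.coe_mk, OneHom.coe_mk, Real.rpow_neg_one]
    rw [Real.norm_of_nonneg (by positivity)]
    exact inv_lt_one_of_one_lt₀ h1
  obtain ⟨hs, hh⟩ :=
    EulerProduct.summable_and_hasSum_smoothNumbers_prod_primesBelow_geometric hlt y
  have hval : ∀ n : ℕ, rpowNegHom 1 n = (n : ℝ)⁻¹ := fun n => by simp [rpowNegHom, Real.rpow_neg_one]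
  have hmem : ∀ n ∈ Finset.Icc 1 (y - 1), n ∈ y.smoothNumbers := fun n hn => by
    rw [Finset.mem_Icc] at hn
    exact Nat.mem_smoothNumbers_of_lt (by omega) (by omega)
  have h1 : ∑ n ∈ Finset.Icc 1 (y - 1), (n : ℝ)⁻¹ ≤ ∏ p ∈ y.primesBelow, (1 - rpowNegHom 1 p)⁻¹ := by
    have h2 := hh.summable.sum_le_tsum
      ((Finset.Icc 1 (y - 1)).subtype (· ∈ y.smoothNumbers))
      (fun n _ => by rw [hval]; positivity)
    rw [hh.tsum_eq] at h2
    refine le_trans (le_of_eq ?_) h2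
    rw [Finset.sum_subtype_of_mem (fun n => rpowNegHom 1 n) hmem]
    exact Finset.sum_congr rfl fun n _ => (hval n).symm
  have h2 : Real.log y ≤ ∑ n ∈ Finset.Icc 1 (y - 1), (n : ℝ)⁻¹ := by
    have h3 := log_add_one_le_harmonic (y - 1)
    rw [harmonic_eq_sum_Icc] at h3
    push_cast at h3
    have h4 : ((y - 1 : ℕ) : ℝ) + 1 = y := by
      rw [Nat.cast_sub (by omega)]; simp
    rw [h4] at h3
    exact h3
  have hlog : 0 < Real.log (y : ℝ) := Real.log_pos (by exact_mod_cast (by omega : 1 < y))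
  have h5 := h2.trans h1
  have h6 : ∏ p ∈ y.primesBelow, (1 - rpowNegHom 1 p)⁻¹ =
      (∏ p ∈ y.primesBelow, (1 - 1 / (p : ℝ)))⁻¹ := by
    rw [← Finset.prod_inv_distrib]
    exact Finset.prod_congr rfl fun p _ => by rw [hval, one_div]
  rw [h6] at h5
  rw [one_div]
  exact le_inv_of_le_inv₀ hlog h5

/-- `(m / φ(m)) ^ 2` as a product over the prime factors of `m`. -/
def totientRatioSq (m : ℕ) : ℝ := ∏ p ∈ m.primeFactors, ((1 - 1 / (p : ℝ))⁻¹) ^ 2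

/-- The weight `α ^ Ω(m) (m / φ(m)) ^ 2 m ^ (δ - 1)`. -/
def omegaWeight (α δ : ℝ) (m : ℕ) : ℝ :=
  α ^ bigOmega m * totientRatioSq m * (m : ℝ) ^ (δ - 1)

lemma one_sub_inv_prime_bounds {p : ℕ} (hp : p.Prime) :
    1 / 2 ≤ 1 - 1 / (p : ℝ) ∧ 1 - 1 / (p : ℝ) < 1 := by
  have h1 : (2 : ℝ) ≤ p := by exact_mod_cast hp.two_le
  have h2 : 1 / (p : ℝ) ≤ 1 / 2 := by gcongr
  have h3 : 0 < 1 / (p : ℝ) := by positivity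
  constructor <;> linarith

lemma one_le_inv_one_sub_inv_prime {p : ℕ} (hp : p.Prime) : 1 ≤ (1 - 1 / (p : ℝ))⁻¹ := by
  obtain ⟨h1, h2⟩ := one_sub_inv_prime_bounds hp
  exact (one_le_inv₀ (by linarith)).2 h2.le

lemma one_le_totientRatioSq (m : ℕ) : 1 ≤ totientRatioSq m := by
  unfold totientRatioSq
  refine Finset.one_le_prod fun p hp => ?_
  exact one_le_pow₀ (one_le_inv_one_sub_inv_prime (Nat.prime_of_mem_primeFactors hp))

lemma totientRatioSq_mul_of_coprime {m n : ℕ} (h : m.Coprime n) :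
    totientRatioSq (m * n) = totientRatioSq m * totientRatioSq n := by
  unfold totientRatioSq
  rw [h.primeFactors_mul, Finset.prod_union h.disjoint_primeFactors]

lemma omegaWeight_nonneg {α : ℝ} (hα : 0 ≤ α) (δ : ℝ) (m : ℕ) : 0 ≤ omegaWeight α δ m := by
  have := one_le_totientRatioSq m
  unfold omegaWeight
  have h2 : 0 ≤ (m : ℝ) ^ (δ - 1) := Real.rpow_nonneg (Nat.cast_nonneg m) _
  positivity

lemma bigOmega_mul {m n : ℕ} (hm : m ≠ 0) (hn : n ≠ 0) :
    bigOmega (m * n) = bigOmega m + bigOmega n := by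
  unfold bigOmega
  rw [(Nat.perm_primeFactorsList_mul hm hn).length_eq, List.length_append]

lemma omegaWeight_one (α δ : ℝ) : omegaWeight α δ 1 = 1 := by
  simp [omegaWeight, bigOmega, totientRatioSq]

lemma omegaWeight_mul_of_coprime (α δ : ℝ) {m n : ℕ} (h : m.Coprime n) :
    omegaWeight α δ (m * n) = omegaWeight α δ m * omegaWeight α δ n := by
  rcases eq_or_ne m 0 with rfl | hm
  · have : n = 1 := by simpa using h
    subst this
    rw [omegaWeight_one, mul_one, mul_one]
  rcases eq_or_ne n 0 with rfl | hn
  · have : m = 1 := by simpa using h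
    subst this
    rw [omegaWeight_one, one_mul, one_mul]
  unfold omegaWeight
  rw [bigOmega_mul hm hn, pow_add, totientRatioSq_mul_of_coprime h]
  push_cast
  rw [Real.mul_rpow (Nat.cast_nonneg m) (Nat.cast_nonneg n)]
  ring

lemma omegaWeight_prime_pow_succ (α δ : ℝ) {p : ℕ} (hp : p.Prime) (k : ℕ) :
    omegaWeight α δ (p ^ (k + 1)) =
      ((1 - 1 / (p : ℝ))⁻¹) ^ 2 * (α * (p : ℝ) ^ (δ - 1)) * (α * (p : ℝ) ^ (δ - 1)) ^ k := by
  unfold omegaWeight bigOmega totientRatioSq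
  rw [hp.primeFactorsList_pow, List.length_replicate, Nat.primeFactors_prime_pow (by omega) hp,
    Finset.prod_singleton]
  push_cast
  rw [← Real.rpow_natCast_mul (Nat.cast_nonneg p), mul_comm ((k + 1 : ℕ) : ℝ) (δ - 1),
    Real.rpow_mul_natCast (Nat.cast_nonneg p), mul_pow]
  ring

lemma alpha_mul_rpow_le {α δ : ℝ} (hα : 1 < α) (hα' : α < 3 / 2) (hδ' : δ ≤ 1 / 20)
    {p : ℕ} (hp : p.Prime) : α * (p : ℝ) ^ (δ - 1) ≤ 4 / 5 := by
  have h2 : (2 : ℝ) ≤ p := by exact_mod_cast hp.two_le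
  have h3 : (p : ℝ) ^ (δ - 1) ≤ (2 : ℝ) ^ (δ - 1) :=
    Real.rpow_le_rpow_of_nonpos (by norm_num) h2 (by linarith)
  have h4 : (2 : ℝ) ^ (δ - 1) ≤ (2 : ℝ) ^ (-(19 / 20 : ℝ)) :=
    Real.rpow_le_rpow_of_exponent_le (by norm_num) (by linarith)
  have h5 : (2 : ℝ) ^ (-(19 / 20 : ℝ)) ≤ 53 / 100 := by
    have h6 : (2 : ℝ) ^ (-(19 / 20 : ℝ)) = Real.exp (1 / 20 * Real.log 2) / 2 := by
      rw [show (-(19 / 20 : ℝ)) = 1 / 20 - 1 by norm_num, Real.rpow_sub_one (by norm_num),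
        Real.rpow_def_of_pos (by norm_num), mul_comm]
    have h7 : Real.exp (1 / 20 * Real.log 2) ≤ 106 / 100 := by
      have h8 : (1 / 20 * Real.log 2) ≤ 1 / 20 := by
        have := Real.log_two_lt_d9
        linarith
      have h9 := Real.exp_bound_div_one_sub_of_interval (x := 1 / 20) (by norm_num) (by norm_num)
      exact (Real.exp_le_exp.2 h8).trans (h9.trans (by norm_num))
    rw [h6]; linarith
  have h6 : 0 ≤ (p : ℝ) ^ (δ - 1) := Real.rpow_nonneg (Nat.cast_nonneg p) _
  nlinarith

lemma hasSum_omegaWeight_prime_pow {α δ : ℝ} (hα : 1 < α) (hα' : α < 3 / 2) (hδ' : δ ≤ 1 / 20)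
    {p : ℕ} (hp : p.Prime) :
    HasSum (fun k => omegaWeight α δ (p ^ k))
      (1 + ((1 - 1 / (p : ℝ))⁻¹) ^ 2 * (α * (p : ℝ) ^ (δ - 1)) *
        (1 - α * (p : ℝ) ^ (δ - 1))⁻¹) := by
  have h1 := alpha_mul_rpow_le hα hα' hδ' hp
  have h0 : 0 ≤ α * (p : ℝ) ^ (δ - 1) :=
    mul_nonneg (by linarith) (Real.rpow_nonneg (Nat.cast_nonneg p) _)
  have h2 := (hasSum_geometric_of_lt_one h0 (by linarith)).mul_left
    (((1 - 1 / (p : ℝ))⁻¹) ^ 2 * (α * (p : ℝ) ^ (δ - 1)))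
  simp_rw [← omegaWeight_prime_pow_succ α δ hp] at h2
  have h3 := (hasSum_nat_add_iff (f := fun k => omegaWeight α δ (p ^ k)) 1).1 h2
  simpa [omegaWeight_one, add_comm] using h3

lemma local_factor_le {α δ : ℝ} (hα : 1 < α) (hα' : α < 3 / 2) (hδ : 0 ≤ δ) (hδ' : δ ≤ 1 / 20)
    {p : ℕ} (hp : p.Prime) (hδp : δ * Real.log p ≤ 1 / 20) :
    1 + ((1 - 1 / (p : ℝ))⁻¹) ^ 2 * (α * (p : ℝ) ^ (δ - 1)) *
        (1 - α * (p : ℝ) ^ (δ - 1))⁻¹ ≤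
      Real.exp (α * (1 / p) + 2 * δ * (Real.log p / p) + 61 * (1 / (p : ℝ) ^ 2)) := by
  have hx := alpha_mul_rpow_le hα hα' hδ' hp
  have hp0 : (0 : ℝ) < p := by exact_mod_cast hp.pos
  have hx0 : 0 ≤ α * (p : ℝ) ^ (δ - 1) :=
    mul_nonneg (by linarith) (Real.rpow_nonneg (Nat.cast_nonneg p) _)
  have h2 : (2 : ℝ) ≤ p := by exact_mod_cast hp.two_le
  set t : ℝ := 1 / (p : ℝ) with ht
  have ht0 : 0 < t := by positivity
  have ht2 : t ≤ 1 / 2 := by rw [ht]; gcongr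
  set s : ℝ := δ * Real.log p with hs
  have hs0 : 0 ≤ s := mul_nonneg hδ (Real.log_natCast_nonneg p)
  have hxe : α * (p : ℝ) ^ (δ - 1) = α * t * Real.exp s := by
    rw [Real.rpow_sub_one hp0.ne', Real.rpow_def_of_pos hp0, ht, hs, mul_comm δ]; ring
  have hes : Real.exp s ≤ 1 + 106 / 100 * s := by
    have h3 := Real.exp_bound_div_one_sub_of_interval hs0 (by linarith)
    refine h3.trans ?_
    rw [div_le_iff₀ (by linarith)]
    nlinarith
  set x : ℝ := α * (p : ℝ) ^ (δ - 1) with hxdef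
  have hx1 : x ≤ α * t + 2 * s * t := by
    rw [hxe]
    calc α * t * Real.exp s ≤ α * t * (1 + 106 / 100 * s) := by gcongr
      _ = α * t + (106 / 100 * α) * s * t := by ring
      _ ≤ _ := by
        have : 106 / 100 * α ≤ 2 := by linarith
        gcongr
  have hx2 : x ≤ 8 / 5 * t := by
    rw [hxe]
    have : α * Real.exp s ≤ 8 / 5 := by
      calc α * Real.exp s ≤ (3 / 2) * (1 + 106 / 100 * s) := by gcongr
        _ ≤ _ := by linarith
    calc _ = (α * Real.exp s) * t := by ring
      _ ≤ _ := by gcongr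
  have hG : ((1 - t)⁻¹) ^ 2 ≤ 1 + 6 * t := by
    rw [inv_pow, inv_le_iff_one_le_mul₀ (by nlinarith)]
    nlinarith [mul_nonneg ht0.le (by linarith : 0 ≤ 1 / 2 - t)]
  have hI : x * (1 - x)⁻¹ ≤ x + 5 * x ^ 2 := by
    rw [← div_eq_mul_inv, div_le_iff₀ (by linarith)]
    nlinarith [mul_nonneg (sq_nonneg x) (by linarith : 0 ≤ 4 / 5 - x)]
  have hx3 : x ^ 2 ≤ 64 / 25 * t ^ 2 := by nlinarith
  have hmain : ((1 - t)⁻¹) ^ 2 * x * (1 - x)⁻¹ ≤ x + 61 * t ^ 2 := by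
    calc ((1 - t)⁻¹) ^ 2 * x * (1 - x)⁻¹ = ((1 - t)⁻¹) ^ 2 * (x * (1 - x)⁻¹) := by ring
      _ ≤ (1 + 6 * t) * (x + 5 * x ^ 2) := by
        have hI0 : 0 ≤ x * (1 - x)⁻¹ := mul_nonneg hx0 (inv_nonneg.2 (by linarith))
        gcongr
      _ ≤ x + 61 * t ^ 2 := by
        have a1 : t * x ≤ 8 / 5 * t ^ 2 := by nlinarith
        have a2 : t * x ^ 2 ≤ 1 / 2 * (64 / 25 * t ^ 2) := by gcongr
        nlinarith
  have h5 : 2 * δ * (Real.log p / p) = 2 * s * t := by rw [hs, ht]; ring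
  have h6 : 1 / (p : ℝ) ^ 2 = t ^ 2 := by rw [ht]; ring
  rw [h5, h6]
  have := Real.add_one_le_exp (α * t + 2 * s * t + 61 * t ^ 2)
  linarith

lemma sum_primesBelow_inv_sq_le (y : ℕ) :
    ∑ p ∈ y.primesBelow, 1 / (p : ℝ) ^ 2 ≤ ∑' n : ℕ, 1 / (n : ℝ) ^ 2 :=
  (Real.summable_one_div_nat_pow.2 (by norm_num)).sum_le_tsum _ fun n _ => by positivity

lemma one_lt_log_natCast {y : ℕ} (hy : 3 ≤ y) : 1 < Real.log (y : ℝ) := by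
  rw [Real.lt_log_iff_exp_lt (by positivity)]
  have h3 : (3 : ℝ) ≤ y := by exact_mod_cast hy
  linarith [Real.exp_one_lt_d9]

/-- Rankin-type bound for the weight summed over smooth numbers. -/
lemma exists_sum_omegaWeight_smooth_le :
    ∃ C : ℝ, 0 < C ∧ ∀ α : ℝ, 1 < α → α < 3 / 2 → ∀ y : ℕ, 3 ≤ y → ∀ δ : ℝ, 0 ≤ δ →
      20 * δ * Real.log y ≤ 1 → ∀ M : Finset ℕ, (∀ m ∈ M, m ∈ y.smoothNumbers) →
      ∑ m ∈ M, omegaWeight α δ m ≤ C * Real.log y ^ α := by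
  obtain ⟨C, hC, hM⟩ := exists_sum_inv_primesBelow_le
  set Z : ℝ := ∑' n : ℕ, 1 / (n : ℝ) ^ 2 with hZ
  refine ⟨Real.exp (3 / 2 * C + 1 + 61 * Z), Real.exp_pos _, ?_⟩
  intro α hα hα' y hy δ hδ hδy M hMs
  have hlog := one_lt_log_natCast hy
  have hδ' : δ ≤ 1 / 20 := by nlinarith
  obtain ⟨-, hh⟩ := EulerProduct.summable_and_hasSum_smoothNumbers_prod_primesBelow_tsum
    (f := omegaWeight α δ) (omegaWeight_one α δ)
    (fun h => omegaWeight_mul_of_coprime α δ h)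
    (fun {p} hp => by
      have h1 := (hasSum_omegaWeight_prime_pow hα hα' hδ' hp).summable
      refine h1.congr fun k => ?_
      rw [Real.norm_of_nonneg (omegaWeight_nonneg (by linarith) _ _)]) y
  have h1 : ∑ m ∈ M, omegaWeight α δ m ≤
      ∏ p ∈ y.primesBelow, ∑' n : ℕ, omegaWeight α δ (p ^ n) := by
    have h2 := hh.summable.sum_le_tsum (M.subtype (· ∈ y.smoothNumbers))
      (fun n _ => omegaWeight_nonneg (by linarith) _ _)
    rw [hh.tsum_eq] at h2
    refine le_trans (le_of_eq ?_) h2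
    rw [Finset.sum_subtype_of_mem (fun n => omegaWeight α δ n) hMs]
  refine h1.trans ?_
  have h3 : ∏ p ∈ y.primesBelow, ∑' n : ℕ, omegaWeight α δ (p ^ n) ≤
      ∏ p ∈ y.primesBelow,
        Real.exp (α * (1 / p) + 2 * δ * (Real.log p / p) + 61 * (1 / (p : ℝ) ^ 2)) := by
    refine Finset.prod_le_prod
      (fun p _ => tsum_nonneg fun n => omegaWeight_nonneg (by linarith) _ _) fun p hp => ?_
    have hpp := Nat.prime_of_mem_primesBelow hp
    rw [(hasSum_omegaWeight_prime_pow hα hα' hδ' hpp).tsum_eq]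
    refine local_factor_le hα hα' hδ hδ' hpp ?_
    have h4 : Real.log p ≤ Real.log y :=
      Real.log_le_log (by exact_mod_cast hpp.pos)
        (by exact_mod_cast (Nat.lt_of_mem_primesBelow hp).le)
    have : δ * Real.log p ≤ δ * Real.log y := by gcongr
    linarith
  refine h3.trans ?_
  rw [← Real.exp_sum, Finset.sum_add_distrib, Finset.sum_add_distrib, ← Finset.mul_sum,
    ← Finset.mul_sum, ← Finset.mul_sum, Real.rpow_def_of_pos (by linarith), ← Real.exp_add,
    Real.exp_le_exp]
  have h5 := hM y hy
  have h6 := sum_log_div_primesBelow_le y (by omega)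
  have h7 := sum_primesBelow_inv_sq_le y
  have h8 : α * ∑ p ∈ y.primesBelow, 1 / (p : ℝ) ≤ α * (Real.log (Real.log y) + C) := by gcongr
  have h9 : 2 * δ * ∑ p ∈ y.primesBelow, Real.log p / p ≤ 2 * δ * (2 * Real.log y) := by gcongr
  have h10 : α * C ≤ 3 / 2 * C := by gcongr
  linarith

lemma exists_prod_inv_one_sub_inv_primesBelow_le :
    ∃ C : ℝ, 0 < C ∧ ∀ y : ℕ, 3 ≤ y →
      ∏ p ∈ y.primesBelow, (1 - 1 / (p : ℝ))⁻¹ ≤ C * Real.log y := by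
  obtain ⟨C, hC, hM⟩ := exists_sum_inv_primesBelow_le
  set Z : ℝ := ∑' n : ℕ, 1 / (n : ℝ) ^ 2 with hZ
  refine ⟨Real.exp (C + 2 * Z), Real.exp_pos _, fun y hy => ?_⟩
  have hlog := one_lt_log_natCast hy
  have h1 : ∏ p ∈ y.primesBelow, (1 - 1 / (p : ℝ))⁻¹ ≤
      ∏ p ∈ y.primesBelow, Real.exp (1 / p + 2 * (1 / (p : ℝ) ^ 2)) := by
    refine Finset.prod_le_prod (fun p hp => ?_) fun p hp => ?_
    · linarith [one_le_inv_one_sub_inv_prime (Nat.prime_of_mem_primesBelow hp)]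
    · obtain ⟨h2, h3⟩ := one_sub_inv_prime_bounds (Nat.prime_of_mem_primesBelow hp)
      refine le_trans ?_ (Real.add_one_le_exp _)
      rw [inv_le_iff_one_le_mul₀ (by linarith)]
      have h4 : 1 / (p : ℝ) ^ 2 = (1 / p) ^ 2 := by ring
      rw [h4]
      set t : ℝ := 1 / (p : ℝ)
      nlinarith [mul_nonneg (sq_nonneg t) (by linarith : 0 ≤ 1 / 2 - t)]
  refine h1.trans ?_
  have h5 := hM y hy
  have h7 := sum_primesBelow_inv_sq_le y
  rw [← Real.exp_sum, Finset.sum_add_distrib, ← Finset.mul_sum]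
  have h8 : Real.log (y : ℝ) = Real.exp (Real.log (Real.log y)) :=
    (Real.exp_log (by linarith)).symm
  rw [h8, ← Real.exp_add, Real.exp_le_exp]
  linarith

lemma two_pow_card_primeFactors_le {k : ℕ} (hk : k ≠ 0) : 2 ^ k.primeFactors.card ≤ k := by
  calc 2 ^ k.primeFactors.card = ∏ _p ∈ k.primeFactors, 2 := by simp
    _ ≤ ∏ p ∈ k.primeFactors, p :=
      Finset.prod_le_prod' fun p hp => (Nat.prime_of_mem_primeFactors hp).two_le
    _ ≤ k := Nat.le_of_dvd (Nat.pos_of_ne_zero hk) (Nat.prod_primeFactors_dvd k)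

lemma exists_prod_primeFactors_inv_one_sub_inv_le :
    ∃ C : ℝ, 0 < C ∧ ∀ y : ℕ, 3 ≤ y → ∀ k : ℕ, k ≠ 0 → k ≤ 2 ^ y →
      ∏ p ∈ k.primeFactors, (1 - 1 / (p : ℝ))⁻¹ ≤ C * Real.log y := by
  obtain ⟨C, hC, hM⟩ := exists_prod_inv_one_sub_inv_primesBelow_le
  refine ⟨C * Real.exp 2, by positivity, fun y hy k hk hky => ?_⟩
  have hcard : k.primeFactors.card ≤ y :=
    (Nat.pow_le_pow_iff_right (by norm_num : 1 < 2)).1 ((two_pow_card_primeFactors_le hk).trans hky)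
  have hy0 : (0 : ℝ) < y := by positivity
  rw [← Finset.prod_filter_mul_prod_filter_not k.primeFactors (fun p => p < y)]
  have h1 : ∏ p ∈ k.primeFactors with p < y, (1 - 1 / (p : ℝ))⁻¹ ≤ C * Real.log y := by
    refine le_trans (Finset.prod_le_prod_of_subset_of_one_le ?_ ?_ ?_) (hM y hy)
    · intro p hp
      rw [Finset.mem_filter] at hp
      exact Nat.mem_primesBelow.2 ⟨hp.2, Nat.prime_of_mem_primeFactors hp.1⟩
    · intro p hp
      rw [Finset.mem_filter] at hp
      linarith [one_le_inv_one_sub_inv_prime (Nat.prime_of_mem_primeFactors hp.1)]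
    · intro p hp _
      exact one_le_inv_one_sub_inv_prime (Nat.prime_of_mem_primesBelow hp)
  have h2 : ∏ p ∈ k.primeFactors with ¬ p < y, (1 - 1 / (p : ℝ))⁻¹ ≤ Real.exp 2 := by
    calc _ ≤ ∏ p ∈ k.primeFactors with ¬ p < y, Real.exp (2 / y) := by
          refine Finset.prod_le_prod (fun p hp => ?_) fun p hp => ?_
          · rw [Finset.mem_filter] at hp
            linarith [one_le_inv_one_sub_inv_prime (Nat.prime_of_mem_primeFactors hp.1)]
          · rw [Finset.mem_filter] at hp
            obtain ⟨h3, h4⟩ := one_sub_inv_prime_bounds (Nat.prime_of_mem_primeFactors hp.1)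
            refine le_trans ?_ (Real.add_one_le_exp _)
            have h5 : 1 / (p : ℝ) ≤ 1 / y := by
              have : (y : ℝ) ≤ p := by exact_mod_cast not_lt.1 hp.2
              gcongr
            have h6 : 2 / (y : ℝ) = 2 * (1 / y) := by ring
            rw [inv_le_iff_one_le_mul₀ (by linarith), h6]
            have h7 : 0 < 1 / (y : ℝ) := by positivity
            nlinarith
      _ = Real.exp (((k.primeFactors.filter (fun p => ¬ p < y)).card : ℝ) * (2 / y)) := by
          rw [Finset.prod_const, Real.exp_nat_mul]
      _ ≤ Real.exp 2 := by
          rw [Real.exp_le_exp]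
          have h3 : ((k.primeFactors.filter (fun p => ¬ p < y)).card : ℝ) ≤ y := by
            exact_mod_cast (Finset.card_filter_le _ _).trans hcard
          calc _ ≤ (y : ℝ) * (2 / y) := by gcongr
            _ = 2 := by field_simp
  have h0 : 0 ≤ ∏ p ∈ k.primeFactors with ¬ p < y, (1 - 1 / (p : ℝ))⁻¹ :=
    Finset.prod_nonneg fun p hp => by
      rw [Finset.mem_filter] at hp
      linarith [one_le_inv_one_sub_inv_prime (Nat.prime_of_mem_primeFactors hp.1)]
  have hlog := one_lt_log_natCast hy
  calc _ ≤ (C * Real.log y) * Real.exp 2 := by gcongr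
    _ = _ := by ring

section Bonferroni

variable {ι : Type*}

/-- Inclusion-exclusion truncated to index sets with fewer than `k` elements. -/
def truncSieveSum (P : Finset ι) (g : ι → ℝ) (k : ℕ) : ℝ :=
  ∑ T ∈ P.powerset, if T.card < k then (-1) ^ T.card * ∏ p ∈ T, g p else 0

/-- The `k`-th elementary symmetric function of `g` on `P`. -/
def elemSymmSum (P : Finset ι) (g : ι → ℝ) (k : ℕ) : ℝ :=
  ∑ T ∈ P.powerset, if T.card = k then ∏ p ∈ T, g p else 0

lemma truncSieveSum_zero (P : Finset ι) (g : ι → ℝ) : truncSieveSum P g 0 = 0 := by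
  simp [truncSieveSum]

lemma elemSymmSum_zero (P : Finset ι) (g : ι → ℝ) : elemSymmSum P g 0 = 1 := by
  unfold elemSymmSum
  rw [Finset.sum_eq_single ∅]
  · simp
  · intro T _ hT
    rw [if_neg (by simpa using hT)]
  · simp

lemma truncSieveSum_insert {P : Finset ι} {p : ι} (hp : p ∉ P) (g : ι → ℝ) (k : ℕ) :
    truncSieveSum (insert p P) g (k + 1) =
      truncSieveSum P g (k + 1) - g p * truncSieveSum P g k := by
  unfold truncSieveSum
  rw [Finset.sum_powerset_insert hp, sub_eq_add_neg, Finset.mul_sum, ← Finset.sum_neg_distrib]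
  congr 1
  refine Finset.sum_congr rfl fun T hT => ?_
  have hpT : p ∉ T := fun h => hp (Finset.mem_powerset.1 hT h)
  rw [Finset.card_insert_of_notMem hpT, Finset.prod_insert hpT]
  simp only [Nat.add_lt_add_iff_right]
  split_ifs <;> ring

lemma elemSymmSum_insert {P : Finset ι} {p : ι} (hp : p ∉ P) (g : ι → ℝ) (k : ℕ) :
    elemSymmSum (insert p P) g (k + 1) =
      elemSymmSum P g (k + 1) + g p * elemSymmSum P g k := by
  unfold elemSymmSum
  rw [Finset.sum_powerset_insert hp, Finset.mul_sum]
  congr 1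
  refine Finset.sum_congr rfl fun T hT => ?_
  have hpT : p ∉ T := fun h => hp (Finset.mem_powerset.1 hT h)
  rw [Finset.card_insert_of_notMem hpT, Finset.prod_insert hpT]
  simp only [Nat.add_right_cancel_iff]
  split_ifs <;> ring

/-- Bonferroni inequalities in weighted form. -/
lemma bonferroni (P : Finset ι) (g : ι → ℝ) (hg0 : ∀ p ∈ P, 0 ≤ g p) (hg1 : ∀ p ∈ P, g p ≤ 1) :
    ∀ k : ℕ, 0 ≤ (-1) ^ (k + 1) * (truncSieveSum P g k - ∏ p ∈ P, (1 - g p)) ∧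
      (-1) ^ (k + 1) * (truncSieveSum P g k - ∏ p ∈ P, (1 - g p)) ≤ elemSymmSum P g k := by
  induction P using Finset.induction_on with
  | empty =>
    intro k
    rcases k with _ | k
    · simp [truncSieveSum, elemSymmSum]
    · simp [truncSieveSum, elemSymmSum]
  | insert p P hp ih =>
    have ih' := ih (fun q hq => hg0 q (Finset.mem_insert_of_mem hq))
      (fun q hq => hg1 q (Finset.mem_insert_of_mem hq))
    have h0 := hg0 p (Finset.mem_insert_self p P)
    intro k
    rcases k with _ | k
    · rw [truncSieveSum_zero, elemSymmSum_zero]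
      have h1 : 0 ≤ ∏ q ∈ insert p P, (1 - g q) :=
        Finset.prod_nonneg fun q hq => by linarith [hg1 q hq]
      have h2 : ∏ q ∈ insert p P, (1 - g q) ≤ 1 :=
        Finset.prod_le_one (fun q hq => by linarith [hg1 q hq]) fun q hq => by linarith [hg0 q hq]
      constructor <;> norm_num <;> assumption
    · rw [truncSieveSum_insert hp, elemSymmSum_insert hp, Finset.prod_insert hp]
      obtain ⟨a1, a2⟩ := ih' (k + 1)
      obtain ⟨b1, b2⟩ := ih' k
      have key : (-1 : ℝ) ^ (k + 1 + 1) * (truncSieveSum P g (k + 1) - g p * truncSieveSum P g k -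
          (1 - g p) * ∏ q ∈ P, (1 - g q)) =
          (-1) ^ (k + 1 + 1) * (truncSieveSum P g (k + 1) - ∏ q ∈ P, (1 - g q)) +
          g p * ((-1) ^ (k + 1) * (truncSieveSum P g k - ∏ q ∈ P, (1 - g q))) := by
        ring
      rw [key]
      have b3 := mul_nonneg h0 b1
      have b4 := mul_le_mul_of_nonneg_left b2 h0
      constructor <;> linarith

lemma sum_powerset_prod_le_exp (P : Finset ι) (g : ι → ℝ) (hg0 : ∀ p ∈ P, 0 ≤ g p) :
    ∑ T ∈ P.powerset, ∏ p ∈ T, g p ≤ Real.exp (∑ p ∈ P, g p) := by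
  rw [← Finset.prod_one_add, Real.exp_sum]
  refine Finset.prod_le_prod (fun p hp => by linarith [hg0 p hp]) fun p _ => ?_
  linarith [Real.add_one_le_exp (g p)]

lemma elemSymmSum_le (P : Finset ι) (g : ι → ℝ) (hg0 : ∀ p ∈ P, 0 ≤ g p) (k : ℕ) :
    elemSymmSum P g k ≤ Real.exp (Real.exp 1 * ∑ p ∈ P, g p - k) := by
  have h1 := sum_powerset_prod_le_exp P (fun p => Real.exp 1 * g p)
    (fun p hp => mul_nonneg (Real.exp_pos _).le (hg0 p hp))
  rw [← Finset.mul_sum] at h1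
  rw [Real.exp_sub, le_div_iff₀ (Real.exp_pos _)]
  refine le_trans ?_ h1
  unfold elemSymmSum
  rw [Finset.sum_mul]
  refine Finset.sum_le_sum fun T hT => ?_
  have hT0 : ∀ p ∈ T, 0 ≤ g p := fun p hp => hg0 p (Finset.mem_powerset.1 hT hp)
  split_ifs with h
  · rw [Finset.prod_mul_distrib, Finset.prod_const, h, ← Real.exp_nat_mul, mul_one, mul_comm]
  · rw [zero_mul]
    exact Finset.prod_nonneg fun p hp => mul_nonneg (Real.exp_pos _).le (hT0 p hp)

lemma sum_powerset_card_lt_prod_le (P : Finset ι) (g : ι → ℝ) (hg0 : ∀ p ∈ P, 0 ≤ g p) (k : ℕ) :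
    ∑ T ∈ P.powerset, (if T.card < k then ∏ p ∈ T, g p else 0) ≤
      3 * (1 + ∑ p ∈ P, g p) ^ k := by
  set S : ℝ := 1 + ∑ p ∈ P, g p with hS
  have hs0 : 0 ≤ ∑ p ∈ P, g p := Finset.sum_nonneg hg0
  have hS1 : 1 ≤ S := by linarith
  have h1 := sum_powerset_prod_le_exp P (fun p => g p / S)
    (fun p hp => div_nonneg (hg0 p hp) (by linarith))
  rw [← Finset.sum_div] at h1
  have h2 : Real.exp ((∑ p ∈ P, g p) / S) ≤ 3 := by
    have h3 : (∑ p ∈ P, g p) / S ≤ 1 := (div_le_one (by linarith)).2 (by linarith)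
    refine (Real.exp_le_exp.2 h3).trans ?_
    linarith [Real.exp_one_lt_d9]
  calc _ ≤ ∑ T ∈ P.powerset, (∏ p ∈ T, g p / S) * S ^ k := by
        refine Finset.sum_le_sum fun T hT => ?_
        have hT0 : ∀ p ∈ T, 0 ≤ g p := fun p hp => hg0 p (Finset.mem_powerset.1 hT hp)
        have hT1 := Finset.prod_nonneg hT0
        rw [Finset.prod_div_distrib, Finset.prod_const]
        have hSp : 0 < S ^ T.card := by positivity
        split_ifs with h
        · rw [div_mul_eq_mul_div, le_div_iff₀ hSp]
          gcongr
        · positivity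
    _ = (∑ T ∈ P.powerset, ∏ p ∈ T, g p / S) * S ^ k := by rw [Finset.sum_mul]
    _ ≤ 3 * S ^ k := by
        gcongr
        exact h1.trans h2

end Bonferroni

lemma exists_residues_mod_prod (R : ℕ → Finset ℕ) (T : Finset ℕ) (hT : ∀ p ∈ T, p.Prime)
    (hR : ∀ p ∈ T, R p ⊆ Finset.range p) :
    ∃ V : Finset ℕ, V ⊆ Finset.range (∏ p ∈ T, p) ∧ V.card = ∏ p ∈ T, (R p).card ∧
      ∀ q : ℕ, (∀ p ∈ T, q % p ∈ R p) ↔ q % (∏ p ∈ T, p) ∈ V := by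
  induction T using Finset.induction_on with
  | empty =>
    refine ⟨{0}, by simp, by simp, fun q => by simp [Nat.mod_one]⟩
  | insert p T hp ih =>
    obtain ⟨V, hV1, hV2, hV3⟩ := ih (fun q hq => hT q (Finset.mem_insert_of_mem hq))
      (fun q hq => hR q (Finset.mem_insert_of_mem hq))
    set d := ∏ q ∈ T, q with hd
    have hpp := hT p (Finset.mem_insert_self p T)
    have hcop : p.Coprime d := by
      refine Nat.Coprime.prod_right fun q hq => ?_
      exact (Nat.coprime_primes hpp (hT q (Finset.mem_insert_of_mem hq))).2
        fun h => hp (h ▸ hq)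
    have hd0 : 0 < d := Finset.prod_pos fun q hq => (hT q (Finset.mem_insert_of_mem hq)).pos
    have hRp := hR p (Finset.mem_insert_self p T)
    refine ⟨(Finset.range (p * d)).filter (fun x => x % p ∈ R p ∧ x % d ∈ V), ?_, ?_, ?_⟩
    · rw [Finset.prod_insert hp]
      exact Finset.filter_subset _ _
    · rw [Finset.prod_insert hp, ← hV2, ← Finset.card_product]
      refine Finset.card_nbij (fun x => (x % p, x % d)) ?_ ?_ ?_
      · intro x hx
        simp only [Finset.coe_filter, Set.mem_ofPred_eq] at hx
        exact Finset.mem_product.2 hx.2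
      · intro x hx x' hx' hxx
        simp only [Finset.coe_filter, Set.mem_ofPred_eq, Finset.mem_range] at hx hx'
        simp only [Prod.mk.injEq] at hxx
        have h1 : x ≡ x' [MOD p * d] := (Nat.modEq_and_modEq_iff_modEq_mul hcop).1 hxx
        exact h1.eq_of_lt_of_lt hx.1 hx'.1
      · rintro ⟨a, b⟩ hab
        obtain ⟨ha, hb⟩ := Finset.mem_product.1 hab
        simp only at ha hb
        have ha' := Finset.mem_range.1 (hRp ha)
        have hb' := Finset.mem_range.1 (hV1 hb)
        obtain ⟨x, hx1, hx2⟩ := Nat.chineseRemainder hcop a b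
        have e1 : x % (p * d) % p = a := by
          rw [Nat.mod_mul_right_mod, hx1, Nat.mod_eq_of_lt ha']
        have e2 : x % (p * d) % d = b := by
          rw [Nat.mod_mul_left_mod, hx2, Nat.mod_eq_of_lt hb']
        refine ⟨x % (p * d), ?_, ?_⟩
        · simp only [Finset.coe_filter, Set.mem_ofPred_eq, Finset.mem_range]
          exact ⟨Nat.mod_lt _ (Nat.mul_pos hpp.pos hd0), by rwa [e1], by rwa [e2]⟩
        · simp only [e1, e2]
    · intro q
      rw [Finset.prod_insert hp, Finset.forall_mem_insert, hV3 q, Finset.mem_filter,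
        Nat.mod_mul_right_mod, Nat.mod_mul_left_mod, Finset.mem_range]
      exact ⟨fun h => ⟨Nat.mod_lt _ (Nat.mul_pos hpp.pos hd0), h⟩, fun h => h.2⟩

lemma abs_card_residues_sub_le (d : ℕ) (hd : 0 < d) (V : Finset ℕ) (hV : V ⊆ Finset.range d)
    (Y : ℕ) :
    |(((Finset.range Y).filter (fun q => q % d ∈ V)).card : ℝ) - Y * (V.card / d)| ≤ V.card := by
  have h1 : ((Finset.range Y).filter (fun q => q % d ∈ V)).card =
      ∑ v ∈ V, ((Finset.range Y).filter (fun q => q % d = v)).card := by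
    rw [Finset.card_eq_sum_card_fiberwise (f := fun q => q % d) (t := V)
      (fun x hx => by simpa using (Finset.mem_filter.1 hx).2)]
    refine Finset.sum_congr rfl fun v hv => ?_
    congr 1
    ext q
    simp only [Finset.mem_filter]
    constructor
    · rintro ⟨⟨a, b⟩, c⟩; exact ⟨a, c⟩
    · rintro ⟨a, c⟩; exact ⟨⟨a, c ▸ hv⟩, c⟩
  have h2 : ∀ v ∈ V,
      |(((Finset.range Y).filter (fun q => q % d = v)).card : ℝ) - Y / d| ≤ 1 := by
    intro v hv
    have hvd : v < d := Finset.mem_range.1 (hV hv)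
    have h3 : ((Finset.range Y).filter (fun q => q % d = v)).card =
        Y / d + if v % d < Y % d then 1 else 0 := by
      rw [← Nat.count_modEq_card Y hd v, Nat.count_eq_card_filter_range]
      congr 1
      ext q
      simp [Nat.ModEq, Nat.mod_eq_of_lt hvd]
    rw [h3]
    have hd' : (0 : ℝ) < d := by exact_mod_cast hd
    have h4 : (Y : ℝ) / d = ((Y / d : ℕ) : ℝ) + ((Y % d : ℕ) : ℝ) / d := by
      rw [eq_comm, ← mul_right_inj' hd'.ne', mul_add, mul_div_cancel₀ _ hd'.ne',
        mul_div_cancel₀ _ hd'.ne']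
      exact_mod_cast Nat.div_add_mod Y d
    have h5 : ((Y % d : ℕ) : ℝ) / d ≤ 1 := by
      rw [div_le_one hd']
      exact_mod_cast (Nat.mod_lt Y hd).le
    have h6 : 0 ≤ ((Y % d : ℕ) : ℝ) / d := by positivity
    rw [h4]
    split_ifs <;> push_cast <;> rw [abs_le] <;> constructor <;> linarith
  have h3 : (((Finset.range Y).filter (fun q => q % d ∈ V)).card : ℝ) - Y * (V.card / d) =
      ∑ v ∈ V, ((((Finset.range Y).filter (fun q => q % d = v)).card : ℝ) - Y / d) := by
    rw [h1, Finset.sum_sub_distrib, Finset.sum_const, nsmul_eq_mul]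
    push_cast
    ring
  rw [h3]
  refine (Finset.abs_sum_le_sum_abs _ _).trans ((Finset.sum_le_sum h2).trans ?_)
  simp

/-- Brun's pure sieve. -/
lemma brun_pure_sieve (P : Finset ℕ) (hP : ∀ p ∈ P, p.Prime) (R : ℕ → Finset ℕ)
    (hR : ∀ p ∈ P, R p ⊆ Finset.range p) (Y k : ℕ) (hk : Odd k) :
    (((Finset.range Y).filter (fun q => ∀ p ∈ P, q % p ∉ R p)).card : ℝ) ≤
      Y * (∏ p ∈ P, (1 - ((R p).card : ℝ) / p)) +
      Y * Real.exp (Real.exp 1 * ∑ p ∈ P, ((R p).card : ℝ) / p - k) +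
      3 * (1 + ∑ p ∈ P, ((R p).card : ℝ)) ^ k := by
  have hsign : (-1 : ℝ) ^ (k + 1) = 1 := (hk.add_one).neg_one_pow
  have hle1 : ∀ p ∈ P, ((R p).card : ℝ) / p ≤ 1 := fun p hp => by
    have h1 : (R p).card ≤ p := by simpa using Finset.card_le_card (hR p hp)
    exact div_le_one_of_le₀ (by exact_mod_cast h1) (Nat.cast_nonneg p)
  have hpt : ∀ q ∈ Finset.range Y, (if ∀ p ∈ P, q % p ∉ R p then (1 : ℝ) else 0) ≤
      truncSieveSum P (fun p => if q % p ∈ R p then 1 else 0) k := by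
    intro q _
    have h1 := (bonferroni P (fun p => if q % p ∈ R p then (1 : ℝ) else 0)
      (fun p _ => by positivity) (fun p _ => by split_ifs <;> norm_num) k).1
    rw [hsign, one_mul] at h1
    have h2 : ∏ p ∈ P, (1 - if q % p ∈ R p then (1 : ℝ) else 0) =
        if ∀ p ∈ P, q % p ∉ R p then (1 : ℝ) else 0 := by
      split_ifs with h
      · exact Finset.prod_eq_one fun p hp => by rw [if_neg (h p hp), sub_zero]
      · push Not at h
        obtain ⟨p, hp, hpr⟩ := h
        exact Finset.prod_eq_zero hp (by rw [if_pos hpr, sub_self])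
    linarith
  have hcount : (((Finset.range Y).filter (fun q => ∀ p ∈ P, q % p ∉ R p)).card : ℝ) ≤
      ∑ q ∈ Finset.range Y, truncSieveSum P (fun p => if q % p ∈ R p then 1 else 0) k := by
    refine le_trans (le_of_eq ?_) (Finset.sum_le_sum hpt)
    rw [Finset.sum_boole]
  have hswap : ∑ q ∈ Finset.range Y, truncSieveSum P (fun p => if q % p ∈ R p then 1 else 0) k =
      ∑ T ∈ P.powerset, if T.card < k then (-1) ^ T.card *
        (((Finset.range Y).filter (fun q => ∀ p ∈ T, q % p ∈ R p)).card : ℝ) else 0 := by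
    unfold truncSieveSum
    rw [Finset.sum_comm]
    refine Finset.sum_congr rfl fun T _ => ?_
    split_ifs with h
    · rw [← Finset.mul_sum, ← Finset.sum_boole]
      congr 1
      refine Finset.sum_congr rfl fun q _ => ?_
      rw [Finset.prod_ite_zero]
      simp
    · simp
  have hT : ∀ T ∈ P.powerset, (if T.card < k then (-1) ^ T.card *
        (((Finset.range Y).filter (fun q => ∀ p ∈ T, q % p ∈ R p)).card : ℝ) else 0) ≤
      Y * (if T.card < k then (-1) ^ T.card * ∏ p ∈ T, ((R p).card : ℝ) / p else 0) +
      (if T.card < k then ∏ p ∈ T, ((R p).card : ℝ) else 0) := by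
    intro T hTP
    have hsub := Finset.mem_powerset.1 hTP
    obtain ⟨V, hV1, hV2, hV3⟩ := exists_residues_mod_prod R T (fun p hp => hP p (hsub hp))
      (fun p hp => hR p (hsub hp))
    have hd0 : 0 < ∏ p ∈ T, p := Finset.prod_pos fun p hp => (hP p (hsub hp)).pos
    have h1 := abs_card_residues_sub_le _ hd0 V hV1 Y
    simp_rw [← hV3] at h1
    rw [hV2] at h1
    split_ifs with h
    · push_cast at h1
      rw [Finset.prod_div_distrib]
      set a : ℝ := (((Finset.range Y).filter (fun q => ∀ p ∈ T, q % p ∈ R p)).card : ℝ)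
      set b : ℝ := (∏ p ∈ T, ((R p).card : ℝ)) / ∏ p ∈ T, (p : ℝ)
      have h2 : (-1 : ℝ) ^ T.card * (a - Y * b) ≤ |a - Y * b| := by
        refine (le_abs_self _).trans ?_
        rw [abs_mul, abs_pow, abs_neg, abs_one, one_pow, one_mul]
      have h3 : (-1 : ℝ) ^ T.card * a = (Y : ℝ) * ((-1) ^ T.card * b) +
        (-1 : ℝ) ^ T.card * (a - Y * b) := by ring
      rw [h3]
      linarith
    · simp
  have hmain := Finset.sum_le_sum hT
  rw [Finset.sum_add_distrib, ← Finset.mul_sum] at hmain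
  have hb := (bonferroni P (fun p => ((R p).card : ℝ) / p) (fun p _ => by positivity) hle1 k).2
  rw [hsign, one_mul] at hb
  have he := elemSymmSum_le P (fun p => ((R p).card : ℝ) / p) (fun p _ => by positivity) k
  have hr := sum_powerset_card_lt_prod_le P (fun p => ((R p).card : ℝ)) (fun p _ => by positivity) k
  rw [hswap] at hcount
  have hfin : truncSieveSum P (fun p => ((R p).card : ℝ) / p) k ≤
      (∏ p ∈ P, (1 - ((R p).card : ℝ) / p)) +
      Real.exp (Real.exp 1 * ∑ p ∈ P, ((R p).card : ℝ) / p - k) := by linarith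
  have hY : (0 : ℝ) ≤ Y := Nat.cast_nonneg Y
  have h9 := mul_le_mul_of_nonneg_left hfin hY
  unfold truncSieveSum at h9
  rw [mul_add] at h9
  linarith

/-- Residues modulo `p` that are forbidden for `q` when `q`, `m * q + 1` and `n - (m * q + 1)` are
all coprime to `p`. -/
lemma exists_forbidden_residues {p : ℕ} (hp : p.Prime) (m n : ℕ) (hn : 1 ≤ n) :
    ∃ R : Finset ℕ, R ⊆ Finset.range p ∧ R.card ≤ 3 ∧
      (∀ q : ℕ, q % p ∈ R → m * q + 1 ≤ n → p ∣ q ∨ p ∣ m * q + 1 ∨ p ∣ n - (m * q + 1)) ∧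
      1 - (R.card : ℝ) / p ≤ (1 - 1 / (p : ℝ)) ^ 3 *
        (if p ∣ m then ((1 - 1 / (p : ℝ))⁻¹) ^ 2 else 1) *
        (if p ∣ n * (n - 1) then (1 - 1 / (p : ℝ))⁻¹ else 1) := by
  have : Fact p.Prime := ⟨hp⟩
  obtain ⟨hc1, hc2⟩ := one_sub_inv_prime_bounds hp
  set c : ℝ := 1 - 1 / (p : ℝ) with hc
  have hc0 : 0 < c := by linarith
  have hcinv : 1 ≤ c⁻¹ := (one_le_inv₀ hc0).2 hc2.le
  have hbern : ∀ j : ℕ, 1 - (j : ℝ) / p ≤ c ^ j := by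
    intro j
    have h := one_add_mul_le_pow (a := -(1 / (p : ℝ))) (by linarith) j
    have e1 : 1 + (j : ℝ) * -(1 / (p : ℝ)) = 1 - (j : ℝ) / p := by ring
    have e2 : 1 + -(1 / (p : ℝ)) = c := by rw [hc]; ring
    rwa [e1, e2] at h
  by_cases hm : p ∣ m
  · refine ⟨{0}, by simpa using hp.pos, by simp, ?_, ?_⟩
    · intro q hq _
      exact Or.inl (Nat.dvd_of_mod_eq_zero (Finset.mem_singleton.1 hq))
    · rw [if_pos hm, Finset.card_singleton]
      have h1 : c ^ 3 * c⁻¹ ^ 2 = c := by field_simp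
      rw [h1, hc]
      push_cast
      rw [← hc]
      split_ifs
      · exact le_mul_of_one_le_right hc0.le hcinv
      · simp
  · have hm0 : (m : ZMod p) ≠ 0 := by rwa [Ne, ZMod.natCast_eq_zero_iff]
    set z1 : ZMod p := -(m : ZMod p)⁻¹ with hz1
    set z2 : ZMod p := ((n : ZMod p) - 1) * (m : ZMod p)⁻¹ with hz2
    have hmz1 : (m : ZMod p) * z1 + 1 = 0 := by
      rw [hz1, mul_neg, mul_inv_cancel₀ hm0]; ring
    have hmz2 : (n : ZMod p) - (m * z2 + 1) = 0 := by
      rw [hz2, mul_comm ((n : ZMod p) - 1), mul_inv_cancel_left₀ hm0]; ring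
    have hz10 : z1.val ≠ 0 := by
      rw [Ne, ZMod.val_eq_zero, hz1, neg_eq_zero]
      exact inv_ne_zero hm0
    have hval : ∀ (q : ℕ) (z : ZMod p), q % p = z.val → (q : ZMod p) = z := by
      intro q z h
      apply ZMod.val_injective
      rw [ZMod.val_natCast, h]
    have hd1 : ∀ q : ℕ, q % p = z1.val → p ∣ m * q + 1 := by
      intro q hq
      rw [← ZMod.natCast_eq_zero_iff]
      push_cast
      rw [hval q z1 hq, hmz1]
    have hd2 : ∀ q : ℕ, q % p = z2.val → m * q + 1 ≤ n → p ∣ n - (m * q + 1) := by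
      intro q hq hqn
      rw [← ZMod.natCast_eq_zero_iff, Nat.cast_sub hqn]
      push_cast
      rw [hval q z2 hq, hmz2]
    by_cases hnn : p ∣ n * (n - 1)
    · have hcard : ({0, z1.val} : Finset ℕ).card = 2 := Finset.card_pair hz10.symm
      refine ⟨{0, z1.val}, ?_, by omega, ?_, ?_⟩
      · intro x hx
        simp only [Finset.mem_insert, Finset.mem_singleton] at hx
        rcases hx with rfl | rfl
        · exact Finset.mem_range.2 hp.pos
        · exact Finset.mem_range.2 (ZMod.val_lt _)
      · intro q hq _
        simp only [Finset.mem_insert, Finset.mem_singleton] at hq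
        rcases hq with h | h
        · exact Or.inl (Nat.dvd_of_mod_eq_zero h)
        · exact Or.inr (Or.inl (hd1 q h))
      · rw [if_neg hm, if_pos hnn, hcard]
        have h1 : c ^ 3 * 1 * c⁻¹ = c ^ 2 := by field_simp
        rw [h1]
        exact hbern 2
    · have hn1 : ¬ p ∣ n := fun h => hnn (h.mul_right _)
      have hn2 : ¬ p ∣ n - 1 := fun h => hnn (h.mul_left _)
      have hz20 : z2.val ≠ 0 := by
        rw [Ne, ZMod.val_eq_zero, hz2, mul_eq_zero, not_or]
        refine ⟨?_, inv_ne_zero hm0⟩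
        rw [← ZMod.natCast_eq_zero_iff, Nat.cast_sub hn] at hn2
        simpa using hn2
      have hz12 : z1.val ≠ z2.val := by
        intro h
        have h2 := ZMod.val_injective p h
        rw [← h2, hmz1, sub_zero, ZMod.natCast_eq_zero_iff] at hmz2
        exact hn1 hmz2
      have hcard : ({0, z1.val, z2.val} : Finset ℕ).card = 3 := by
        rw [Finset.card_eq_three]
        exact ⟨_, _, _, hz10.symm, hz20.symm, hz12, rfl⟩
      refine ⟨{0, z1.val, z2.val}, ?_, by omega, ?_, ?_⟩
      · intro x hx
        simp only [Finset.mem_insert, Finset.mem_singleton] at hx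
        rcases hx with rfl | rfl | rfl
        · exact Finset.mem_range.2 hp.pos
        · exact Finset.mem_range.2 (ZMod.val_lt _)
        · exact Finset.mem_range.2 (ZMod.val_lt _)
      · intro q hq hqn
        simp only [Finset.mem_insert, Finset.mem_singleton] at hq
        rcases hq with h | h | h
        · exact Or.inl (Nat.dvd_of_mod_eq_zero h)
        · exact Or.inr (Or.inl (hd1 q h))
        · exact Or.inr (Or.inr (hd2 q h hqn))
      · rw [if_neg hm, if_neg hnn, hcard, mul_one, mul_one]
        exact hbern 3

/-- Those `q < Y` for which `q`, `m * q + 1`, `n - (m * q + 1)` are primes, with the first and the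
last of them at least `w`. -/
def primeTriples (m n Y w : ℕ) : Finset ℕ :=
  (Finset.range Y).filter fun q => q.Prime ∧ (m * q + 1).Prime ∧ (n - (m * q + 1)).Prime ∧
    w ≤ q ∧ w ≤ n - (m * q + 1)

lemma prod_primesBelow_ite_dvd_le (w m : ℕ) (hm : m ≠ 0) (f : ℕ → ℝ)
    (hf : ∀ p : ℕ, p.Prime → 1 ≤ f p) :
    ∏ p ∈ w.primesBelow, (if p ∣ m then f p else 1) ≤ ∏ p ∈ m.primeFactors, f p := by
  rw [← Finset.prod_filter]
  refine Finset.prod_le_prod_of_subset_of_one_le ?_ ?_ ?_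
  · intro p hp
    rw [Finset.mem_filter] at hp
    exact Nat.mem_primeFactors.2 ⟨Nat.prime_of_mem_primesBelow hp.1, hp.2, hm⟩
  · intro p hp
    rw [Finset.mem_filter] at hp
    linarith [hf p (Nat.prime_of_mem_primesBelow hp.1)]
  · intro p hp _
    exact hf p (Nat.prime_of_mem_primeFactors hp)

lemma exists_card_primeTriples_le :
    ∃ C : ℝ, 0 < C ∧ ∀ m n Y w k : ℕ, m ≠ 0 → 2 ≤ n → 3 ≤ w → Odd k →
      ((primeTriples m n Y w).card : ℝ) ≤
        Y * ((1 / Real.log w) ^ 3 * totientRatioSq m *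
          ∏ p ∈ (n * (n - 1)).primeFactors, (1 - 1 / (p : ℝ))⁻¹) +
        Y * (C * Real.log w ^ 9 * Real.exp (-k)) + 3 * (1 + 3 * (w : ℝ)) ^ k := by
  obtain ⟨C, hC, hM⟩ := exists_sum_inv_primesBelow_le
  refine ⟨Real.exp (9 * C), Real.exp_pos _, fun m n Y w k hm hn hw hk => ?_⟩
  have hlog := one_lt_log_natCast hw
  have hR : ∀ p : ℕ, ∃ R : Finset ℕ, p ∈ w.primesBelow → (R ⊆ Finset.range p ∧ R.card ≤ 3 ∧
      (∀ q : ℕ, q % p ∈ R → m * q + 1 ≤ n → p ∣ q ∨ p ∣ m * q + 1 ∨ p ∣ n - (m * q + 1)) ∧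
      1 - (R.card : ℝ) / p ≤ (1 - 1 / (p : ℝ)) ^ 3 *
        (if p ∣ m then ((1 - 1 / (p : ℝ))⁻¹) ^ 2 else 1) *
        (if p ∣ n * (n - 1) then (1 - 1 / (p : ℝ))⁻¹ else 1)) := by
    intro p
    by_cases hp : p ∈ w.primesBelow
    · obtain ⟨R, h⟩ := exists_forbidden_residues (Nat.prime_of_mem_primesBelow hp) m n (by omega)
      exact ⟨R, fun _ => h⟩
    · exact ⟨∅, fun h => absurd h hp⟩
  choose R hR using hR
  have hsub : primeTriples m n Y w ⊆
      (Finset.range Y).filter (fun q => ∀ p ∈ w.primesBelow, q % p ∉ R p) := by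
    intro q hq
    unfold primeTriples at hq
    rw [Finset.mem_filter] at hq ⊢
    obtain ⟨hqY, h1, h2, h3, h4, h5⟩ := hq
    refine ⟨hqY, fun p hp hqp => ?_⟩
    have hpw := Nat.lt_of_mem_primesBelow hp
    have hpp := Nat.prime_of_mem_primesBelow hp
    have hle : m * q + 1 ≤ n := by
      have := h3.pos
      omega
    have hqm : q ≤ m * q := Nat.le_mul_of_pos_left q (Nat.pos_of_ne_zero hm)
    rcases (hR p hp).2.2.1 q hqp hle with h | h | h
    · have := (Nat.prime_dvd_prime_iff_eq hpp h1).1 h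
      omega
    · have := (Nat.prime_dvd_prime_iff_eq hpp h2).1 h
      omega
    · have := (Nat.prime_dvd_prime_iff_eq hpp h3).1 h
      omega
  have hcard : ((primeTriples m n Y w).card : ℝ) ≤
      (((Finset.range Y).filter (fun q => ∀ p ∈ w.primesBelow, q % p ∉ R p)).card : ℝ) := by
    exact_mod_cast Finset.card_le_card hsub
  refine hcard.trans ((brun_pure_sieve w.primesBelow (fun p hp => Nat.prime_of_mem_primesBelow hp)
    R (fun p hp => (hR p hp).1) Y k hk).trans ?_)
  have hcard3 : ∀ p ∈ w.primesBelow, ((R p).card : ℝ) ≤ 3 := fun p hp => by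
    exact_mod_cast (hR p hp).2.1
  have hA : ∏ p ∈ w.primesBelow, (1 - ((R p).card : ℝ) / p) ≤
      (1 / Real.log w) ^ 3 * totientRatioSq m *
          ∏ p ∈ (n * (n - 1)).primeFactors, (1 - 1 / (p : ℝ))⁻¹ := by
    have h1 : ∏ p ∈ w.primesBelow, (1 - ((R p).card : ℝ) / p) ≤
        ∏ p ∈ w.primesBelow, ((1 - 1 / (p : ℝ)) ^ 3 *
        (if p ∣ m then ((1 - 1 / (p : ℝ))⁻¹) ^ 2 else 1) *
        (if p ∣ n * (n - 1) then (1 - 1 / (p : ℝ))⁻¹ else 1)) := by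
      refine Finset.prod_le_prod (fun p hp => ?_) fun p hp => (hR p hp).2.2.2
      have h2 : (R p).card ≤ p := by simpa using Finset.card_le_card (hR p hp).1
      have h3 : ((R p).card : ℝ) / p ≤ 1 :=
        div_le_one_of_le₀ (by exact_mod_cast h2) (Nat.cast_nonneg p)
      linarith
    refine h1.trans ?_
    rw [Finset.prod_mul_distrib, Finset.prod_mul_distrib, Finset.prod_pow]
    have h2 := prod_one_sub_inv_primesBelow_le w (by omega)
    have h3 := prod_primesBelow_ite_dvd_le w m hm (fun p => ((1 - 1 / (p : ℝ))⁻¹) ^ 2)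
      (fun p hp => one_le_pow₀ (one_le_inv_one_sub_inv_prime hp))
    have h4 := prod_primesBelow_ite_dvd_le w (n * (n - 1))
      (Nat.mul_ne_zero (by omega) (by omega)) (fun p => (1 - 1 / (p : ℝ))⁻¹)
      (fun p hp => one_le_inv_one_sub_inv_prime hp)
    have h5 : 0 ≤ ∏ p ∈ w.primesBelow, (1 - 1 / (p : ℝ)) := Finset.prod_nonneg fun p hp => by
      linarith [(one_sub_inv_prime_bounds (Nat.prime_of_mem_primesBelow hp)).1]
    have h6 : 0 ≤ ∏ p ∈ w.primesBelow, (if p ∣ m then ((1 - 1 / (p : ℝ))⁻¹) ^ 2 else 1) :=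
      Finset.prod_nonneg fun p hp => by split_ifs <;> positivity
    have h7 : 0 ≤ ∏ p ∈ w.primesBelow, (if p ∣ n * (n - 1) then (1 - 1 / (p : ℝ))⁻¹ else 1) :=
      Finset.prod_nonneg fun p hp => by
        have := one_le_inv_one_sub_inv_prime (Nat.prime_of_mem_primesBelow hp)
        split_ifs <;> linarith
    have h8 := one_le_totientRatioSq m
    unfold totientRatioSq at h8 ⊢
    gcongr
  have hB : Real.exp (Real.exp 1 * ∑ p ∈ w.primesBelow, ((R p).card : ℝ) / p - k) ≤
      Real.exp (9 * C) * Real.log w ^ 9 * Real.exp (-k) := by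
    have h1 : ∑ p ∈ w.primesBelow, ((R p).card : ℝ) / p ≤ 3 * (Real.log (Real.log w) + C) := by
      refine le_trans ?_ (mul_le_mul_of_nonneg_left (hM w hw) (by norm_num))
      rw [Finset.mul_sum]
      refine Finset.sum_le_sum fun p hp => ?_
      rw [mul_one_div]
      gcongr
      exact hcard3 p hp
    have hll : 0 ≤ Real.log (Real.log w) := Real.log_nonneg hlog.le
    have h2 : Real.exp 1 * ∑ p ∈ w.primesBelow, ((R p).card : ℝ) / p ≤
        3 * (3 * (Real.log (Real.log w) + C)) := by
      have h3 : Real.exp 1 ≤ 3 := by linarith [Real.exp_one_lt_d9]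
      have h4 : 0 ≤ ∑ p ∈ w.primesBelow, ((R p).card : ℝ) / p :=
        Finset.sum_nonneg fun p _ => by positivity
      gcongr
    have h3 : Real.log (w : ℝ) ^ 9 = Real.exp (9 * Real.log (Real.log w)) := by
      rw [← Real.exp_log (by linarith : 0 < Real.log (w : ℝ)), ← Real.exp_nat_mul, Real.log_exp]
      norm_num
    rw [h3, ← Real.exp_add, ← Real.exp_add, Real.exp_le_exp]
    linarith
  have hE : (1 + ∑ p ∈ w.primesBelow, ((R p).card : ℝ)) ^ k ≤ (1 + 3 * (w : ℝ)) ^ k := by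
    have h1 : ∑ p ∈ w.primesBelow, ((R p).card : ℝ) ≤ 3 * (w : ℝ) := by
      refine (Finset.sum_le_sum hcard3).trans ?_
      have h2 : (w.primesBelow.card : ℝ) ≤ w := by
        exact_mod_cast (Finset.card_filter_le _ _).trans (by simp)
      rw [Finset.sum_const, nsmul_eq_mul]
      linarith
    have h2 : 0 ≤ ∑ p ∈ w.primesBelow, ((R p).card : ℝ) :=
      Finset.sum_nonneg fun p _ => by positivity
    gcongr
  gcongr

set_option maxHeartbeats 1000000 in
/-- Sieve bound for `primeTriples` when `m ≤ N * exp (-log N / u)`. -/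
lemma exists_card_primeTriples_le_of_large :
    ∃ C : ℝ, 0 < C ∧ ∀ N n m w : ℕ, ∀ L l u : ℝ, 2 ≤ N → L = Real.log N → l = Real.log L → 3 ≤ l →
      30000 * l ^ 2 ≤ L → 1 ≤ u → u ≤ 200 * l → 2 ≤ n → n ≤ N → m ≠ 0 →
      m * Real.exp (L / u) ≤ N → w = ⌊Real.exp (L / (60 * u * l))⌋₊ →
      ((primeTriples m n (N / m + 1) w).card : ℝ) ≤
        C * (N * totientRatioSq m / m) * ((u * l) ^ 3 * l / L ^ 3) := by
  obtain ⟨C1, hC1, hS⟩ := exists_card_primeTriples_le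
  obtain ⟨C2, hC2, hH⟩ := exists_prod_primeFactors_inv_one_sub_inv_le
  refine ⟨4 * 120 ^ 3 * C2 + 2 * C1 + 3, by positivity, ?_⟩
  intro N n m w L l u hN hL hl hl3 hbig hu1 hu2 hn hnN hm hmN hw
  have hl0 : 0 < l := by linarith
  have hu0 : 0 < u := by linarith
  have hll : 3 * l ≤ l ^ 2 := by nlinarith
  have hL5 : 5 ≤ L := by linarith
  have hL0 : 0 < L := by linarith
  have hm0 : (0 : ℝ) < m := by exact_mod_cast Nat.pos_of_ne_zero hm
  have hN0 : (0 : ℝ) < N := by positivity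
  have hul : u * l ≤ 200 * l ^ 2 := by nlinarith
  have hul1 : 1 ≤ u * l := by nlinarith
  have hexpl : Real.exp l = L := by rw [hl, Real.exp_log hL0]
  have hexpL : Real.exp L = N := by rw [hL, Real.exp_log hN0]
  set t : ℝ := L / (60 * u * l) with ht
  have ht2 : 2 ≤ t := by
    rw [ht, le_div_iff₀ (by positivity)]
    nlinarith
  have htL : t ≤ L := by
    rw [ht, div_le_iff₀ (by positivity)]
    nlinarith
  have het : 7 ≤ Real.exp t := by
    have h1 : Real.exp 2 ≤ Real.exp t := Real.exp_le_exp.2 ht2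
    have h2 : Real.exp 2 = Real.exp 1 * Real.exp 1 := by rw [← Real.exp_add]; norm_num
    have h3 := Real.exp_one_gt_d9
    nlinarith
  have hwle : (w : ℝ) ≤ Real.exp t := by rw [hw]; exact Nat.floor_le (Real.exp_pos _).le
  have hwge : Real.exp t - 1 < w := by
    rw [hw]; linarith [Nat.lt_floor_add_one (Real.exp t)]
  have hw6 : (6 : ℝ) < w := by linarith
  have hw4 : 4 ≤ w := by
    have : 6 < w := by exact_mod_cast hw6
    omega
  have hw0 : (0 : ℝ) < w := by linarith
  have hlogw1 := one_lt_log_natCast (by omega : 3 ≤ w)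
  have hlogw : t / 2 ≤ Real.log w := by
    rw [Real.le_log_iff_exp_le hw0]
    have h1 : Real.exp (t / 2) * Real.exp (t / 2) = Real.exp t := by rw [← Real.exp_add]; ring_nf
    have h2 : 2 ≤ Real.exp (t / 2) := by
      have := Real.add_one_le_exp (t / 2)
      linarith
    nlinarith
  have hlogwL : Real.log w ≤ L := by
    refine le_trans ?_ htL
    rw [Real.log_le_iff_le_exp hw0]
    exact hwle
  set k : ℕ := 2 * ⌈6 * l⌉₊ + 1 with hk
  have hkodd : Odd k := ⟨⌈6 * l⌉₊, hk⟩
  have hkge : 12 * l ≤ k := by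
    rw [hk]; push_cast
    linarith [Nat.le_ceil (6 * l)]
  have hkle : (k : ℝ) ≤ 13 * l := by
    rw [hk]; push_cast
    linarith [Nat.ceil_lt_add_one (by positivity : 0 ≤ 6 * l)]
  refine (hS m n (N / m + 1) w k hm hn (by omega) hkodd).trans ?_
  have hG := one_le_totientRatioSq m
  set G := totientRatioSq m
  set X : ℝ := (N : ℝ) / m with hX
  have hXge : Real.exp (L / u) ≤ X := by
    rw [hX, le_div_iff₀ hm0, mul_comm]
    exact hmN
  have hLu : 0 ≤ L / u := by positivity
  have hX1 : 1 ≤ X := le_trans (Real.one_le_exp hLu) hXge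
  have hY : ((N / m + 1 : ℕ) : ℝ) ≤ 2 * X := by
    push_cast
    have : ((N / m : ℕ) : ℝ) ≤ X := Nat.cast_div_le
    linarith
  have hH' : ∏ p ∈ (n * (n - 1)).primeFactors, (1 - 1 / (p : ℝ))⁻¹ ≤ C2 * (2 * l) := by
    have hy3 : 3 ≤ ⌈3 * L⌉₊ := by
      have h1 : (3 : ℝ) ≤ (⌈3 * L⌉₊ : ℝ) := le_trans (by linarith) (Nat.le_ceil (3 * L))
      exact_mod_cast h1
    have hpow : n * (n - 1) ≤ 2 ^ ⌈3 * L⌉₊ := by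
      have h1 : ((n * (n - 1) : ℕ) : ℝ) ≤ (2 : ℝ) ^ ⌈3 * L⌉₊ := by
        have h2 : ((n * (n - 1) : ℕ) : ℝ) ≤ (N : ℝ) * N := by
          exact_mod_cast Nat.mul_le_mul hnN (by omega)
        refine h2.trans ?_
        rw [← hexpL, ← Real.exp_add, ← Real.rpow_natCast, Real.rpow_def_of_pos (by norm_num),
          Real.exp_le_exp]
        have h3 := Real.log_two_gt_d9
        have h4 := Nat.le_ceil (3 * L)
        have h5 : 0.69 * (3 * L) ≤ Real.log 2 * (⌈3 * L⌉₊ : ℝ) := by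
          gcongr
          linarith
        linarith
      exact_mod_cast h1
    refine (hH _ hy3 _ (Nat.mul_ne_zero (by omega) (by omega)) hpow).trans ?_
    have h5 : Real.log (⌈3 * L⌉₊ : ℝ) ≤ 2 * l := by
      rw [Real.log_le_iff_le_exp (by positivity)]
      have h6 : Real.exp (2 * l) = L * L := by rw [two_mul, Real.exp_add, hexpl]
      rw [h6]
      have h7 := Nat.ceil_lt_add_one (by positivity : 0 ≤ 3 * L)
      have h8 : 5 * L ≤ L * L := mul_le_mul_of_nonneg_right hL5 hL0.le
      linarith
    gcongr
  have hH0 : 0 ≤ ∏ p ∈ (n * (n - 1)).primeFactors, (1 - 1 / (p : ℝ))⁻¹ :=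
    Finset.prod_nonneg fun p hp => by
      linarith [one_le_inv_one_sub_inv_prime (Nat.prime_of_mem_primeFactors hp)]
  have hlogw3 : (1 / Real.log w) ^ 3 ≤ 120 ^ 3 * ((u * l) ^ 3 / L ^ 3) := by
    have h1 : 1 / Real.log w ≤ 120 * (u * l) / L := by
      rw [div_le_div_iff₀ (by linarith) hL0, one_mul]
      have h2 : t * (60 * u * l) = L := by rw [ht]; field_simp
      nlinarith
    calc (1 / Real.log w) ^ 3 ≤ (120 * (u * l) / L) ^ 3 := by
          have : 0 ≤ 1 / Real.log (w : ℝ) := by positivity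
          gcongr
      _ = _ := by ring
  have hexpk : Real.log w ^ 9 * Real.exp (-k) ≤ 1 / L ^ 3 := by
    have h1 : Real.exp (-k) ≤ 1 / L ^ 12 := by
      calc Real.exp (-k) ≤ Real.exp (-(12 * l)) := Real.exp_le_exp.2 (by linarith)
        _ = 1 / L ^ 12 := by
          rw [Real.exp_neg, ← hexpl, ← Real.exp_nat_mul, one_div]
          norm_num
    calc Real.log w ^ 9 * Real.exp (-k) ≤ L ^ 9 * (1 / L ^ 12) := by gcongr
      _ = 1 / L ^ 3 := by field_simp
  have herr : (1 + 3 * (w : ℝ)) ^ k ≤ X * (1 / L ^ 3) := by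
    have h1 : (1 + 3 * (w : ℝ)) ^ k ≤ (Real.exp (2 * t)) ^ k := by
      have h2 : 1 + 3 * (w : ℝ) ≤ Real.exp (2 * t) := by
        rw [two_mul, Real.exp_add]
        nlinarith
      gcongr
    refine h1.trans ?_
    rw [← Real.exp_nat_mul]
    have h3 : (k : ℝ) * (2 * t) ≤ L / u - L / (2 * u) := by
      calc (k : ℝ) * (2 * t) ≤ 13 * l * (2 * t) := by gcongr
        _ = (26 / 60) * (L / u) := by rw [ht]; field_simp; norm_num
        _ ≤ (1 / 2) * (L / u) := mul_le_mul_of_nonneg_right (by norm_num) hLu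
        _ = _ := by field_simp; norm_num
    have h4 : 3 * l ≤ L / (2 * u) := by
      rw [le_div_iff₀ (by positivity)]
      nlinarith
    have h5 : (1 : ℝ) / L ^ 3 = Real.exp (-(3 * l)) := by
      rw [Real.exp_neg, ← hexpl, ← Real.exp_nat_mul, one_div]
      norm_num
    calc Real.exp ((k : ℝ) * (2 * t)) ≤ Real.exp (L / u + -(3 * l)) :=
          Real.exp_le_exp.2 (by linarith)
      _ = Real.exp (L / u) * (1 / L ^ 3) := by rw [Real.exp_add, h5]
      _ ≤ _ := by gcongr
  set W : ℝ := (u * l) ^ 3 * l / L ^ 3 with hW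
  have hWge : 1 / L ^ 3 ≤ W := by
    rw [hW]
    have : 1 ≤ (u * l) ^ 3 * l := by
      have := one_le_pow₀ hul1 (n := 3)
      nlinarith
    gcongr
  have hW0 : 0 ≤ W := by positivity
  have hXG : X ≤ X * G := le_mul_of_one_le_right (by linarith) hG
  have t1 : ((N / m + 1 : ℕ) : ℝ) * ((1 / Real.log w) ^ 3 * G *
      ∏ p ∈ (n * (n - 1)).primeFactors, (1 - 1 / (p : ℝ))⁻¹) ≤
      4 * 120 ^ 3 * C2 * (X * G) * W := by
    calc _ ≤ (2 * X) * ((120 ^ 3 * ((u * l) ^ 3 / L ^ 3)) * G * (C2 * (2 * l))) := by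
          have : 0 ≤ 1 / Real.log (w : ℝ) := by positivity
          gcongr
      _ = _ := by rw [hW]; ring
  have t2 : ((N / m + 1 : ℕ) : ℝ) * (C1 * Real.log w ^ 9 * Real.exp (-k)) ≤
      2 * C1 * (X * G) * W := by
    calc _ ≤ (2 * X) * (C1 * (1 / L ^ 3)) := by
          rw [mul_assoc C1]
          gcongr
      _ ≤ (2 * (X * G)) * (C1 * W) := by gcongr
      _ = _ := by ring
  have t3 : 3 * (1 + 3 * (w : ℝ)) ^ k ≤ 3 * (X * G) * W := by
    calc _ ≤ 3 * (X * (1 / L ^ 3)) := by gcongr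
      _ ≤ 3 * ((X * G) * W) := by gcongr
      _ = _ := by ring
  have e1 : (N : ℝ) * G / m = X * G := by rw [hX]; ring
  rw [e1]
  calc _ ≤ 4 * 120 ^ 3 * C2 * (X * G) * W + 2 * C1 * (X * G) * W + 3 * (X * G) * W := by
        linarith
    _ = _ := by ring

lemma one_le_rpow_mul_pow_bigOmega {α L l : ℝ} {m : ℕ} (hα : 1 < α) (hα' : α < 3 / 2)
    (hL : Real.exp l = L) (hm : α * l - 1 ≤ bigOmega m) :
    1 ≤ 3 / 2 * L ^ (-(α * Real.log α)) * α ^ bigOmega m := by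
  have hα0 : 0 < α := by linarith
  have hlog : 0 < Real.log α := Real.log_pos hα
  have h1 : L ^ (-(α * Real.log α)) = Real.exp (-(α * l * Real.log α)) := by
    rw [← hL, ← Real.exp_mul]
    ring_nf
  have h2 : α ^ bigOmega m = Real.exp (bigOmega m * Real.log α) := by
    rw [Real.exp_nat_mul, Real.exp_log hα0]
  have h3 : Real.exp (-(Real.log α)) ≤
      Real.exp (-(α * l * Real.log α)) * Real.exp (bigOmega m * Real.log α) := by
    rw [← Real.exp_add, Real.exp_le_exp]
    nlinarith
  rw [Real.exp_neg, Real.exp_log hα0] at h3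
  rw [h1, h2, mul_assoc]
  calc (1 : ℝ) = α * α⁻¹ := by field_simp
    _ ≤ 3 / 2 * (Real.exp (-(α * l * Real.log α)) * Real.exp (bigOmega m * Real.log α)) := by
      have : 0 ≤ α⁻¹ := by positivity
      gcongr

/-- The sieve bound for `primeTriples` summed over smooth `m` with many prime factors. -/
lemma exists_sum_card_primeTriples_le :
    ∃ C : ℝ, 0 < C ∧ ∀ α : ℝ, 1 < α → α < 3 / 2 → ∀ N n y : ℕ, ∀ L l u δ V : ℝ, ∀ M : Finset ℕ,
      2 ≤ N → L = Real.log N → l = Real.log L → 3 ≤ l → 30000 * l ^ 2 ≤ L → 1 ≤ u → u ≤ 200 * l →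
      2 ≤ n → n ≤ N → 3 ≤ y → 0 ≤ δ → 20 * δ * Real.log y ≤ 1 → 0 < V →
      (∀ m ∈ M, m ∈ y.smoothNumbers ∧ m * Real.exp (L / u) ≤ N ∧ α * l - 1 ≤ bigOmega m ∧ V ≤ m) →
      ∑ m ∈ M, ((primeTriples m n (N / m + 1) ⌊Real.exp (L / (60 * u * l))⌋₊).card : ℝ) ≤
        C * N * ((u * l) ^ 3 * l / L ^ 3) * L ^ (-(α * Real.log α)) * V ^ (-δ) *
          Real.log y ^ α := by
  obtain ⟨C1, hC1, hT⟩ := exists_card_primeTriples_le_of_large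
  obtain ⟨C2, hC2, hO⟩ := exists_sum_omegaWeight_smooth_le
  refine ⟨C1 * (3 / 2) * C2, by positivity, ?_⟩
  intro α hα hα' N n y L l u δ V M hN hL hl hl3 hbig hu1 hu2 hn hnN hy hδ hδy hV hM
  have hα0 : 0 < α := by linarith
  have hl0 : 0 < l := by linarith
  have hL0 : 0 < L := by nlinarith
  have hexpl : Real.exp l = L := by rw [hl, Real.exp_log hL0]
  set W : ℝ := (u * l) ^ 3 * l / L ^ 3 with hW
  have hW0 : 0 ≤ W := by positivity
  set D : ℝ := L ^ (-(α * Real.log α)) with hD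
  have hD0 : 0 ≤ D := by positivity
  have hterm : ∀ m ∈ M,
      ((primeTriples m n (N / m + 1) ⌊Real.exp (L / (60 * u * l))⌋₊).card : ℝ) ≤
        C1 * (3 / 2) * N * W * D * V ^ (-δ) * omegaWeight α δ m := by
    intro m hm
    obtain ⟨hms, hmN, hΩ, hVm⟩ := hM m hm
    have hm0 : m ≠ 0 := (Nat.mem_smoothNumbers.1 hms).1
    have hm1 : (0 : ℝ) < m := by exact_mod_cast Nat.pos_of_ne_zero hm0
    refine (hT N n m _ L l u hN hL hl hl3 hbig hu1 hu2 hn hnN hm0 hmN rfl).trans ?_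
    have hG := one_le_totientRatioSq m
    have h1 := one_le_rpow_mul_pow_bigOmega hα hα' hexpl hΩ
    have h2 : (1 : ℝ) / m ≤ (m : ℝ) ^ (δ - 1) * V ^ (-δ) := by
      calc (1 : ℝ) / m = (m : ℝ) ^ (δ - 1) * (m : ℝ) ^ (-δ) := by
            rw [← Real.rpow_add hm1, one_div, ← Real.rpow_neg_one]
            ring_nf
        _ ≤ _ := mul_le_mul_of_nonneg_left
            (Real.rpow_le_rpow_of_nonpos hV hVm (by linarith)) (by positivity)
    calc C1 * (N * totientRatioSq m / m) * W
        = C1 * N * W * totientRatioSq m * (1 * (1 / m)) := by ring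
      _ ≤ C1 * N * W * totientRatioSq m *
          ((3 / 2 * D * α ^ bigOmega m) * ((m : ℝ) ^ (δ - 1) * V ^ (-δ))) := by
        gcongr
      _ = _ := by rw [omegaWeight]; ring
  refine (Finset.sum_le_sum hterm).trans ?_
  rw [← Finset.mul_sum]
  calc _ ≤ C1 * (3 / 2) * N * W * D * V ^ (-δ) * (C2 * Real.log y ^ α) := by
        have := hO α hα hα' y hy δ hδ hδy M fun m hm => (hM m hm).1
        gcongr
    _ = _ := by ring

/-- Rankin's bound for the number of smooth integers in `[V, N]`. -/
lemma exists_card_smooth_le :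
    ∃ C : ℝ, 0 < C ∧ ∀ α : ℝ, 1 < α → α < 3 / 2 → ∀ N y : ℕ, ∀ δ V : ℝ, ∀ K : Finset ℕ,
      3 ≤ y → 0 ≤ δ → 20 * δ * Real.log y ≤ 1 → 0 < V →
      (∀ k ∈ K, k ∈ y.smoothNumbers ∧ k ≤ N ∧ V ≤ k) →
      (K.card : ℝ) ≤ C * N * V ^ (-δ) * Real.log y ^ α := by
  obtain ⟨C2, hC2, hO⟩ := exists_sum_omegaWeight_smooth_le
  refine ⟨C2, hC2, ?_⟩
  intro α hα hα' N y δ V K hy hδ hδy hV hK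
  have hterm : ∀ k ∈ K, (1 : ℝ) ≤ N * V ^ (-δ) * omegaWeight α δ k := by
    intro k hk
    obtain ⟨hks, hkN, hVk⟩ := hK k hk
    have hk0 : (0 : ℝ) < k := by exact_mod_cast Nat.pos_of_ne_zero (Nat.mem_smoothNumbers.1 hks).1
    have hG := one_le_totientRatioSq k
    have hP : 1 ≤ α ^ bigOmega k := one_le_pow₀ hα.le
    have hkN' : (k : ℝ) ≤ N := by exact_mod_cast hkN
    have h1 : (k : ℝ) ^ (-δ) ≤ V ^ (-δ) := Real.rpow_le_rpow_of_nonpos hV hVk (by linarith)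
    have h2 : (k : ℝ) ^ (δ - 1) ≤ omegaWeight α δ k := by
      rw [omegaWeight]
      exact le_mul_of_one_le_left (by positivity) (one_le_mul_of_one_le_of_one_le hP hG)
    calc (1 : ℝ) = k * (k : ℝ) ^ (-δ) * (k : ℝ) ^ (δ - 1) := by
          rw [mul_assoc, ← Real.rpow_add hk0, show -δ + (δ - 1) = -1 by ring, Real.rpow_neg_one]
          field_simp
      _ ≤ _ := by gcongr
  calc (K.card : ℝ) = ∑ k ∈ K, (1 : ℝ) := by simp
    _ ≤ ∑ k ∈ K, N * V ^ (-δ) * omegaWeight α δ k := Finset.sum_le_sum hterm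
    _ = N * V ^ (-δ) * ∑ k ∈ K, omegaWeight α δ k := by rw [Finset.mul_sum]
    _ ≤ N * V ^ (-δ) * (C2 * Real.log y ^ α) := by
      have := hO α hα hα' y hy δ hδ hδy K fun k hk => (hK k hk).1
      gcongr
    _ = _ := by ring

/-- Every integer `k ≥ 2` is `m * q` with `q` its largest prime factor. -/
lemma exists_eq_mul_largest_prime {k : ℕ} (hk : 2 ≤ k) :
    ∃ m q : ℕ, q.Prime ∧ m ≠ 0 ∧ k = m * q ∧ (∀ p ∈ k.primeFactorsList, p ≤ q) ∧
      bigOmega k = bigOmega m + 1 := by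
  have hne : k.primeFactors.Nonempty := Nat.nonempty_primeFactors.2 (by omega)
  obtain ⟨q, hq, hmax⟩ := Finset.exists_max_image k.primeFactors id hne
  have hqp := Nat.prime_of_mem_primeFactors hq
  obtain ⟨m, rfl⟩ := Nat.dvd_of_mem_primeFactors hq
  have hm : m ≠ 0 := by rintro rfl; simp at hk
  refine ⟨m, q, hqp, hm, mul_comm _ _, fun p hp => hmax p (by simpa using hp), ?_⟩
  rw [bigOmega_mul hqp.ne_zero hm, add_comm, bigOmega, bigOmega, Nat.primeFactorsList_prime hqp]
  rfl

lemma card_le_sum_card_primeTriples (n N w : ℕ) (S M : Finset ℕ)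
    (h : ∀ p ∈ S, ∃ m ∈ M, ∃ q ∈ primeTriples m n (N / m + 1) w, p = m * q + 1) :
    (S.card : ℝ) ≤ ∑ m ∈ M, ((primeTriples m n (N / m + 1) w).card : ℝ) := by
  have h1 : S ⊆ M.biUnion fun m => (primeTriples m n (N / m + 1) w).image fun q => m * q + 1 := by
    intro p hp
    obtain ⟨m, hm, q, hq, rfl⟩ := h p hp
    exact Finset.mem_biUnion.2 ⟨m, hm, Finset.mem_image_of_mem _ hq⟩
  have h2 := (Finset.card_le_card h1).trans Finset.card_biUnion_le
  have h3 : S.card ≤ ∑ m ∈ M, (primeTriples m n (N / m + 1) w).card :=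
    h2.trans (Finset.sum_le_sum fun m _ => Finset.card_image_le)
  exact_mod_cast h3

/-- Primes `p` with `n - p` prime and `p - 1` having many prime factors, away from the ends. -/
def shiftedPrimes (α L l : ℝ) (N n : ℕ) : Finset ℕ :=
  (Finset.range (N + 1)).filter fun p => p.Prime ∧ p ≤ n ∧ (n - p).Prime ∧
    α * l < bigOmega (p - 1) ∧ Real.exp (L - 4 * l) < (p - 1 : ℕ) ∧ Real.exp (L / 2) < (n - p : ℕ)

lemma mem_primeTriples_of_mem_shiftedPrimes {α L l u : ℝ} {N n m q p : ℕ} (hl3 : 3 ≤ l)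
    (hbig : 30000 * l ^ 2 ≤ L) (hu1 : 1 ≤ u) (hu2 : u ≤ 200 * l) (hL : Real.exp L = N)
    (hp : p ∈ shiftedPrimes α L l N n) (hq : q.Prime) (hm : m ≠ 0) (hpq : p - 1 = m * q)
    (hmN : m * Real.exp (L / u) ≤ N) :
    p = m * q + 1 ∧ q ∈ primeTriples m n (N / m + 1) ⌊Real.exp (L / (60 * u * l))⌋₊ := by
  simp only [shiftedPrimes, Finset.mem_filter, Finset.mem_range] at hp
  obtain ⟨hpN, hpp, hpn, hnp, -, hlarge, hlarge'⟩ := hp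
  have hl0 : 0 < l := by linarith
  have hu0 : 0 < u := by linarith
  have hL0 : 0 < L := by nlinarith
  have hpe : p = m * q + 1 := by have := hpp.two_le; omega
  have hmpos := Nat.pos_of_ne_zero hm
  have hm0 : (0 : ℝ) < m := by exact_mod_cast hmpos
  have hLu : 150 * l ≤ L / u := by
    rw [le_div_iff₀ hu0]
    have : l * u ≤ l * (200 * l) := by gcongr
    nlinarith
  have hw : L / (60 * u * l) ≤ L / u / 2 := by
    rw [div_div]
    refine div_le_div_of_nonneg_left hL0.le (by positivity) ?_
    nlinarith
  have hLu' : L / u ≤ L := div_le_self hL0.le hu1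
  refine ⟨hpe, ?_⟩
  simp only [primeTriples, Finset.mem_filter, Finset.mem_range]
  refine ⟨?_, hq, hpe ▸ hpp, hpe ▸ hnp, ?_, ?_⟩
  · refine Nat.lt_succ_of_le ((Nat.le_div_iff_mul_le hmpos).2 ?_)
    rw [mul_comm]
    omega
  · have h1 : Real.exp (L / (60 * u * l)) ≤ q := by
      have h2 : Real.exp (L - 4 * l) < m * q := by
        rw [hpq] at hlarge
        exact_mod_cast hlarge
      have h3 : Real.exp (L / u - 4 * l) * m ≤ Real.exp (L - 4 * l) := by
        rw [sub_eq_add_neg, sub_eq_add_neg, Real.exp_add, Real.exp_add, hL]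
        have := Real.exp_pos (-(4 * l))
        nlinarith
      have h4 : Real.exp (L / u - 4 * l) ≤ q := by
        refine le_of_mul_le_mul_right (h3.trans ?_) hm0
        rw [mul_comm (q : ℝ)]
        exact h2.le
      exact (Real.exp_le_exp.2 (by linarith)).trans h4
    exact Nat.floor_le_of_le h1
  · rw [← hpe]
    exact Nat.floor_le_of_le ((Real.exp_le_exp.2 (by linarith)).trans hlarge'.le)

lemma rpow_gam_sub_three {α L : ℝ} (hL : 0 < L) :
    L ^ (gam α - 3) = L ^ α * L ^ (-(α * Real.log α)) * (1 / L ^ 3) := by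
  rw [one_div, ← Real.rpow_natCast, ← Real.rpow_neg hL.le, ← Real.rpow_add hL, ← Real.rpow_add hL,
    gam]
  push_cast
  ring_nf

lemma log_floor_exp_add_one_le {x : ℝ} (hx : 1 ≤ x) :
    Real.log ((⌊Real.exp x⌋₊ + 1 : ℕ) : ℝ) ≤ 2 * x := by
  rw [Real.log_le_iff_le_exp (by positivity), two_mul, Real.exp_add]
  have h1 := Nat.floor_le (Real.exp_pos x).le
  have h2 := Real.add_one_le_exp x
  push_cast
  nlinarith

lemma three_le_floor_exp_add_one {x : ℝ} (hx : 1 ≤ x) : 3 ≤ ⌊Real.exp x⌋₊ + 1 := by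
  have h2 := Real.add_one_le_exp x
  have : 2 ≤ ⌊Real.exp x⌋₊ := Nat.le_floor (by push_cast; linarith)
  omega

/-- Contribution of the primes `m * q + 1` with `q` large. -/
lemma exists_card_shiftedPrimes_large_le :
    ∃ C : ℝ, 0 < C ∧ ∀ α : ℝ, 1 < α → α < 3 / 2 → ∀ N n : ℕ, ∀ L l u : ℝ,
      2 ≤ N → L = Real.log N → l = Real.log L → 4 ≤ l → 30000 * l ^ 2 ≤ L → 0 ≤ u → u ^ 2 = l →
      2 ≤ n → n ≤ N →
      (((shiftedPrimes α L l N n).filter fun p => ∃ m q : ℕ, q.Prime ∧ m ≠ 0 ∧ p - 1 = m * q ∧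
        bigOmega (p - 1) = bigOmega m + 1 ∧ m * Real.exp (L / u) ≤ N).card : ℝ) ≤
          C * N * L ^ (gam α - 3) * l ^ 6 := by
  obtain ⟨C, hC, hS⟩ := exists_sum_card_primeTriples_le
  refine ⟨C * 4, by positivity, ?_⟩
  intro α hα hα' N n L l u hN hL hl hl4 hbig hu hul hn hnN
  have hu2 : 2 ≤ u := by nlinarith
  have hul' : u ≤ l := by nlinarith
  have hl0 : 0 < l := by linarith
  have hL0 : 0 < L := by nlinarith
  have hN1 : (0 : ℝ) < N := by positivity
  have hexpL : Real.exp L = N := by rw [hL, Real.exp_log hN1]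
  set M : Finset ℕ := (Finset.range (N + 1)).filter fun m =>
    m ≠ 0 ∧ m * Real.exp (L / u) ≤ N ∧ α * l - 1 ≤ bigOmega m with hM
  have h1 := card_le_sum_card_primeTriples n N ⌊Real.exp (L / (60 * u * l))⌋₊
    ((shiftedPrimes α L l N n).filter fun p => ∃ m q : ℕ, q.Prime ∧ m ≠ 0 ∧ p - 1 = m * q ∧
        bigOmega (p - 1) = bigOmega m + 1 ∧ m * Real.exp (L / u) ≤ N) M (by
    intro p hp
    obtain ⟨hps, m, q, hq, hm, hpq, hΩ, hmN⟩ := Finset.mem_filter.1 hp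
    obtain ⟨he, hT⟩ := mem_primeTriples_of_mem_shiftedPrimes (by linarith) hbig (by linarith)
      (by linarith) hexpL hps hq hm hpq hmN
    refine ⟨m, ?_, q, hT, he⟩
    simp only [shiftedPrimes, Finset.mem_filter, Finset.mem_range] at hps
    obtain ⟨hpN, hpp, hpn, hnp, hΩ', -⟩ := hps
    simp only [hM, Finset.mem_filter, Finset.mem_range]
    refine ⟨?_, hm, hmN, ?_⟩
    · have := Nat.le_mul_of_pos_right m hq.pos
      omega
    · rw [hΩ] at hΩ'
      push_cast at hΩ'
      linarith)
  refine h1.trans ((hS α hα hα' N n (N + 1) L l u 0 1 M hN hL hl (by linarith) hbig (by linarith)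
    (by linarith) hn hnN (by omega) le_rfl (by simp) one_pos ?_).trans ?_)
  · intro m hm
    simp only [hM, Finset.mem_filter, Finset.mem_range] at hm
    obtain ⟨hmN, hm0, h2, h3⟩ := hm
    refine ⟨?_, h2, h3, by exact_mod_cast Nat.pos_of_ne_zero hm0⟩
    refine Nat.mem_smoothNumbers.2 ⟨hm0, fun p hp => ?_⟩
    exact (Nat.le_of_mem_primeFactorsList hp).trans_lt hmN
  · have hlog : Real.log ((N + 1 : ℕ) : ℝ) ≤ 2 * L := by
      rw [Real.log_le_iff_le_exp (by positivity), two_mul, Real.exp_add, hexpL]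
      push_cast
      have : (2 : ℝ) ≤ N := by exact_mod_cast hN
      nlinarith
    have hlog' : Real.log ((N + 1 : ℕ) : ℝ) ^ α ≤ 4 * L ^ α := by
      calc _ ≤ (2 * L) ^ α := by
            refine Real.rpow_le_rpow (Real.log_natCast_nonneg _) hlog (by linarith)
        _ = 2 ^ α * L ^ α := Real.mul_rpow (by norm_num) hL0.le
        _ ≤ 4 * L ^ α := by
          have : (2 : ℝ) ^ α ≤ 2 ^ (2 : ℝ) :=
            Real.rpow_le_rpow_of_exponent_le (by norm_num) (by linarith)
          norm_num at this
          gcongr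
    have hpow : (u * l) ^ 3 * l ≤ l ^ 6 := by
      calc (u * l) ^ 3 * l = u ^ 2 * u * l ^ 4 := by ring
        _ ≤ l * l * l ^ 4 := by rw [hul]; gcongr
        _ = _ := by ring
    rw [rpow_gam_sub_three hL0, Real.one_rpow, mul_one]
    calc _ ≤ C * N * (l ^ 6 / L ^ 3) * L ^ (-(α * Real.log α)) * (4 * L ^ α) := by gcongr
      _ = _ := by ring

/-- Contribution of the primes `m * q + 1` with `q` of intermediate size. -/
lemma exists_card_shiftedPrimes_medium_le :
    ∃ C : ℝ, 0 < C ∧ ∀ α : ℝ, 1 < α → α < 3 / 2 → ∀ N n : ℕ, ∀ L l u : ℝ,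
      2 ≤ N → L = Real.log N → l = Real.log L → 4 ≤ l → 30000 * l ^ 2 ≤ L → 0 ≤ u → u ^ 2 = l →
      2 ≤ n → n ≤ N →
      (((shiftedPrimes α L l N n).filter fun p => ∃ m q : ℕ, q.Prime ∧ m ≠ 0 ∧ p - 1 = m * q ∧
        bigOmega (p - 1) = bigOmega m + 1 ∧ (∀ r ∈ (p - 1).primeFactorsList, r ≤ q) ∧
        N < m * Real.exp (L / u) ∧ m * Real.exp (L / (200 * l)) ≤ N).card : ℝ) ≤
          C * N * L ^ (gam α - 3) * l ^ 6 := by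
  obtain ⟨C, hC, hS⟩ := exists_sum_card_primeTriples_le
  refine ⟨C * 200 ^ 3 * 12800, by positivity, ?_⟩
  intro α hα hα' N n L l u hN hL hl hl4 hbig hu hul hn hnN
  have hu2 : 2 ≤ u := by nlinarith
  have hul' : u ≤ l := by nlinarith
  have hl0 : 0 < l := by linarith
  have hll : 4 * l ≤ l ^ 2 := by nlinarith
  have hlL : l ≤ L := by linarith
  have hL0 : 0 < L := by linarith
  have hu0 : 0 < u := by linarith
  have hN1 : (0 : ℝ) < N := by positivity
  have hexpL : Real.exp L = N := by rw [hL, Real.exp_log hN1]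
  have hLu : 1 ≤ L / u := by rw [le_div_iff₀ hu0]; linarith
  have hLu2 : 2 * (L / u) ≤ L := by
    rw [← mul_div_assoc, div_le_iff₀ hu0]
    nlinarith
  set y : ℕ := ⌊Real.exp (L / u)⌋₊ + 1 with hy
  have hylog : Real.log y ≤ 2 * (L / u) := log_floor_exp_add_one_le hLu
  set M : Finset ℕ := (Finset.range (N + 1)).filter fun m => m ∈ y.smoothNumbers ∧
    m * Real.exp (L / (200 * l)) ≤ N ∧ α * l - 1 ≤ bigOmega m ∧ Real.exp (L / 2) ≤ m with hM
  have h1 := card_le_sum_card_primeTriples n N ⌊Real.exp (L / (60 * (200 * l) * l))⌋₊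
    ((shiftedPrimes α L l N n).filter fun p => ∃ m q : ℕ, q.Prime ∧ m ≠ 0 ∧ p - 1 = m * q ∧
        bigOmega (p - 1) = bigOmega m + 1 ∧ (∀ r ∈ (p - 1).primeFactorsList, r ≤ q) ∧
        N < m * Real.exp (L / u) ∧ m * Real.exp (L / (200 * l)) ≤ N) M (by
    intro p hp
    obtain ⟨hps, m, q, hq, hm, hpq, hΩ, hmax, hmN', hmN⟩ := Finset.mem_filter.1 hp
    obtain ⟨he, hT⟩ := mem_primeTriples_of_mem_shiftedPrimes (by linarith) hbig (by linarith)
      le_rfl hexpL hps hq hm hpq hmN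
    refine ⟨m, ?_, q, hT, he⟩
    simp only [shiftedPrimes, Finset.mem_filter, Finset.mem_range] at hps
    obtain ⟨hpN, hpp, hpn, hnp, hΩ', -⟩ := hps
    simp only [hM, Finset.mem_filter, Finset.mem_range]
    have hm0 : (0 : ℝ) < m := by exact_mod_cast Nat.pos_of_ne_zero hm
    refine ⟨?_, ?_, hmN, ?_, ?_⟩
    · have := Nat.le_mul_of_pos_right m hq.pos
      omega
    · refine Nat.mem_smoothNumbers.2 ⟨hm, fun r hr => ?_⟩
      have hrq : r ≤ q := by
        refine hmax r ?_
        rw [hpq, Nat.mem_primeFactorsList_mul hm hq.ne_zero]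
        exact Or.inl hr
      have hqN : (m : ℝ) * q ≤ N := by
        have : m * q ≤ N := by omega
        exact_mod_cast this
      have hqe : (q : ℝ) ≤ Real.exp (L / u) :=
        le_of_mul_le_mul_left (hqN.trans hmN'.le) hm0
      have := Nat.le_floor hqe
      omega
    · rw [hΩ] at hΩ'
      push_cast at hΩ'
      linarith
    · have h2 : Real.exp (L / 2) * Real.exp (L / 2) = N := by
        rw [← hexpL, ← Real.exp_add]
        ring_nf
      have h3 : Real.exp (L / u) ≤ Real.exp (L / 2) := Real.exp_le_exp.2 (by linarith)
      refine le_of_mul_le_mul_right (a := Real.exp (L / 2)) ?_ (Real.exp_pos _)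
      rw [h2]
      exact hmN'.le.trans (by gcongr))
  have hδy : 20 * (u / (40 * L)) * Real.log y ≤ 1 := by
    calc 20 * (u / (40 * L)) * Real.log y ≤ 20 * (u / (40 * L)) * (2 * (L / u)) := by gcongr
      _ = 1 := by field_simp; norm_num
  refine h1.trans ((hS α hα hα' N n y L l (200 * l) (u / (40 * L)) (Real.exp (L / 2)) M hN hL hl
    (by linarith) hbig (by linarith) le_rfl hn hnN (three_le_floor_exp_add_one hLu) (by positivity)
    hδy (Real.exp_pos _) ?_).trans ?_)
  · intro m hm
    simp only [hM, Finset.mem_filter] at hm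
    exact hm.2
  · have hlog' : Real.log y ^ α ≤ L ^ α :=
      Real.rpow_le_rpow (Real.log_natCast_nonneg _) (hylog.trans hLu2) (by linarith)
    have hV : Real.exp (L / 2) ^ (-(u / (40 * L))) ≤ 12800 / l := by
      have h2 : L / 2 * -(u / (40 * L)) = -(u / 80) := by field_simp; norm_num
      rw [← Real.exp_mul, h2, Real.exp_neg, inv_le_comm₀ (Real.exp_pos _) (by positivity), inv_div]
      have h3 := Real.quadratic_le_exp_of_nonneg (by positivity : 0 ≤ u / 80)
      have h4 : (u / 80) ^ 2 / 2 = l / 12800 := by rw [← hul]; ring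
      rw [h4] at h3
      have : 0 ≤ u / 80 := by positivity
      linarith
    rw [rpow_gam_sub_three hL0]
    calc _ ≤ C * N * ((200 * l * l) ^ 3 * l / L ^ 3) * L ^ (-(α * Real.log α)) * (12800 / l) *
          L ^ α := by gcongr
      _ = _ := by field_simp

/-- Contribution of the primes `p` for which `p - 1` is smooth. -/
lemma exists_card_shiftedPrimes_smooth_le :
    ∃ C : ℝ, 0 < C ∧ ∀ α : ℝ, 1 < α → α < 3 / 2 → ∀ N n : ℕ, ∀ L l : ℝ,
      2 ≤ N → L = Real.log N → l = Real.log L → 4 ≤ l → 30000 * l ^ 2 ≤ L →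
      (((shiftedPrimes α L l N n).filter fun p => ∃ m q : ℕ, q.Prime ∧ m ≠ 0 ∧ p - 1 = m * q ∧
        (∀ r ∈ (p - 1).primeFactorsList, r ≤ q) ∧ N < m * Real.exp (L / (200 * l))).card : ℝ) ≤
          C * N * (1 / L ^ 3) := by
  obtain ⟨C, hC, hS⟩ := exists_card_smooth_le
  refine ⟨C, hC, ?_⟩
  intro α hα hα' N n L l hN hL hl hl4 hbig
  have hl0 : 0 < l := by linarith
  have hll : 4 * l ≤ l ^ 2 := by nlinarith
  have hL0 : 0 < L := by linarith
  have hL1 : 1 ≤ L := by linarith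
  have hN1 : (0 : ℝ) < N := by positivity
  have hexpL : Real.exp L = N := by rw [hL, Real.exp_log hN1]
  have hexpl : Real.exp l = L := by rw [hl, Real.exp_log hL0]
  have hLu : 1 ≤ L / (200 * l) := by rw [le_div_iff₀ (by positivity)]; linarith
  have hLu2 : 2 * (L / (200 * l)) ≤ L := by
    rw [← mul_div_assoc, div_le_iff₀ (by positivity)]
    nlinarith
  set y : ℕ := ⌊Real.exp (L / (200 * l))⌋₊ + 1 with hy
  have hylog : Real.log y ≤ 2 * (L / (200 * l)) := log_floor_exp_add_one_le hLu
  set K : Finset ℕ := (Finset.range (N + 1)).filter fun k => k ∈ y.smoothNumbers ∧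
    k ≤ N ∧ Real.exp (L - 4 * l) ≤ k with hK
  have hsub : ((shiftedPrimes α L l N n).filter fun p => ∃ m q : ℕ, q.Prime ∧ m ≠ 0 ∧
      p - 1 = m * q ∧ (∀ r ∈ (p - 1).primeFactorsList, r ≤ q) ∧
      N < m * Real.exp (L / (200 * l))) ⊆ K.image fun k => k + 1 := by
    intro p hp
    obtain ⟨hps, m, q, hq, hm, hpq, hmax, hmN'⟩ := Finset.mem_filter.1 hp
    simp only [shiftedPrimes, Finset.mem_filter, Finset.mem_range] at hps
    obtain ⟨hpN, hpp, hpn, hnp, hΩ', hlarge, -⟩ := hps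
    have hp1 := hpp.two_le
    have hm0 : (0 : ℝ) < m := by exact_mod_cast Nat.pos_of_ne_zero hm
    refine Finset.mem_image.2 ⟨p - 1, ?_, by omega⟩
    simp only [hK, Finset.mem_filter, Finset.mem_range]
    refine ⟨by omega, ?_, by omega, hlarge.le⟩
    refine Nat.mem_smoothNumbers.2 ⟨by omega, fun r hr => ?_⟩
    have hrq : r ≤ q := hmax r hr
    have hqN : (m : ℝ) * q ≤ N := by
      have : m * q ≤ N := by omega
      exact_mod_cast this
    have hqe : (q : ℝ) ≤ Real.exp (L / (200 * l)) :=
      le_of_mul_le_mul_left (hqN.trans hmN'.le) hm0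
    have := Nat.le_floor hqe
    omega
  have hcard : (((shiftedPrimes α L l N n).filter fun p => ∃ m q : ℕ, q.Prime ∧ m ≠ 0 ∧
      p - 1 = m * q ∧ (∀ r ∈ (p - 1).primeFactorsList, r ≤ q) ∧
      N < m * Real.exp (L / (200 * l))).card : ℝ) ≤ K.card := by
    exact_mod_cast (Finset.card_le_card hsub).trans Finset.card_image_le
  have hδy : 20 * (5 * l / L) * Real.log y ≤ 1 := by
    calc 20 * (5 * l / L) * Real.log y ≤ 20 * (5 * l / L) * (2 * (L / (200 * l))) := by gcongr
      _ = 1 := by field_simp; norm_num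
  refine hcard.trans ((hS α hα hα' N y (5 * l / L) (Real.exp (L - 4 * l)) K
    (three_le_floor_exp_add_one hLu) (by positivity) hδy (Real.exp_pos _) ?_).trans ?_)
  · intro k hk
    simp only [hK, Finset.mem_filter] at hk
    exact hk.2
  · have hlog' : Real.log y ^ α ≤ Real.exp (3 / 2 * l) := by
      calc Real.log y ^ α ≤ L ^ α :=
            Real.rpow_le_rpow (Real.log_natCast_nonneg _) (hylog.trans hLu2) (by linarith)
        _ ≤ L ^ (3 / 2 : ℝ) := Real.rpow_le_rpow_of_exponent_le hL1 hα'.le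
        _ = _ := by rw [← hexpl, ← Real.exp_mul]; ring_nf
    have hV : Real.exp (L - 4 * l) ^ (-(5 * l / L)) ≤ Real.exp (-(9 / 2 * l)) := by
      rw [← Real.exp_mul, Real.exp_le_exp]
      have h2 : (L - 4 * l) * -(5 * l / L) = -(5 * l) + 20 * l ^ 2 / L := by
        field_simp
        ring
      have h3 : 20 * l ^ 2 / L ≤ 1 := by
        rw [div_le_iff₀ hL0]
        linarith
      rw [h2]
      linarith
    have h5 : 1 / L ^ 3 = Real.exp (-(9 / 2 * l)) * Real.exp (3 / 2 * l) := by
      rw [← Real.exp_add, ← hexpl, ← Real.exp_nat_mul, one_div, ← Real.exp_neg]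
      push_cast
      ring_nf
    rw [h5]
    calc _ ≤ C * N * Real.exp (-(9 / 2 * l)) * Real.exp (3 / 2 * l) := by gcongr
      _ = _ := by ring

lemma card_goldbach_pairs_le (α : ℝ) (N n : ℕ) {L l : ℝ} (hN : 2 ≤ N) (hL : L = Real.log N)
    (hl : l = Real.log L) (hl4 : 4 ≤ l) (hbig : 30000 * l ^ 2 ≤ L) :
    (((Finset.range (N + 1) ×ˢ Finset.range (N + 1)).filter
      (fun q => q.1.Prime ∧ q.2.Prime ∧ q.1 + q.2 = n ∧
        α * l < (bigOmega (q.1 - 1) : ℝ))).card : ℝ) ≤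
      (shiftedPrimes α L l N n).card + 5 * (N * (1 / L ^ 3)) := by
  have hl0 : 0 < l := by linarith
  have hll : 4 * l ≤ l ^ 2 := by nlinarith
  have hL0 : 0 < L := by linarith
  have hL1 : 1 ≤ L := by linarith
  have hN1 : (0 : ℝ) < N := by positivity
  have hexpL : Real.exp L = N := by rw [hL, Real.exp_log hN1]
  have hexpl : Real.exp l = L := by rw [hl, Real.exp_log hL0]
  have hX : N * (1 / L ^ 3) = Real.exp (L - 3 * l) := by
    rw [sub_eq_add_neg, Real.exp_add, hexpL, ← hexpl, ← Real.exp_nat_mul, one_div, ← Real.exp_neg]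
    push_cast
    rfl
  set P := (Finset.range (N + 1) ×ˢ Finset.range (N + 1)).filter
      (fun q => q.1.Prime ∧ q.2.Prime ∧ q.1 + q.2 = n ∧ α * l < (bigOmega (q.1 - 1) : ℝ)) with hP
  have hsub : P.image Prod.fst ⊆ shiftedPrimes α L l N n ∪
      ((Finset.range (⌊Real.exp (L - 4 * l)⌋₊ + 2)) ∪
        (Finset.range (⌊Real.exp (L / 2)⌋₊ + 1)).image fun j => n - j) := by
    intro p hp
    obtain ⟨⟨p', r⟩, hq, rfl⟩ := Finset.mem_image.1 hp
    simp only [hP, Finset.mem_filter, Finset.mem_product, Finset.mem_range] at hq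
    obtain ⟨⟨h1, h2⟩, h3, h4, h5, h6⟩ := hq
    simp only [Finset.mem_union, Finset.mem_range, Finset.mem_image]
    by_cases ha : Real.exp (L - 4 * l) < (p' - 1 : ℕ)
    · by_cases hb : Real.exp (L / 2) < (n - p' : ℕ)
      · left
        have h7 : n - p' = r := by omega
        simp only [shiftedPrimes, Finset.mem_filter, Finset.mem_range]
        exact ⟨h1, h3, by omega, h7 ▸ h4, h6, ha, hb⟩
      · right; right
        refine ⟨n - p', ?_, by omega⟩
        have := Nat.le_floor (not_lt.1 hb)
        omega
    · right; left
      have := Nat.le_floor (not_lt.1 ha)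
      omega
  have hinj : P.card = (P.image Prod.fst).card := by
    refine (Finset.card_image_of_injOn ?_).symm
    rintro ⟨a, b⟩ hab ⟨c, d⟩ hcd (rfl : a = c)
    simp only [hP, Finset.coe_filter, Set.mem_ofPred_eq] at hab hcd
    have : b = d := by omega
    rw [this]
  have hcard : (P.card : ℝ) ≤ (shiftedPrimes α L l N n).card +
      ((⌊Real.exp (L - 4 * l)⌋₊ + 2 : ℝ) + (⌊Real.exp (L / 2)⌋₊ + 1)) := by
    have h1 := (Finset.card_le_card hsub).trans ((Finset.card_union_le _ _).trans
      (Nat.add_le_add_left ((Finset.card_union_le _ _).trans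
        (Nat.add_le_add_left Finset.card_image_le _)) _))
    rw [← hinj, Finset.card_range, Finset.card_range] at h1
    exact_mod_cast h1
  refine hcard.trans ?_
  have h1 := Nat.floor_le (Real.exp_pos (L - 4 * l)).le
  have h2 := Nat.floor_le (Real.exp_pos (L / 2)).le
  have h3 : Real.exp (L - 4 * l) ≤ Real.exp (L - 3 * l) := Real.exp_le_exp.2 (by linarith)
  have h4 : Real.exp (L / 2) ≤ Real.exp (L - 3 * l) := Real.exp_le_exp.2 (by linarith)
  have h5 : 1 ≤ Real.exp (L - 3 * l) := Real.one_le_exp (by linarith)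
  rw [hX]
  linarith

lemma exists_card_shiftedPrimes_le :
    ∃ C : ℝ, 0 < C ∧ ∀ α : ℝ, 1 < α → α < 3 / 2 → ∀ N n : ℕ, ∀ L l : ℝ,
      2 ≤ N → L = Real.log N → l = Real.log L → 4 ≤ l → 30000 * l ^ 2 ≤ L → 2 ≤ n → n ≤ N →
      ((shiftedPrimes α L l N n).card : ℝ) ≤
        C * N * L ^ (gam α - 3) * l ^ 6 + C * N * (1 / L ^ 3) := by
  obtain ⟨C1, hC1, h1⟩ := exists_card_shiftedPrimes_large_le
  obtain ⟨C2, hC2, h2⟩ := exists_card_shiftedPrimes_medium_le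
  obtain ⟨C3, hC3, h3⟩ := exists_card_shiftedPrimes_smooth_le
  refine ⟨C1 + C2 + C3, by positivity, ?_⟩
  intro α hα hα' N n L l hN hL hl hl4 hbig hn hnN
  have hll : 4 * l ≤ l ^ 2 := by nlinarith
  have hL0 : 0 < L := by linarith
  have hul : Real.sqrt l ^ 2 = l := Real.sq_sqrt (by linarith)
  have h1' := h1 α hα hα' N n L l _ hN hL hl hl4 hbig (Real.sqrt_nonneg l) hul hn hnN
  have h2' := h2 α hα hα' N n L l _ hN hL hl hl4 hbig (Real.sqrt_nonneg l) hul hn hnN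
  have h3' := h3 α hα hα' N n L l hN hL hl hl4 hbig
  set S1 := (shiftedPrimes α L l N n).filter fun p => ∃ m q : ℕ, q.Prime ∧ m ≠ 0 ∧
    p - 1 = m * q ∧ bigOmega (p - 1) = bigOmega m + 1 ∧ m * Real.exp (L / Real.sqrt l) ≤ N with hS1
  set S2 := (shiftedPrimes α L l N n).filter fun p => ∃ m q : ℕ, q.Prime ∧ m ≠ 0 ∧
    p - 1 = m * q ∧ bigOmega (p - 1) = bigOmega m + 1 ∧
    (∀ r ∈ (p - 1).primeFactorsList, r ≤ q) ∧
    N < m * Real.exp (L / Real.sqrt l) ∧ m * Real.exp (L / (200 * l)) ≤ N with hS2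
  set S3 := (shiftedPrimes α L l N n).filter fun p => ∃ m q : ℕ, q.Prime ∧ m ≠ 0 ∧
    p - 1 = m * q ∧ (∀ r ∈ (p - 1).primeFactorsList, r ≤ q) ∧
    N < m * Real.exp (L / (200 * l)) with hS3
  have hsub : shiftedPrimes α L l N n ⊆ S1 ∪ (S2 ∪ S3) := by
    intro p hp
    have hp' := hp
    simp only [shiftedPrimes, Finset.mem_filter, Finset.mem_range] at hp'
    obtain ⟨-, -, -, -, -, hlarge, -⟩ := hp'
    have hk : 2 ≤ p - 1 := by
      have h4 : (1 : ℝ) < (p - 1 : ℕ) :=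
        (Real.one_le_exp (by linarith : 0 ≤ L - 4 * l)).trans_lt hlarge
      exact_mod_cast h4
    obtain ⟨m, q, hq, hm, hpq, hmax, hΩ⟩ := exists_eq_mul_largest_prime hk
    simp only [Finset.mem_union, hS1, hS2, hS3, Finset.mem_filter]
    by_cases ha : m * Real.exp (L / Real.sqrt l) ≤ N
    · exact Or.inl ⟨hp, m, q, hq, hm, hpq, hΩ, ha⟩
    by_cases hb : m * Real.exp (L / (200 * l)) ≤ N
    · exact Or.inr (Or.inl ⟨hp, m, q, hq, hm, hpq, hΩ, hmax, not_le.1 ha, hb⟩)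
    · exact Or.inr (Or.inr ⟨hp, m, q, hq, hm, hpq, hmax, not_le.1 hb⟩)
  have hcard : ((shiftedPrimes α L l N n).card : ℝ) ≤ S1.card + (S2.card + S3.card) := by
    exact_mod_cast (Finset.card_le_card hsub).trans ((Finset.card_union_le _ _).trans
      (Nat.add_le_add_left (Finset.card_union_le _ _) _))
  have hA : 0 ≤ N * L ^ (gam α - 3) * l ^ 6 := by positivity
  have hB : 0 ≤ N * (1 / L ^ 3) := by positivity
  have e1 := mul_nonneg hC3.le hA
  have e2 := mul_nonneg (add_pos hC1 hC2).le hB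
  linarith

lemma eventually_log_log_bounds :
    ∀ᶠ N : ℕ in Filter.atTop, 2 ≤ N ∧ 4 ≤ Real.log (Real.log N) ∧
      30000 * Real.log (Real.log N) ^ 2 ≤ Real.log N := by
  have hlog : Filter.Tendsto (fun N : ℕ => Real.log N) Filter.atTop Filter.atTop :=
    Real.tendsto_log_atTop.comp tendsto_natCast_atTop_atTop
  have h1 : ∀ᶠ x : ℝ in Filter.atTop, 30000 * Real.log x ^ 2 ≤ x := by
    have h2 := (Real.isLittleO_pow_log_id_atTop (n := 2)).bound (by norm_num : (0 : ℝ) < 1 / 30000)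
    filter_upwards [h2, Filter.eventually_ge_atTop 0] with x hx hx0
    rw [Real.norm_of_nonneg (sq_nonneg _), id, Real.norm_of_nonneg hx0] at hx
    linarith
  filter_upwards [Filter.eventually_ge_atTop 2, hlog.eventually h1,
    (Real.tendsto_log_atTop.comp hlog).eventually_ge_atTop 4] with N h2 h3 h4
  exact ⟨h2, h4, h3⟩

/-- the number of ordered pairs of primes (p₁, p₂) with p₁ + p₂ = n and
Ω(p₁ - 1) > α log L is ≪ N L^{γ(α) - 3} (log L)⁶, uniformly in 1 ≤ n ≤ N. -/
theorem goldbach_pairs_many_prime_factors :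
    ∀ α : ℝ, 1 < α → α < 3 / 2 → ∃ C : ℝ, 0 < C ∧ ∃ N0 : ℕ,
      ∀ N : ℕ, N0 ≤ N → ∀ n : ℕ, 1 ≤ n → n ≤ N →
        (((Finset.range (N + 1) ×ˢ Finset.range (N + 1)).filter
            (fun q => q.1.Prime ∧ q.2.Prime ∧ q.1 + q.2 = n ∧
              α * Real.log (Real.log N) < (bigOmega (q.1 - 1) : ℝ))).card : ℝ) ≤
          C * (N : ℝ) * Real.log N ^ (gam α - 3) * Real.log (Real.log N) ^ 6 := by
  intro α hα hα'
  obtain ⟨C, hC, hS⟩ := exists_card_shiftedPrimes_le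
  obtain ⟨N0, hN0⟩ := Filter.eventually_atTop.1 eventually_log_log_bounds
  refine ⟨2 * C + 5, by positivity, N0, ?_⟩
  intro N hN n hn1 hnN
  obtain ⟨hN2, hl4, hbig⟩ := hN0 N hN
  set L := Real.log N with hL
  set l := Real.log L with hl
  have hll : 4 * l ≤ l ^ 2 := by nlinarith
  have hL0 : 0 < L := by linarith
  have hL1 : 1 ≤ L := by linarith
  have hR : N * (1 / L ^ 3) ≤ N * L ^ (gam α - 3) * l ^ 6 := by
    have h1 : 1 / L ^ 3 ≤ L ^ (gam α - 3) := by
      have h2 : 1 / L ^ 3 = L ^ (-3 : ℝ) := by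
        rw [Real.rpow_neg hL0.le, one_div]
        norm_cast
      rw [h2]
      refine Real.rpow_le_rpow_of_exponent_le hL1 ?_
      have h3 := Real.log_le_sub_one_of_pos (by linarith : 0 < α)
      rw [gam]
      nlinarith
    have h4 : 1 ≤ l ^ 6 := one_le_pow₀ (by linarith)
    rw [mul_assoc]
    gcongr
    exact h1.trans (le_mul_of_one_le_right (by positivity) h4)
  have hR0 : 0 ≤ N * L ^ (gam α - 3) * l ^ 6 := by positivity
  rcases Nat.lt_or_ge n 2 with hn | hn
  · rw [Finset.filter_false_of_mem]
    · rw [Finset.card_empty, Nat.cast_zero]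
      positivity
    · rintro ⟨a, b⟩ - ⟨ha, hb, hab, -⟩
      have := ha.two_le
      simp only at hab
      omega
  · have h1 := card_goldbach_pairs_le α N n hN2 hL hl hl4 hbig
    have h2 := hS α hα hα' N n L l hN2 hL hl hl4 hbig hn hnN
    have h3 := mul_le_mul_of_nonneg_left hR hC.le
    linarith
end
end

section
/- Let ω > 0 be a constant and N a sufficiently large integer. Let n be an integer with N^{3/4} ≤ n ≤ N and let m be an integer with \sqrt{N} L^{-ω-10} < m < \sqrt{N} L^{ω}. Then the number of primes p < n such that p ≡ 1 (mod m) and n - p is prime is \ll (N/m) L^{-2} (\log L)^2, where L = log N and the implied constant depends only on ω. -/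
open Finset

noncomputable section

theorem sum_range_mul_of_coprime {a b : ℕ} (hab : a.Coprime b) (ha : 0 < a) (hb : 0 < b)
    (F G : ℕ → ℝ) (hF : ∀ k, F (k % a) = F k) (hG : ∀ k, G (k % b) = G k) :
    ∑ k ∈ range (a * b), F k * G k = (∑ k ∈ range a, F k) * ∑ k ∈ range b, G k := by
  rw [sum_mul_sum, ← sum_product']
  refine sum_bij' (fun k _ => (k % a, k % b)) (fun x _ => (Nat.chineseRemainder hab x.1 x.2 : ℕ))
    ?_ ?_ ?_ ?_ ?_
  · intro k _
    simp [Nat.mod_lt, ha, hb]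
  · intro x _
    exact mem_range.2 (Nat.chineseRemainder_lt_mul hab _ _ ha.ne' hb.ne')
  · intro k hk
    have h := Nat.chineseRemainder_modEq_unique hab (a := k % a) (b := k % b) (z := k)
      (Nat.mod_modEq k a).symm (Nat.mod_modEq k b).symm
    have h2 := Nat.chineseRemainder_lt_mul hab (k % a) (k % b) ha.ne' hb.ne'
    exact (Nat.ModEq.eq_of_lt_of_lt h (mem_range.1 hk) h2).symm
  · rintro ⟨x, y⟩ hxy
    simp only [mem_product, mem_range] at hxy
    have h := (Nat.chineseRemainder hab x y).2
    have h1 : _ % a = x % a := h.1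
    have h2 : _ % b = y % b := h.2
    rw [Nat.mod_eq_of_lt hxy.1] at h1
    rw [Nat.mod_eq_of_lt hxy.2] at h2
    exact Prod.ext h1 h2
  · intro k _
    simp [hF, hG]

theorem periodic_of_dvd {a b : ℕ} (hab : a ∣ b) {F : ℕ → ℝ} (hF : ∀ k, F (k % a) = F k) (k : ℕ) :
    F (k % b) = F k := by
  rw [← hF (k % b), Nat.mod_mod_of_dvd _ hab, hF]

theorem sum_range_prod_primes (T : Finset ℕ) (hT : ∀ p ∈ T, p.Prime) (h : ℕ → ℕ → ℝ)
    (hper : ∀ p ∈ T, ∀ k, h p (k % p) = h p k) :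
    ∑ k ∈ range (∏ p ∈ T, p), ∏ p ∈ T, h p k = ∏ p ∈ T, ∑ k ∈ range p, h p k := by
  induction T using Finset.induction_on with
  | empty => simp
  | insert q T hq ih =>
    have hT' : ∀ p ∈ T, p.Prime := fun p hp => hT p (mem_insert_of_mem hp)
    have hper' : ∀ p ∈ T, ∀ k, h p (k % p) = h p k := fun p hp => hper p (mem_insert_of_mem hp)
    have hq' := hT q (mem_insert_self _ _)
    rw [prod_insert hq, prod_insert hq, ← ih hT' hper', ← sum_range_mul_of_coprime]
    · exact sum_congr rfl fun k _ => prod_insert hq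
    · refine Nat.Coprime.prod_right fun p hp => (Nat.coprime_primes hq' (hT' p hp)).2 ?_
      rintro rfl
      exact hq hp
    · exact hq'.pos
    · exact prod_pos fun p hp => (hT' p hp).pos
    · exact hper q (mem_insert_self _ _)
    · exact fun k => prod_congr rfl fun p hp =>
        periodic_of_dvd (F := h p) (dvd_prod_of_mem _ hp) (hper' p hp) k

theorem sum_range_periodic_le {q : ℕ} (hq : 0 < q) (F : ℕ → ℝ) (hF : ∀ k, F (k % q) = F k)
    {B : ℝ} (hB : ∀ k, |F k| ≤ B) (hnn : 0 ≤ ∑ k ∈ range q, F k) (K : ℕ) :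
    ∑ k ∈ range K, F k ≤ (K : ℝ) / q * ∑ k ∈ range q, F k + q * B := by
  have hB0 : 0 ≤ B := (abs_nonneg _).trans (hB 0)
  have hper : ∀ a k, F (q * a + k) = F k := fun a k => by
    rw [← hF, Nat.mul_add_mod, hF]
  have hblock : ∀ a : ℕ, ∑ k ∈ range (q * a), F k = a * ∑ k ∈ range q, F k := by
    intro a
    induction a with
    | zero => simp
    | succ a ih =>
      rw [Nat.mul_succ, sum_range_add, ih, sum_congr rfl fun k _ => hper a k]
      push_cast
      ring
  conv_lhs => rw [← Nat.div_add_mod K q]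
  rw [sum_range_add, hblock]
  refine add_le_add (mul_le_mul_of_nonneg_right Nat.cast_div_le hnn) ?_
  calc ∑ k ∈ range (K % q), F (q * (K / q) + k) ≤ ∑ _k ∈ range (K % q), B :=
        sum_le_sum fun k _ => (le_abs_self _).trans (hB _)
    _ = ((K % q : ℕ) : ℝ) * B := by simp
    _ ≤ q * B := by
        gcongr
        exact (Nat.mod_lt _ hq).le

/-- The function on residues modulo `p` equal to `1` off `B p` whose mean value is zero. -/
def sieveFun (B : ℕ → Finset ℕ) (p k : ℕ) : ℝ :=
  if k % p ∈ B p then -(((p : ℝ) - (B p).card) / (B p).card) else 1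

/-- The density of the sieve removing the residue classes in `B p`. -/
def sieveDensity (B : ℕ → Finset ℕ) (p : ℕ) : ℝ := (B p).card / ((p : ℝ) - (B p).card)

theorem sieveFun_mod (B : ℕ → Finset ℕ) (p k : ℕ) : sieveFun B p (k % p) = sieveFun B p k := by
  simp [sieveFun]

theorem sum_range_sieveFun_comp (B : ℕ → Finset ℕ) (p : ℕ) (hB : B p ⊆ range p) (φ : ℝ → ℝ) :
    ∑ k ∈ range p, φ (sieveFun B p k) =
      (B p).card * φ (-(((p : ℝ) - (B p).card) / (B p).card)) + ((p : ℝ) - (B p).card) * φ 1 := by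
  have h1 : ∀ k ∈ range p, φ (sieveFun B p k) =
      if k ∈ B p then φ (-(((p : ℝ) - (B p).card) / (B p).card)) else φ 1 := by
    intro k hk
    rw [sieveFun, Nat.mod_eq_of_lt (mem_range.1 hk)]
    split_ifs <;> rfl
  rw [sum_congr rfl h1, sum_ite, sum_const, sum_const, nsmul_eq_mul, nsmul_eq_mul,
    filter_mem_eq_inter, inter_eq_right.2 hB, filter_notMem_eq_sdiff, card_sdiff_of_subset hB,
    Nat.cast_sub (card_le_card hB), card_range]

theorem sum_range_sieveFun (B : ℕ → Finset ℕ) (p : ℕ) (hB : B p ⊆ range p)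
    (h0 : 0 < (B p).card) : ∑ k ∈ range p, sieveFun B p k = 0 := by
  have h := sum_range_sieveFun_comp B p hB id
  simp only [id] at h
  have : ((B p).card : ℝ) ≠ 0 := by positivity
  rw [h]
  field_simp
  ring

theorem sum_range_sieveFun_sq (B : ℕ → Finset ℕ) (p : ℕ) (hB : B p ⊆ range p)
    (h0 : 0 < (B p).card) (h1 : (B p).card < p) :
    ∑ k ∈ range p, sieveFun B p k ^ 2 = p / sieveDensity B p := by
  have h := sum_range_sieveFun_comp B p hB (fun x => x ^ 2)
  have h2 : ((B p).card : ℝ) ≠ 0 := by positivity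
  have h3 : (p : ℝ) - (B p).card ≠ 0 := (sub_pos.2 (by exact_mod_cast h1)).ne'
  rw [h, sieveDensity]
  field_simp
  ring

theorem sieveDensity_pos (B : ℕ → Finset ℕ) (p : ℕ) (h0 : 0 < (B p).card)
    (h1 : (B p).card < p) : 0 < sieveDensity B p :=
  div_pos (by exact_mod_cast h0) (sub_pos.2 (by exact_mod_cast h1))

theorem sieveDensity_mul_abs_sieveFun_le (B : ℕ → Finset ℕ) (p k : ℕ) (h0 : 0 < (B p).card)
    (h1 : (B p).card < p) : sieveDensity B p * |sieveFun B p k| ≤ p := by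
  have h2 : (0 : ℝ) < (B p).card := by exact_mod_cast h0
  have h4 : ((B p).card : ℝ) + 1 ≤ p := by exact_mod_cast h1
  have h3 : (0 : ℝ) < (p : ℝ) - (B p).card := by linarith
  rw [sieveDensity, sieveFun]
  split_ifs
  · rw [abs_neg, abs_of_pos (by positivity)]
    field_simp
    nlinarith
  · rw [abs_one, mul_one, div_le_iff₀ h3]
    nlinarith

theorem sum_range_sieveFun_mul (B : ℕ → Finset ℕ) (T U : Finset ℕ)
    (hp : ∀ p ∈ T ∪ U, p.Prime) (hB : ∀ p ∈ T ∪ U, B p ⊆ range p)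
    (h0 : ∀ p ∈ T ∪ U, 0 < (B p).card) (h1 : ∀ p ∈ T ∪ U, (B p).card < p) :
    ∑ k ∈ range (∏ p ∈ T ∪ U, p), (∏ p ∈ T, sieveFun B p k) * ∏ p ∈ U, sieveFun B p k =
      if T = U then (∏ p ∈ T, (p : ℝ)) / ∏ p ∈ T, sieveDensity B p else 0 := by
  have key : ∀ k, (∏ p ∈ T, sieveFun B p k) * ∏ p ∈ U, sieveFun B p k =
      ∏ p ∈ T ∪ U, (if p ∈ T then sieveFun B p k else 1) *
        (if p ∈ U then sieveFun B p k else 1) := by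
    intro k
    rw [prod_mul_distrib, prod_ite_mem, prod_ite_mem, union_inter_cancel_left,
      union_inter_cancel_right]
  simp_rw [key]
  rw [sum_range_prod_primes (T ∪ U) hp (fun p k => (if p ∈ T then sieveFun B p k else 1) *
        (if p ∈ U then sieveFun B p k else 1)) (fun p _ k => by simp only [sieveFun_mod])]
  split_ifs with h
  · subst h
    rw [union_self] at *
    rw [← prod_div_distrib]
    refine prod_congr rfl fun p hpT => ?_
    simp only [hpT, if_true, ← sq]
    exact sum_range_sieveFun_sq B p (hB p hpT) (h0 p hpT) (h1 p hpT)
  · obtain ⟨p, hpTU⟩ : ∃ p, ¬ (p ∈ T ↔ p ∈ U) := by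
      by_contra! hc
      exact h (Finset.ext hc)
    have hmem : p ∈ T ∪ U := by
      rw [mem_union]
      tauto
    refine prod_eq_zero hmem ?_
    have hz := sum_range_sieveFun B p (hB p hmem) (h0 p hmem)
    by_cases hT : p ∈ T
    · have hU : p ∉ U := by tauto
      simpa [hT, hU] using hz
    · have hU : p ∈ U := by tauto
      simpa [hT, hU] using hz

/-- The sets of primes in `P` whose product is at most `z`. -/
def sieveSupport (P : Finset ℕ) (z : ℕ) : Finset (Finset ℕ) :=
  P.powerset.filter fun T => ∏ p ∈ T, p ≤ z

/-- The sum of the multiplicative extension of `g` over products of distinct primes in `P`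
that are at most `z`. -/
def sieveSum (g : ℕ → ℝ) (P : Finset ℕ) (z : ℕ) : ℝ :=
  ∑ T ∈ sieveSupport P z, ∏ p ∈ T, g p

theorem card_sieveSupport_le (P : Finset ℕ) (hP : ∀ p ∈ P, p.Prime) (z : ℕ) :
    (sieveSupport P z).card ≤ z := by
  have : (sieveSupport P z).card ≤ (Icc 1 z).card := by
    refine card_le_card_of_injOn (fun T => ∏ p ∈ T, p) ?_ ?_
    · intro T hT
      simp only [sieveSupport, coe_filter, mem_powerset, Set.mem_ofPred_eq] at hT
      simp only [coe_Icc, Set.mem_Icc]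
      exact ⟨Nat.one_le_iff_ne_zero.2 (prod_ne_zero_iff.2 fun p hp => (hP p (hT.1 hp)).ne_zero),
        hT.2⟩
    · intro T hT U hU h
      simp only [sieveSupport, coe_filter, mem_powerset, Set.mem_ofPred_eq] at hT hU
      rw [← Nat.primeFactors_prod fun p hp => hP p (hT.1 hp),
        ← Nat.primeFactors_prod fun p hp => hP p (hU.1 hp)]
      exact congrArg Nat.primeFactors h
  simpa using this

/-- Selberg's upper bound sieve, with a crude error term. -/
theorem card_sifted_le (P : Finset ℕ) (hP : ∀ p ∈ P, p.Prime) (B : ℕ → Finset ℕ)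
    (hB : ∀ p ∈ P, B p ⊆ range p) (h0 : ∀ p ∈ P, 0 < (B p).card)
    (h1 : ∀ p ∈ P, (B p).card < p) (K z : ℕ) (hz : 1 ≤ z) :
    (((range K).filter fun k => ∀ p ∈ P, k % p ∉ B p).card : ℝ) ≤
      K / sieveSum (sieveDensity B) P z + (z : ℝ) ^ 6 := by
  set S := sieveSum (sieveDensity B) P z with hS
  have hmem : ∀ T ∈ sieveSupport P z, T ⊆ P ∧ ∏ p ∈ T, p ≤ z := fun T hT => by
    simpa [sieveSupport] using hT
  have hgpos : ∀ T ∈ sieveSupport P z, 0 < ∏ p ∈ T, sieveDensity B p := fun T hT =>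
    prod_pos fun p hp => sieveDensity_pos B p (h0 p ((hmem T hT).1 hp)) (h1 p ((hmem T hT).1 hp))
  have hS1 : 1 ≤ S := by
    have : ∅ ∈ sieveSupport P z := by simp [sieveSupport, hz]
    simpa [hS, sieveSum] using single_le_sum (f := fun T => ∏ p ∈ T, sieveDensity B p)
      (fun T hT => (hgpos T hT).le) this
  set lam : ℕ → ℝ := fun k =>
    ∑ T ∈ sieveSupport P z, (∏ p ∈ T, sieveDensity B p) * ∏ p ∈ T, sieveFun B p k with hlam
  have hsift : ((range K).filter fun k => ∀ p ∈ P, k % p ∉ B p).card * S ^ 2 ≤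
      ∑ k ∈ range K, lam k ^ 2 := by
    rw [← nsmul_eq_mul, ← sum_const]
    refine le_trans (le_of_eq ?_) (sum_le_sum_of_subset_of_nonneg (filter_subset
      (fun k => ∀ p ∈ P, k % p ∉ B p) _) fun k _ _ => sq_nonneg (lam k))
    refine sum_congr rfl fun k hk => ?_
    have hk2 := (mem_filter.1 hk).2
    have : lam k = S := by
      rw [hS, hlam, sieveSum]
      refine sum_congr rfl fun T hT => ?_
      rw [prod_eq_one (f := fun p => sieveFun B p k), mul_one]
      intro p hp
      simp [sieveFun, hk2 p ((hmem T hT).1 hp)]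
    rw [this]
  have hpair : ∀ T ∈ sieveSupport P z, ∀ U ∈ sieveSupport P z,
      ∑ k ∈ range K, ((∏ p ∈ T, sieveDensity B p) * ∏ p ∈ T, sieveFun B p k) *
        ((∏ p ∈ U, sieveDensity B p) * ∏ p ∈ U, sieveFun B p k) ≤
      (if T = U then K * ∏ p ∈ T, sieveDensity B p else 0) + (z : ℝ) ^ 4 := by
    intro T hT U hU
    have hTU : T ∪ U ⊆ P := union_subset (hmem T hT).1 (hmem U hU).1
    set q := ∏ p ∈ T ∪ U, p with hq
    have hqpos : 0 < q := prod_pos fun p hp => (hP p (hTU hp)).pos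
    have hqz : q ≤ z ^ 2 := by
      calc q ≤ (∏ p ∈ T ∪ U, p) * ∏ p ∈ T ∩ U, p :=
            Nat.le_mul_of_pos_right _ (prod_pos fun p hp =>
              (hP p ((hmem T hT).1 (mem_inter.1 hp).1)).pos)
        _ = (∏ p ∈ T, p) * ∏ p ∈ U, p := prod_union_inter
        _ ≤ z * z := Nat.mul_le_mul (hmem T hT).2 (hmem U hU).2
        _ = z ^ 2 := (sq z).symm
    have hone : ∀ V ∈ sieveSupport P z, ∀ k,
        |(∏ p ∈ V, sieveDensity B p) * ∏ p ∈ V, sieveFun B p k| ≤ z := by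
      intro V hV k
      have hVP := (hmem V hV).1
      rw [abs_mul, abs_of_pos (hgpos V hV), abs_prod, ← prod_mul_distrib]
      calc ∏ p ∈ V, sieveDensity B p * |sieveFun B p k| ≤ ∏ p ∈ V, (p : ℝ) :=
            prod_le_prod (fun p hp => mul_nonneg
              (sieveDensity_pos B p (h0 p (hVP hp)) (h1 p (hVP hp))).le (abs_nonneg _))
              fun p hp => sieveDensity_mul_abs_sieveFun_le B p k (h0 p (hVP hp)) (h1 p (hVP hp))
        _ ≤ z := by
            rw [← Nat.cast_prod]
            exact_mod_cast (hmem V hV).2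
    set F : ℕ → ℝ := fun k => ((∏ p ∈ T, sieveDensity B p) * ∏ p ∈ T, sieveFun B p k) *
        ((∏ p ∈ U, sieveDensity B p) * ∏ p ∈ U, sieveFun B p k) with hF
    have hper : ∀ k, F (k % q) = F k := by
      intro k
      have hprod : ∀ V, V ⊆ T ∪ U →
          ∏ p ∈ V, sieveFun B p (k % q) = ∏ p ∈ V, sieveFun B p k := fun V hV =>
        prod_congr rfl fun p hp => periodic_of_dvd (F := sieveFun B p)
          (dvd_prod_of_mem _ (hV hp)) (sieveFun_mod B p) k
      simp only [hF, hprod T subset_union_left, hprod U subset_union_right]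
    have hbound : ∀ k, |F k| ≤ (z : ℝ) * z := fun k => by
      rw [hF, abs_mul]
      exact mul_le_mul (hone T hT k) (hone U hU k) (abs_nonneg _) (Nat.cast_nonneg _)
    have hsum : ∑ k ∈ range q, F k = if T = U then q * ∏ p ∈ T, sieveDensity B p else 0 := by
      have h := sum_range_sieveFun_mul B T U (fun p hp => hP p (hTU hp))
        (fun p hp => hB p (hTU hp)) (fun p hp => h0 p (hTU hp)) (fun p hp => h1 p (hTU hp))
      have h2 : ∑ k ∈ range q, F k =
          ((∏ p ∈ T, sieveDensity B p) * ∏ p ∈ U, sieveDensity B p) *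
          ∑ k ∈ range q, (∏ p ∈ T, sieveFun B p k) * ∏ p ∈ U, sieveFun B p k := by
        rw [mul_sum]
        exact sum_congr rfl fun k _ => by rw [hF]; ring
      rw [h2, h]
      split_ifs with hTU'
      · subst hTU'
        have := (hgpos T hT).ne'
        rw [hq, union_self]
        push_cast
        field_simp
      · simp
    have hnn : 0 ≤ ∑ k ∈ range q, F k := by
      rw [hsum]
      split_ifs
      · exact mul_nonneg (Nat.cast_nonneg _) (hgpos T hT).le
      · exact le_rfl
    refine (sum_range_periodic_le hqpos F hper hbound hnn K).trans (add_le_add (le_of_eq ?_) ?_)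
    · rw [hsum]
      split_ifs
      · have : (q : ℝ) ≠ 0 := by positivity
        field_simp
      · simp
    · have : (q : ℝ) ≤ (z : ℝ) ^ 2 := by exact_mod_cast hqz
      nlinarith [sq_nonneg (z : ℝ)]
  have hcard : ((sieveSupport P z).card : ℝ) ≤ z := by
    exact_mod_cast card_sieveSupport_le P hP z
  have hsq : ∑ k ∈ range K, lam k ^ 2 ≤ K * S + (z : ℝ) ^ 6 := by
    calc ∑ k ∈ range K, lam k ^ 2
        = ∑ T ∈ sieveSupport P z, ∑ U ∈ sieveSupport P z, ∑ k ∈ range K,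
          ((∏ p ∈ T, sieveDensity B p) * ∏ p ∈ T, sieveFun B p k) *
          ((∏ p ∈ U, sieveDensity B p) * ∏ p ∈ U, sieveFun B p k) := by
          simp only [hlam, sq, sum_mul_sum]
          rw [sum_comm]
          exact sum_congr rfl fun T _ => sum_comm
      _ ≤ ∑ T ∈ sieveSupport P z, ∑ U ∈ sieveSupport P z,
          ((if T = U then K * ∏ p ∈ T, sieveDensity B p else 0) + (z : ℝ) ^ 4) :=
          sum_le_sum fun T hT => sum_le_sum fun U hU => hpair T hT U hU
      _ = K * S + ((sieveSupport P z).card : ℝ) ^ 2 * (z : ℝ) ^ 4 := by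
          simp only [sum_add_distrib, sum_ite_eq, sum_const, nsmul_eq_mul]
          congr 1
          · rw [hS, sieveSum, mul_sum]
            exact sum_congr rfl fun T hT => by rw [if_pos hT]
          · ring
      _ ≤ K * S + (z : ℝ) ^ 2 * (z : ℝ) ^ 4 := by gcongr
      _ = K * S + (z : ℝ) ^ 6 := by ring
  have hS0 : 0 < S := by linarith
  have hfin := hsift.trans hsq
  rw [← le_div_iff₀ (by positivity)] at hfin
  refine hfin.trans ?_
  rw [add_div]
  refine add_le_add (le_of_eq ?_) (div_le_self (by positivity) (one_le_pow₀ hS1))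
  field_simp

/-- The sum of `1 / x` over positive `x ≤ Z` all of whose prime factors lie in `Q`. -/
def factoredHarmonic (Q : Finset ℕ) (Z : ℕ) : ℝ :=
  ∑ x ∈ (Icc 1 Z).filter fun x => x.primeFactors ⊆ Q, (1 : ℝ) / x

theorem factoredHarmonic_nonneg (Q : Finset ℕ) (Z : ℕ) : 0 ≤ factoredHarmonic Q Z :=
  sum_nonneg fun _ _ => by positivity

theorem factoredHarmonic_mono (Q : Finset ℕ) {Y Z : ℕ} (h : Y ≤ Z) :
    factoredHarmonic Q Y ≤ factoredHarmonic Q Z :=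
  sum_le_sum_of_subset_of_nonneg (filter_subset_filter _ (Icc_subset_Icc_right h))
    fun _ _ _ => by positivity

theorem factoredHarmonic_insert {Q : Finset ℕ} {p : ℕ} (hp : p.Prime) (hpQ : p ∉ Q) (Z : ℕ) :
    factoredHarmonic (insert p Q) Z =
      factoredHarmonic Q Z + 1 / p * factoredHarmonic (insert p Q) (Z / p) := by
  unfold factoredHarmonic
  rw [← sum_filter_not_add_sum_filter _ (fun x => p ∣ x), filter_filter, filter_filter]
  congr 1
  · refine sum_congr (filter_congr fun x hx => ?_) fun _ _ => rfl
    have hx0 : x ≠ 0 := by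
      have := (mem_Icc.1 hx).1
      omega
    constructor
    · rintro ⟨h, hd⟩ q hq
      rcases mem_insert.1 (h hq) with rfl | h'
      · exact absurd (Nat.dvd_of_mem_primeFactors hq) hd
      · exact h'
    · exact fun h => ⟨h.trans (subset_insert _ _),
        fun hd => hpQ (h (Nat.mem_primeFactors.2 ⟨hp, hd, hx0⟩))⟩
  · rw [mul_sum]
    symm
    refine sum_bij' (fun x _ => p * x) (fun x _ => x / p) ?_ ?_ ?_ ?_ ?_
    · intro x hx
      simp only [mem_filter, mem_Icc] at hx ⊢
      obtain ⟨⟨hx1, hx2⟩, hx3⟩ := hx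
      refine ⟨⟨Nat.mul_pos hp.pos hx1, ?_⟩, ?_, dvd_mul_right _ _⟩
      · rw [mul_comm]
        exact (Nat.le_div_iff_mul_le hp.pos).1 hx2
      · rw [Nat.primeFactors_mul hp.ne_zero (by omega), hp.primeFactors]
        exact union_subset (by simp) hx3
    · intro x hx
      simp only [mem_filter, mem_Icc] at hx ⊢
      obtain ⟨⟨hx1, hx2⟩, hx3, hd⟩ := hx
      refine ⟨⟨Nat.div_pos (Nat.le_of_dvd hx1 hd) hp.pos, Nat.div_le_div_right hx2⟩, ?_⟩
      exact (Nat.primeFactors_mono (Nat.div_dvd_of_dvd hd) (by omega)).trans hx3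
    · intro x _
      exact Nat.mul_div_cancel_left x hp.pos
    · intro x hx
      exact Nat.mul_div_cancel' (mem_filter.1 hx).2.2
    · intro x _
      push_cast
      rw [one_div_mul_one_div]

theorem factoredHarmonic_insert_le {Q : Finset ℕ} {p : ℕ} (hp : p.Prime) (hpQ : p ∉ Q) (Z : ℕ) :
    factoredHarmonic (insert p Q) Z ≤ (1 - 1 / (p : ℝ))⁻¹ * factoredHarmonic Q Z := by
  have h := factoredHarmonic_insert hp hpQ Z
  have h2 := factoredHarmonic_mono (insert p Q) (Nat.div_le_self Z p)
  have hp1 : (1 : ℝ) < p := by exact_mod_cast hp.one_lt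
  have hp2 : 1 / (p : ℝ) < 1 := by rwa [div_lt_one (by linarith)]
  have hp3 : 0 ≤ 1 / (p : ℝ) := by positivity
  rw [← div_eq_inv_mul, le_div_iff₀ (by linarith)]
  nlinarith

theorem factoredHarmonic_union_le (Q D : Finset ℕ) (hD : ∀ p ∈ D, p.Prime) (hQD : Disjoint Q D)
    (Z : ℕ) :
    factoredHarmonic (Q ∪ D) Z ≤ (∏ p ∈ D, (1 - 1 / (p : ℝ))⁻¹) * factoredHarmonic Q Z := by
  induction D using Finset.induction_on with
  | empty => simp
  | insert p D hp ih =>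
    have hp' := hD p (mem_insert_self _ _)
    rw [disjoint_insert_right] at hQD
    have hp1 : (1 : ℝ) < p := by exact_mod_cast hp'.one_lt
    have hp2 : 1 / (p : ℝ) < 1 := by rwa [div_lt_one (by linarith)]
    rw [union_insert, prod_insert hp, mul_assoc]
    refine (factoredHarmonic_insert_le hp' (by simp [hQD.1, hp]) Z).trans ?_
    exact mul_le_mul_of_nonneg_left (ih (fun q hq => hD q (mem_insert_of_mem hq)) hQD.2)
      (inv_nonneg.2 (by linarith))

theorem factoredHarmonic_insert_le_add {Q : Finset ℕ} {p : ℕ} (hp : p.Prime) (hpQ : p ∉ Q)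
    (Z : ℕ) :
    factoredHarmonic (insert p Q) Z ≤
      factoredHarmonic Q Z + 1 / ((p : ℝ) - 1) * factoredHarmonic Q (Z / p) := by
  have hp1 : (1 : ℝ) < p := by exact_mod_cast hp.one_lt
  have hp2 : (p : ℝ) - 1 ≠ 0 := by linarith
  rw [factoredHarmonic_insert hp hpQ Z]
  refine add_le_add le_rfl ?_
  have h := mul_le_mul_of_nonneg_left (factoredHarmonic_insert_le hp hpQ (Z / p))
    (by positivity : 0 ≤ 1 / (p : ℝ))
  refine h.trans (le_of_eq ?_)
  field_simp

theorem sieveSum_nonneg {g : ℕ → ℝ} {P : Finset ℕ} (hg : ∀ p ∈ P, 0 ≤ g p) (z : ℕ) :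
    0 ≤ sieveSum g P z :=
  sum_nonneg fun _ hT => prod_nonneg fun p hp =>
    hg p (mem_powerset.1 (mem_filter.1 hT).1 hp)

theorem sieveSum_mono {g : ℕ → ℝ} {P : Finset ℕ} (hg : ∀ p ∈ P, 0 ≤ g p) {y z : ℕ} (h : y ≤ z) :
    sieveSum g P y ≤ sieveSum g P z := by
  refine sum_le_sum_of_subset_of_nonneg (fun T hT => ?_) fun _ hT _ => prod_nonneg fun p hp =>
    hg p (mem_powerset.1 (mem_filter.1 hT).1 hp)
  simp only [sieveSupport, mem_filter] at hT ⊢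
  exact ⟨hT.1, hT.2.trans h⟩

theorem sieveSum_insert (g : ℕ → ℝ) {P : Finset ℕ} {p : ℕ} (hp : 0 < p) (hpP : p ∉ P) (z : ℕ) :
    sieveSum g (insert p P) z = sieveSum g P z + g p * sieveSum g P (z / p) := by
  unfold sieveSum sieveSupport
  rw [sum_filter, sum_powerset_insert hpP, ← sum_filter]
  congr 1
  rw [mul_sum, sum_filter]
  refine sum_congr rfl fun T hT => ?_
  have hpT : p ∉ T := fun h => hpP (mem_powerset.1 hT h)
  have : p * ∏ q ∈ T, q ≤ z ↔ ∏ q ∈ T, q ≤ z / p := by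
    rw [Nat.le_div_iff_mul_le hp, mul_comm]
  simp only [prod_insert hpT, this]

theorem div_mul_le_mul_div (a b c : ℕ) : a / c * b ≤ a * b / c := by
  rw [mul_comm, mul_comm a b]
  exact Nat.mul_div_le_mul_div_assoc b a c

theorem factoredHarmonic_mul_le_sieveSum (P : Finset ℕ) (hP : ∀ p ∈ P, p.Prime) (R : ℕ → Prop)
    [DecidablePred R] (g : ℕ → ℝ)
    (hg : ∀ p ∈ P, (if R p then 2 * (1 / ((p : ℝ) - 1)) + (1 / ((p : ℝ) - 1)) ^ 2
      else 1 / ((p : ℝ) - 1)) ≤ g p) (Y Z : ℕ) :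
    factoredHarmonic P Y * factoredHarmonic (P.filter R) Z ≤ sieveSum g P (Y * Z) := by
  have hw : ∀ p : ℕ, p.Prime → 0 ≤ 1 / ((p : ℝ) - 1) := fun p hp =>
    div_nonneg zero_le_one (sub_nonneg.2 (by exact_mod_cast hp.one_le))
  induction P using Finset.induction_on generalizing Y Z with
  | empty =>
    have h1 : ∀ X : ℕ, factoredHarmonic ∅ X ≤ 1 := by
      intro X
      have hsub : ((Icc 1 X).filter fun x => x.primeFactors ⊆ ∅) ⊆ {1} := by
        intro x hx
        simp only [mem_filter, mem_Icc, subset_empty, Nat.primeFactors_eq_empty] at hx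
        simp only [mem_singleton]
        omega
      calc factoredHarmonic ∅ X ≤ ∑ x ∈ ({1} : Finset ℕ), (1 : ℝ) / x :=
            sum_le_sum_of_subset_of_nonneg hsub fun _ _ _ => by positivity
        _ = 1 := by simp
    have h0 : factoredHarmonic ∅ 0 = 0 := by simp [factoredHarmonic]
    rw [filter_empty]
    rcases Nat.eq_zero_or_pos Y with rfl | hY
    · rw [h0, zero_mul]
      exact sieveSum_nonneg (by simp) _
    rcases Nat.eq_zero_or_pos Z with rfl | hZ
    · rw [h0, mul_zero]
      exact sieveSum_nonneg (by simp) _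
    have h2 : sieveSum g ∅ (Y * Z) = 1 := by
      have : 1 ≤ Y * Z := Nat.mul_pos hY hZ
      simp [sieveSum, sieveSupport, sum_filter, this]
    rw [h2]
    exact mul_le_one₀ (h1 Y) (factoredHarmonic_nonneg _ _) (h1 Z)
  | insert p P hpP ih =>
    have hp := hP p (mem_insert_self _ _)
    have hP' : ∀ q ∈ P, q.Prime := fun q hq => hP q (mem_insert_of_mem hq)
    have hg' := fun q (hq : q ∈ P) => hg q (mem_insert_of_mem hq)
    have ih' := ih hP' hg'
    have hg0 : ∀ q ∈ P, 0 ≤ g q := fun q hq => by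
      refine le_trans ?_ (hg' q hq)
      have := hw q (hP' q hq)
      split_ifs <;> positivity
    have hgp := hg p (mem_insert_self _ _)
    set w := 1 / ((p : ℝ) - 1) with hwdef
    have hw0 : 0 ≤ w := hw p hp
    have hA := factoredHarmonic_insert_le_add hp hpP Y
    have hG0 : 0 ≤ sieveSum g P (Y * Z / p) := sieveSum_nonneg hg0 _
    have e1 := ih' Y Z
    have e2 := (ih' (Y / p) Z).trans (sieveSum_mono hg0 (div_mul_le_mul_div _ _ _))
    have hH0 := factoredHarmonic_nonneg P (Y / p)
    have hmul := mul_le_mul_of_nonneg_left e2 hw0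
    rw [sieveSum_insert g hp.pos hpP, filter_insert]
    split_ifs at hgp ⊢ with hR
    · have hB := factoredHarmonic_insert_le_add hp
        (fun h => hpP (mem_filter.1 h).1 : p ∉ P.filter R) Z
      rw [← hwdef] at hA hB
      have e3 := (ih' Y (Z / p)).trans (sieveSum_mono hg0 (Nat.mul_div_le_mul_div_assoc _ _ _))
      have e4 := (ih' (Y / p) (Z / p)).trans (sieveSum_mono hg0 (
        (div_mul_le_mul_div _ _ _).trans
        (Nat.div_le_div_right (Nat.mul_le_mul_left _ (Nat.div_le_self _ _)))))
      have hm3 := mul_le_mul_of_nonneg_left e3 hw0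
      have hm4 := mul_le_mul_of_nonneg_left e4 (sq_nonneg w)
      have hgG := mul_le_mul_of_nonneg_right hgp hG0
      have hAB := mul_le_mul hA hB (factoredHarmonic_nonneg _ _)
        (add_nonneg (factoredHarmonic_nonneg _ _) (mul_nonneg hw0 hH0))
      nlinarith
    · rw [← hwdef] at hA
      have hAB := mul_le_mul_of_nonneg_right hA (factoredHarmonic_nonneg (P.filter R) Z)
      have hgG := mul_le_mul_of_nonneg_right hgp hG0
      nlinarith

theorem log_le_factoredHarmonic (Z : ℕ) :
    Real.log (Z + 1) ≤ factoredHarmonic ((Icc 1 Z).filter Nat.Prime) Z := by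
  have h := log_add_one_le_harmonic Z
  rw [harmonic_eq_sum_Icc] at h
  push_cast at h
  refine h.trans (le_of_eq ?_)
  unfold factoredHarmonic
  rw [filter_true_of_mem]
  · simp
  · intro x hx q hq
    have hq' := Nat.mem_primeFactors.1 hq
    have hx' := mem_Icc.1 hx
    exact mem_filter.2 ⟨mem_Icc.2 ⟨hq'.1.one_le, (Nat.le_of_dvd hx'.1 hq'.2.1).trans hx'.2⟩, hq'.1⟩

theorem sum_log_div_primes_le {y : ℕ} (hy : 0 < y) :
    ∑ p ∈ (Icc 1 y).filter Nat.Prime, Real.log p / p ≤ 2 * Real.log y := by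
  have hy0 : (0 : ℝ) < y := by exact_mod_cast hy
  have h1 : ∀ k ∈ Icc 1 y, ∑ p ∈ (Icc 1 y).filter Nat.Prime, (if p ∣ k then Real.log p else 0) ≤
      Real.log y := by
    intro k hk
    have hk' := mem_Icc.1 hk
    have hle : ∏ p ∈ ((Icc 1 y).filter Nat.Prime).filter (· ∣ k), p ≤ k := by
      refine Nat.le_of_dvd hk'.1 (dvd_trans (prod_dvd_prod_of_subset _ _ _ ?_)
        (Nat.prod_primeFactors_dvd k))
      intro p hp
      simp only [mem_filter] at hp
      exact Nat.mem_primeFactors.2 ⟨hp.1.2, hp.2, by omega⟩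
    rw [← sum_filter, ← Real.log_prod]
    · refine Real.log_le_log (prod_pos fun p hp => ?_) ?_
      · simp only [mem_filter] at hp
        exact_mod_cast hp.1.2.pos
      · rw [← Nat.cast_prod]
        exact_mod_cast hle.trans hk'.2
    · intro p hp
      simp only [mem_filter] at hp
      exact_mod_cast hp.1.2.ne_zero
  have h2 := sum_le_sum h1
  rw [sum_comm, sum_const, Nat.card_Icc, nsmul_eq_mul, Nat.add_sub_cancel] at h2
  have h3 : ∀ p ∈ (Icc 1 y).filter Nat.Prime, (y : ℝ) / 2 * (Real.log p / p) ≤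
      ∑ k ∈ Icc 1 y, (if p ∣ k then Real.log p else 0) := by
    intro p hp
    simp only [mem_filter, mem_Icc] at hp
    have hp0 : (0 : ℝ) < p := by exact_mod_cast hp.2.pos
    have hlog : 0 ≤ Real.log p := Real.log_natCast_nonneg p
    have hcount : ((Icc 1 y).filter (p ∣ ·)).card = y / p := by
      have : Icc 1 y = Ioc 0 y := rfl
      rw [this, Nat.Ioc_filter_dvd_card_eq_div]
    rw [← sum_filter, sum_const, hcount, nsmul_eq_mul]
    have hdiv : (y : ℝ) / 2 ≤ p * (y / p : ℕ) := by
      have h4 : 1 ≤ y / p := Nat.div_pos hp.1.2 hp.2.pos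
      have h5 : y < p * (y / p) + p := Nat.lt_mul_div_succ y hp.2.pos
      have h6 : y ≤ 2 * (p * (y / p)) := by nlinarith
      have : (y : ℝ) ≤ 2 * (p * (y / p : ℕ)) := by exact_mod_cast h6
      linarith
    rw [← mul_div_assoc, div_le_iff₀ hp0]
    nlinarith
  have h4 := (sum_le_sum h3).trans h2
  rw [← mul_sum] at h4
  have h5 : (y : ℝ) * ∑ p ∈ (Icc 1 y).filter Nat.Prime, Real.log p / p ≤
      y * (2 * Real.log y) := by linarith
  exact le_of_mul_le_mul_left h5 hy0

theorem sum_log_div_le (D : Finset ℕ) (hD : ∀ p ∈ D, p.Prime) {y : ℕ} (hy : 0 < y) :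
    ∑ p ∈ D, Real.log p / p ≤ 2 * Real.log y + (∑ p ∈ D, Real.log p) / y := by
  have hy0 : (0 : ℝ) < y := by exact_mod_cast hy
  have hnn : ∀ p : ℕ, 0 ≤ Real.log p / p := fun p =>
    div_nonneg (Real.log_natCast_nonneg p) (Nat.cast_nonneg p)
  rw [← sum_filter_add_sum_filter_not D (· ≤ y)]
  refine add_le_add ?_ ?_
  · refine (sum_le_sum_of_subset_of_nonneg ?_ fun p _ _ => hnn p).trans (sum_log_div_primes_le hy)
    intro p hp
    simp only [mem_filter, mem_Icc] at hp ⊢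
    exact ⟨⟨(hD p hp.1).one_le, hp.2⟩, hD p hp.1⟩
  · rw [sum_div]
    refine (sum_le_sum fun p hp => ?_).trans (sum_le_sum_of_subset_of_nonneg (filter_subset _ _)
      fun p _ _ => div_nonneg (Real.log_natCast_nonneg p) hy0.le)
    have hyp : (y : ℝ) ≤ p := by exact_mod_cast (not_le.1 (mem_filter.1 hp).2).le
    exact div_le_div_of_nonneg_left (Real.log_natCast_nonneg p) hy0 hyp

theorem prod_one_sub_rpow_inv_le (D : Finset ℕ) (hD : ∀ p ∈ D, p.Prime) {s : ℝ} (hs : 1 < s) :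
    ∏ p ∈ D, (1 - (p : ℝ) ^ (-s))⁻¹ ≤ 1 + 1 / (s - 1) := by
  let f : ℕ →* ℝ :=
    { toFun := fun n => (n : ℝ) ^ (-s)
      map_one' := by simp
      map_mul' := fun a b => by
        push_cast
        exact Real.mul_rpow (Nat.cast_nonneg a) (Nat.cast_nonneg b) }
  have hf : ∀ n, f n = (n : ℝ) ^ (-s) := fun n => rfl
  have hsum : Summable f := by
    have := Real.summable_nat_rpow.2 (by linarith : -s < -1)
    exact this
  have hnn : ∀ n, 0 ≤ f n := fun n => Real.rpow_nonneg (Nat.cast_nonneg n) _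
  have h1 := EulerProduct.prod_filter_prime_geometric_eq_tsum_factoredNumbers hsum D
  rw [filter_true_of_mem hD] at h1
  simp only [hf] at h1
  rw [h1]
  have h2 : ∑' m : Nat.factoredNumbers D, f m ≤ ∑' n, f n :=
    hsum.tsum_subtype_le _ (Nat.factoredNumbers D) hnn
  refine h2.trans ?_
  have h3 := ZetaAsymptotics.zeta_limit_aux1 hs
  have h4 : 0 ≤ ZetaAsymptotics.termTSum s := tsum_nonneg fun n => ZetaAsymptotics.term_nonneg _ _
  have h5 : ∑' n, f n = ∑' n : ℕ, 1 / (n + 1 : ℝ) ^ s := by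
    rw [hsum.tsum_eq_zero_add]
    have : f 0 = 0 := by
      rw [hf, Nat.cast_zero, Real.zero_rpow (by linarith)]
    rw [this, zero_add]
    refine tsum_congr fun n => ?_
    rw [hf, Real.rpow_neg (Nat.cast_nonneg _), one_div]
    push_cast
    rfl
  rw [h5]
  nlinarith

theorem one_sub_inv_prime_inv_le {p : ℕ} (hp : p.Prime) {ε : ℝ} (hε : 0 < ε) :
    (1 - 1 / (p : ℝ))⁻¹ ≤
      Real.exp (2 * ε * (Real.log p / p)) * (1 - (p : ℝ) ^ (-(1 + ε)))⁻¹ := by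
  have hp2 : (2 : ℝ) ≤ p := by exact_mod_cast hp.two_le
  have hp0 : (0 : ℝ) < p := by linarith
  have hlog : 0 ≤ Real.log p := Real.log_natCast_nonneg p
  have hhalf : 1 / (p : ℝ) ≤ 1 / 2 := one_div_le_one_div_of_le (by norm_num) hp2
  have hpow : (p : ℝ) ^ (-(1 + ε)) = 1 / p * Real.exp (-(ε * Real.log p)) := by
    rw [Real.rpow_def_of_pos hp0, one_div, ← Real.exp_log (inv_pos.2 hp0), Real.log_inv,
      ← Real.exp_add]
    congr 1
    ring
  have h1 := Real.add_one_le_exp (-(ε * Real.log p))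
  have h2 := Real.add_one_le_exp (2 * ε * (Real.log p / p))
  have h3 : Real.exp (-(ε * Real.log p)) ≤ 1 := Real.exp_le_one_iff.2 (by
    have := mul_nonneg hε.le hlog
    linarith)
  have hinv : 0 < 1 / (p : ℝ) := by positivity
  have h4 : (p : ℝ) ^ (-(1 + ε)) ≤ 1 / 2 := by
    rw [hpow]
    nlinarith
  have hu : 0 ≤ ε * (Real.log p / p) := by positivity
  have h5 : 1 / (p : ℝ) - ε * (Real.log p / p) ≤ (p : ℝ) ^ (-(1 + ε)) := by
    rw [hpow]
    calc 1 / (p : ℝ) - ε * (Real.log p / p) = 1 / p * (-(ε * Real.log p) + 1) := by ring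
      _ ≤ _ := mul_le_mul_of_nonneg_left h1 hinv.le
  rw [← div_eq_mul_inv, le_div_iff₀ (by linarith), ← div_eq_inv_mul, div_le_iff₀ (by linarith)]
  nlinarith

/-- The upper bound in Mertens' third theorem, for an arbitrary set of primes. -/
theorem prod_one_sub_inv_le (D : Finset ℕ) (hD : ∀ p ∈ D, p.Prime) {L : ℝ}
    (hL1 : 1 ≤ L) (hL : 2 ≤ Real.log L) (hsum : ∑ p ∈ D, Real.log p ≤ 4 * L) :
    ∏ p ∈ D, (1 - 1 / (p : ℝ))⁻¹ ≤ 2 * Real.exp 10 * Real.log L := by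
  set l := Real.log L with hl
  have hl0 : 0 < l := by linarith
  set ε := 1 / l with hε
  have hε0 : 0 < ε := by positivity
  have hy : 0 < ⌈L⌉₊ := Nat.ceil_pos.2 (by linarith)
  have hyL : (⌈L⌉₊ : ℝ) ≤ 2 * L := (Nat.ceil_lt_add_one (by linarith)).le.trans (by linarith)
  have hy0 : (0 : ℝ) < ⌈L⌉₊ := by exact_mod_cast hy
  have h1 := sum_log_div_le D hD hy
  have h2 : Real.log ⌈L⌉₊ ≤ l + 1 := by
    have h := Real.log_le_log hy0 hyL
    rw [Real.log_mul two_ne_zero (by linarith)] at h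
    have := Real.log_le_sub_one_of_pos (zero_lt_two (α := ℝ))
    linarith
  have h3 : (∑ p ∈ D, Real.log p) / ⌈L⌉₊ ≤ 4 := by
    rw [div_le_iff₀ hy0]
    have := Nat.le_ceil L
    linarith
  have h4 : 2 * ε * ∑ p ∈ D, Real.log p / p ≤ 10 := by
    have h5 : ∑ p ∈ D, Real.log p / p ≤ 5 * l := by linarith
    calc 2 * ε * ∑ p ∈ D, Real.log p / p ≤ 2 * ε * (5 * l) :=
          mul_le_mul_of_nonneg_left h5 (by positivity)
      _ = 10 := by
          rw [hε]
          field_simp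
          norm_num
  have hs := prod_one_sub_rpow_inv_le D hD (by linarith : 1 < 1 + ε)
  have hpos : ∀ p ∈ D, 0 ≤ (1 - 1 / (p : ℝ))⁻¹ := fun p hp => by
    have : (1 : ℝ) ≤ p := by exact_mod_cast (hD p hp).one_le
    exact inv_nonneg.2 (sub_nonneg.2 ((div_le_one (by linarith)).2 this))
  calc ∏ p ∈ D, (1 - 1 / (p : ℝ))⁻¹
      ≤ ∏ p ∈ D, Real.exp (2 * ε * (Real.log p / p)) * (1 - (p : ℝ) ^ (-(1 + ε)))⁻¹ :=
        prod_le_prod hpos fun p hp => one_sub_inv_prime_inv_le (hD p hp) hε0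
    _ = Real.exp (2 * ε * ∑ p ∈ D, Real.log p / p) * ∏ p ∈ D, (1 - (p : ℝ) ^ (-(1 + ε)))⁻¹ := by
        rw [prod_mul_distrib, ← Real.exp_sum, mul_sum]
    _ ≤ Real.exp 10 * (1 + 1 / (1 + ε - 1)) :=
        mul_le_mul (Real.exp_le_exp.2 h4) hs (prod_nonneg fun p hp => inv_nonneg.2 (sub_nonneg.2
          (Real.rpow_le_one_of_one_le_of_nonpos (by exact_mod_cast (hD p hp).one_le)
            (by linarith)))) (Real.exp_pos _).le
    _ = Real.exp 10 * (1 + l) := by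
        rw [hε]
        simp
    _ ≤ 2 * Real.exp 10 * l := by nlinarith [Real.exp_pos 10]

/-- The odd primes up to `Z` that do not divide `m`. -/
def siftingPrimes (m Z : ℕ) : Finset ℕ :=
  ((Icc 1 Z).filter Nat.Prime).filter fun p => ¬ p ∣ 2 * m

theorem prime_of_mem_siftingPrimes {m Z p : ℕ} (h : p ∈ siftingPrimes m Z) : p.Prime :=
  (mem_filter.1 (mem_filter.1 h).1).2

theorem exists_residue {p m : ℕ} (hp : p.Prime) (hpm : ¬ p ∣ m) (a : ℕ) :
    ∃ r < p, m * r + 1 ≡ a [MOD p] := by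
  have : Fact p.Prime := ⟨hp⟩
  have hm : (m : ZMod p) ≠ 0 := fun h => hpm ((ZMod.natCast_eq_zero_iff m p).1 h)
  refine ⟨(((a : ZMod p) - 1) / m).val, ZMod.val_lt _, ?_⟩
  rw [← ZMod.natCast_eq_natCast_iff]
  push_cast
  rw [ZMod.natCast_zmod_val]
  field_simp
  ring

theorem card_twin_le (n m Z : ℕ) (hm : 0 < m) (hZ : 1 ≤ Z) :
    (((range n).filter fun p => p.Prime ∧ m ∣ p - 1 ∧ (n - p).Prime).card : ℝ) ≤
      ((n : ℝ) / m + 1) / (factoredHarmonic (siftingPrimes m Z) Z *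
        factoredHarmonic ((siftingPrimes m Z).filter fun p => ¬ p ∣ n) Z) +
      ((Z : ℝ) ^ 12 + 2 * (Z + 1)) := by
  classical
  set P := siftingPrimes m Z with hPdef
  have hP : ∀ p ∈ P, p.Prime := fun p hp => prime_of_mem_siftingPrimes hp
  have hPm : ∀ p ∈ P, ¬ p ∣ m := fun p hp h =>
    (mem_filter.1 hp).2 (h.trans (dvd_mul_left _ _))
  have hP3 : ∀ p ∈ P, 3 ≤ p := fun p hp => by
    have h2 := (hP p hp).two_le
    have : p ≠ 2 := by
      rintro rfl
      exact (mem_filter.1 hp).2 (dvd_mul_right _ _)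
    omega
  have hPZ : ∀ p ∈ P, p ≤ Z := fun p hp => (mem_Icc.1 (mem_filter.1 (mem_filter.1 hp).1).1).2
  have hres : ∀ p a : ℕ, ∃ r, p ∈ P → r < p ∧ m * r + 1 ≡ a [MOD p] := by
    intro p a
    by_cases hp : p ∈ P
    · obtain ⟨r, hr⟩ := exists_residue (hP p hp) (hPm p hp) a
      exact ⟨r, fun _ => hr⟩
    · exact ⟨0, fun h => absurd h hp⟩
  choose r hr using hres
  set B : ℕ → Finset ℕ := fun p => if p ∣ n then {r p 0} else {r p 0, r p n} with hB
  have hBsub : ∀ p ∈ P, B p ⊆ range p := by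
    intro p hp x hx
    rw [mem_range]
    simp only [hB] at hx
    split_ifs at hx
    · rw [mem_singleton.1 hx]
      exact (hr p 0 hp).1
    · rcases mem_insert.1 hx with rfl | hx
      · exact (hr p 0 hp).1
      · rw [mem_singleton.1 hx]
        exact (hr p n hp).1
  have hBcard : ∀ p ∈ P, (B p).card = if p ∣ n then 1 else 2 := by
    intro p hp
    simp only [hB]
    split_ifs with h
    · simp
    · refine card_pair fun heq => h ?_
      have h0 := (hr p 0 hp).2
      rw [heq] at h0
      exact (Nat.modEq_zero_iff_dvd).1 ((hr p n hp).2.symm.trans h0)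
  have hB0 : ∀ p ∈ P, 0 < (B p).card := fun p hp => by
    rw [hBcard p hp]
    split_ifs <;> norm_num
  have hB1 : ∀ p ∈ P, (B p).card < p := fun p hp => by
    have := hP3 p hp
    rw [hBcard p hp]
    split_ifs <;> omega
  have hsieve := card_sifted_le P hP B hBsub hB0 hB1 (n / m + 1) (Z * Z) (Nat.mul_pos hZ hZ)
  set sifted := (range (n / m + 1)).filter fun k => ∀ p ∈ P, k % p ∉ B p with hsifted
  have hsub : ((range n).filter fun p => p.Prime ∧ m ∣ p - 1 ∧ (n - p).Prime) ⊆
      (range (Z + 1) ∪ (range (Z + 1)).image (n - ·)) ∪ sifted.image fun k => m * k + 1 := by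
    intro p hp
    simp only [mem_filter, mem_range] at hp
    obtain ⟨hpn, hpp, ⟨k, hk⟩, hpp'⟩ := hp
    have hpk : p = m * k + 1 := by
      have := hpp.one_le
      omega
    rcases Nat.lt_or_ge p (Z + 1) with h1 | h1
    · exact mem_union_left _ (mem_union_left _ (mem_range.2 h1))
    rcases Nat.lt_or_ge (n - p) (Z + 1) with h2 | h2
    · refine mem_union_left _ (mem_union_right _ (mem_image.2 ⟨n - p, mem_range.2 h2, ?_⟩))
      omega
    refine mem_union_right _ (mem_image.2 ⟨k, mem_filter.2 ⟨mem_range.2 ?_, ?_⟩, hpk.symm⟩)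
    · refine Nat.lt_succ_of_le ((Nat.le_div_iff_mul_le hm).2 ?_)
      rw [mul_comm]
      omega
    · intro q hq hmem
      have hmod : ∀ a, k % q = r q a → p ≡ a [MOD q] := by
        intro a ha
        rw [hpk]
        refine Nat.ModEq.trans ?_ (hr q a hq).2
        rw [← ha]
        exact ((Nat.mod_modEq k q).symm.mul_left m).add_right 1
      have hqZ := hPZ q hq
      have hzero : k % q ≠ r q 0 := by
        intro h
        have h3 := (Nat.prime_dvd_prime_iff_eq (hP q hq) hpp).1
          ((Nat.modEq_zero_iff_dvd).1 (hmod 0 h))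
        omega
      simp only [hB] at hmem
      split_ifs at hmem
      · exact hzero (mem_singleton.1 hmem)
      · rcases mem_insert.1 hmem with h | h
        · exact hzero h
        · have h3 := (Nat.prime_dvd_prime_iff_eq (hP q hq) hpp').1
            ((Nat.modEq_iff_dvd' hpn.le).1 (hmod n (mem_singleton.1 h)))
          omega
  have hcard : ((range n).filter fun p => p.Prime ∧ m ∣ p - 1 ∧ (n - p).Prime).card ≤
      2 * (Z + 1) + sifted.card := by
    refine (card_le_card hsub).trans ((card_union_le _ _).trans (add_le_add ?_ card_image_le))
    refine (card_union_le _ _).trans ?_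
    have := card_image_le (s := range (Z + 1)) (f := (n - ·))
    simp only [card_range] at this ⊢
    omega
  have hS := factoredHarmonic_mul_le_sieveSum P hP (fun p => ¬ p ∣ n) (sieveDensity B) (by
    intro p hp
    have h3 : (3 : ℝ) ≤ p := by exact_mod_cast hP3 p hp
    rw [sieveDensity, hBcard p hp]
    by_cases h : p ∣ n
    · simp [h]
    · simp only [h, not_false_eq_true, if_true, if_false, Nat.cast_ofNat]
      have h1 : (0 : ℝ) < p - 1 := by linarith
      have h2 : (0 : ℝ) < p - 2 := by linarith
      rw [← sub_nonneg]
      have : (2 : ℝ) / (p - 2) - (2 * (1 / ((p : ℝ) - 1)) + (1 / ((p : ℝ) - 1)) ^ 2) =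
          p / ((p - 2) * (p - 1) ^ 2) := by
        field_simp
        ring
      rw [this]
      positivity) Z Z
  have hone : ∀ Q, 1 ≤ factoredHarmonic Q Z := fun Q => by
    have hmem : 1 ∈ (Icc 1 Z).filter fun x => x.primeFactors ⊆ Q := by simp [hZ]
    simpa [factoredHarmonic] using
      single_le_sum (f := fun x : ℕ => (1 : ℝ) / x) (fun _ _ => by positivity) hmem
  have hHpos : 0 < factoredHarmonic P Z * factoredHarmonic (P.filter fun p => ¬ p ∣ n) Z :=
    mul_pos (zero_lt_one.trans_le (hone _)) (zero_lt_one.trans_le (hone _))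
  have hK : ((n / m + 1 : ℕ) : ℝ) ≤ (n : ℝ) / m + 1 := by
    push_cast
    exact add_le_add Nat.cast_div_le le_rfl
  have hmain : ((n / m + 1 : ℕ) : ℝ) / sieveSum (sieveDensity B) P (Z * Z) ≤
      ((n : ℝ) / m + 1) / (factoredHarmonic P Z *
        factoredHarmonic (P.filter fun p => ¬ p ∣ n) Z) :=
    div_le_div₀ (by positivity) hK hHpos hS
  have hcard' : (((range n).filter fun p => p.Prime ∧ m ∣ p - 1 ∧ (n - p).Prime).card : ℝ) ≤
      2 * (Z + 1) + sifted.card := by exact_mod_cast hcard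
  have hpow : ((Z * Z : ℕ) : ℝ) ^ 6 = (Z : ℝ) ^ 12 := by
    push_cast
    ring
  rw [hpow] at hsieve
  linarith

theorem log_le_mul_factoredHarmonic {L : ℝ} (hL1 : 1 ≤ L) (hL : 2 ≤ Real.log L) {M : ℕ}
    (hM0 : 0 < M) (hM : Real.log M ≤ 4 * L) (R : ℕ → Prop) [DecidablePred R] (Z : ℕ)
    (hR : ∀ p, R p → p ∣ M) :
    Real.log (Z + 1) ≤ 2 * Real.exp 10 * Real.log L *
      factoredHarmonic (((Icc 1 Z).filter Nat.Prime).filter fun p => ¬ R p) Z := by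
  set D := ((Icc 1 Z).filter Nat.Prime).filter R with hDdef
  have hD : ∀ p ∈ D, p.Prime := fun p hp => (mem_filter.1 (mem_filter.1 hp).1).2
  have hdisj : Disjoint (((Icc 1 Z).filter Nat.Prime).filter fun p => ¬ R p) D :=
    (disjoint_filter_filter_not _ _ _).symm
  have hunion : (((Icc 1 Z).filter Nat.Prime).filter fun p => ¬ R p) ∪ D =
      (Icc 1 Z).filter Nat.Prime := by
    rw [union_comm]
    exact filter_union_filter_not_eq _ _
  have hle : ∏ p ∈ D, p ≤ M := by
    refine Nat.le_of_dvd hM0 ((prod_dvd_prod_of_subset _ _ _ fun p hp => ?_).trans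
      (Nat.prod_primeFactors_dvd M))
    exact Nat.mem_primeFactors.2 ⟨hD p hp, hR p (mem_filter.1 hp).2, hM0.ne'⟩
  have hsum : ∑ p ∈ D, Real.log p ≤ 4 * L := by
    rw [← Real.log_prod fun p hp => by exact_mod_cast (hD p hp).ne_zero, ← Nat.cast_prod]
    refine (Real.log_le_log ?_ (by exact_mod_cast hle)).trans hM
    exact_mod_cast prod_pos fun p hp => (hD p hp).pos
  have h := factoredHarmonic_union_le _ D hD hdisj Z
  rw [hunion] at h
  exact (log_le_factoredHarmonic Z).trans (h.trans (mul_le_mul_of_nonneg_right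
    (prod_one_sub_inv_le D hD hL1 hL hsum) (factoredHarmonic_nonneg _ _)))

theorem eventually_log_rpow_le (ω : ℝ) : ∃ N0 : ℕ, ∀ N : ℕ, N0 ≤ N →
    8 ≤ N ∧ 1 ≤ Real.log N ∧ 2 ≤ Real.log (Real.log N) ∧
      5 * Real.log N ^ (ω + 2) ≤ (N : ℝ) ^ ((38 : ℝ) / 100) := by
  have hlog := Real.tendsto_log_atTop
  have h1 := hlog.eventually_ge_atTop 1
  have h2 := (hlog.comp hlog).eventually_ge_atTop 2
  have h3 := (isLittleO_log_rpow_rpow_atTop (ω + 2)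
    (by norm_num : (0 : ℝ) < 38 / 100)).bound (by norm_num : (0 : ℝ) < 1 / 5)
  have h4 := tendsto_natCast_atTop_atTop.eventually (h1.and (h2.and h3))
  obtain ⟨N0, hN0⟩ := Filter.eventually_atTop.1 (h4.and (Filter.eventually_ge_atTop 8))
  refine ⟨N0, fun N hN => ?_⟩
  obtain ⟨⟨a, b, c⟩, d⟩ := hN0 N hN
  refine ⟨d, a, b, ?_⟩
  rw [Real.norm_of_nonneg (Real.rpow_nonneg (by linarith) _),
    Real.norm_of_nonneg (Real.rpow_nonneg (Nat.cast_nonneg _) _)] at c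
  linarith

/-- for N^{3/4} ≤ n ≤ N and √N L^{-ω-10} < m < √N L^{ω},
the number of primes p < n with p ≡ 1 (mod m) and n - p prime is
≪ (N/m) L^{-2} (log L)². -/
theorem twin_type_count_in_progression :
    ∀ ω : ℝ, 0 < ω → ∃ C : ℝ, 0 < C ∧ ∃ N0 : ℕ,
      ∀ N : ℕ, N0 ≤ N → ∀ n m : ℕ,
        (N : ℝ) ^ ((3 : ℝ) / 4) ≤ (n : ℝ) → n ≤ N →
        Real.sqrt N * Real.log N ^ (-ω - 10) < (m : ℝ) →
        (m : ℝ) < Real.sqrt N * Real.log N ^ ω →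
        (((Finset.range n).filter
            (fun p => p.Prime ∧ m ∣ p - 1 ∧ (n - p).Prime)).card : ℝ) ≤
          C * ((N : ℝ) / m) * (Real.log N)⁻¹ ^ 2 * Real.log (Real.log N) ^ 2 := by
  intro ω hω
  refine ⟨2 * (200 * Real.exp 10) ^ 2 + 1, by positivity, ?_⟩
  obtain ⟨N0, hN0⟩ := eventually_log_rpow_le ω
  refine ⟨N0, fun N hN n m hn hnN hm1 hm2 => ?_⟩
  obtain ⟨hN8, hL1, hl2, hpow⟩ := hN0 N hN
  set L := Real.log N with hL
  set l := Real.log L with hl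
  have hNpos : (0 : ℝ) < N := by
    have : (8 : ℝ) ≤ N := by exact_mod_cast hN8
    linarith
  have hN1 : (1 : ℝ) ≤ N := by
    have : (8 : ℝ) ≤ N := by exact_mod_cast hN8
    linarith
  have hL0 : 0 < L := by linarith
  have hmR : (0 : ℝ) < m :=
    lt_of_le_of_lt (mul_nonneg (Real.sqrt_nonneg _) (Real.rpow_nonneg hL0.le _)) hm1
  have hm : 0 < m := by exact_mod_cast hmR
  have hnR : (0 : ℝ) < n := lt_of_lt_of_le (Real.rpow_pos_of_pos hNpos _) hn
  have hn0 : 0 < n := by exact_mod_cast hnR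
  have hnNR : (n : ℝ) ≤ N := by exact_mod_cast hnN
  have hX : 5 * (N : ℝ) ^ ((12 : ℝ) / 100) ≤ N / m * L⁻¹ ^ 2 := by
    have h1 : (m : ℝ) * L ^ 2 ≤ Real.sqrt N * L ^ (ω + 2) := by
      rw [Real.rpow_add hL0, Real.rpow_two, ← mul_assoc]
      exact mul_le_mul_of_nonneg_right hm2.le (sq_nonneg L)
    rw [inv_pow, ← div_eq_mul_inv, div_div, le_div_iff₀ (by positivity)]
    calc 5 * (N : ℝ) ^ ((12 : ℝ) / 100) * (m * L ^ 2)
        ≤ 5 * (N : ℝ) ^ ((12 : ℝ) / 100) * (Real.sqrt N * L ^ (ω + 2)) := by gcongr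
      _ = (N : ℝ) ^ ((12 : ℝ) / 100) * (N : ℝ) ^ ((1 : ℝ) / 2) * (5 * L ^ (ω + 2)) := by
        rw [Real.sqrt_eq_rpow]
        ring
      _ ≤ (N : ℝ) ^ ((12 : ℝ) / 100) * (N : ℝ) ^ ((1 : ℝ) / 2) *
          (N : ℝ) ^ ((38 : ℝ) / 100) := by gcongr
      _ = N := by
        rw [← Real.rpow_add hNpos, ← Real.rpow_add hNpos]
        norm_num
  have hX1 : 1 ≤ (N : ℝ) / m := by
    have h1 : (1 : ℝ) ≤ (N : ℝ) ^ ((12 : ℝ) / 100) := Real.one_le_rpow hN1 (by norm_num)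
    have h2 : L⁻¹ ^ 2 ≤ 1 := pow_le_one₀ (by positivity) (inv_le_one_of_one_le₀ hL1)
    have h3 : (N : ℝ) / m * L⁻¹ ^ 2 ≤ N / m := mul_le_of_le_one_right (by positivity) h2
    linarith
  have hmN : (m : ℝ) ≤ N := by rwa [one_le_div hmR] at hX1
  have hlogM : ∀ M : ℕ, 0 < M → M ≤ 2 * m * n → Real.log M ≤ 4 * L := by
    intro M hM hle
    have h0 : (M : ℝ) ≤ (N : ℝ) ^ 4 := by
      have h1 : (M : ℝ) ≤ 2 * m * n := by exact_mod_cast hle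
      have h2 : (2 : ℝ) * m * n ≤ N * N * N := by
        gcongr
        exact_mod_cast (by omega : 2 ≤ N)
      have h3 : (N : ℝ) * N * N * 1 ≤ N * N * N * N := by gcongr
      calc (M : ℝ) ≤ N * N * N * N := by linarith
        _ = (N : ℝ) ^ 4 := by ring
    have h1 := Real.log_le_log (by exact_mod_cast hM) h0
    rw [Real.log_pow] at h1
    exact_mod_cast h1
  set Z := ⌊(N : ℝ) ^ ((1 : ℝ) / 100)⌋₊ with hZdef
  have hZN : (1 : ℝ) ≤ (N : ℝ) ^ ((1 : ℝ) / 100) := Real.one_le_rpow hN1 (by norm_num)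
  have hZ : 1 ≤ Z := Nat.le_floor (by simpa using hZN)
  have hZle : (Z : ℝ) ≤ (N : ℝ) ^ ((1 : ℝ) / 100) := Nat.floor_le (by positivity)
  have hlogZ : L / 100 ≤ Real.log (Z + 1) := by
    have h1 := Real.log_le_log (by positivity)
      (Nat.lt_floor_add_one ((N : ℝ) ^ ((1 : ℝ) / 100))).le
    rw [Real.log_rpow hNpos] at h1
    rw [hL]
    linarith
  have hH1 := log_le_mul_factoredHarmonic hL1 hl2 (M := 2 * m) (by omega)
    (hlogM _ (by omega) (Nat.le_mul_of_pos_right _ hn0)) (fun p => p ∣ 2 * m) Z fun p hp => hp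
  have hH2 := log_le_mul_factoredHarmonic hL1 hl2 (M := 2 * m * n) (by positivity)
    (hlogM _ (by positivity) le_rfl) (fun p => p ∣ 2 * m ∨ p ∣ n) Z fun p hp =>
      hp.elim (fun h => h.mul_right n) (fun h => h.mul_left (2 * m))
  have hP2 : (((Icc 1 Z).filter Nat.Prime).filter fun p => ¬ (p ∣ 2 * m ∨ p ∣ n)) =
      (siftingPrimes m Z).filter fun p => ¬ p ∣ n := by
    ext p
    simp only [siftingPrimes, mem_filter, not_or, and_assoc]
  rw [hP2] at hH2
  have hcount := card_twin_le n m Z hm hZ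
  change Real.log (Z + 1) ≤ _ * factoredHarmonic (siftingPrimes m Z) Z at hH1
  set H₁ := factoredHarmonic (siftingPrimes m Z) Z with hH₁
  set H₂ := factoredHarmonic ((siftingPrimes m Z).filter fun p => ¬ p ∣ n) Z with hH₂
  set c := 2 * Real.exp 10 * l with hc
  have hc0 : 0 < c := by positivity
  have hlow : L ^ 2 / (100 * c) ^ 2 ≤ H₁ * H₂ := by
    have h1 : L / (100 * c) ≤ H₁ := by
      rw [div_le_iff₀ (by positivity)]
      linarith
    have h2 : L / (100 * c) ≤ H₂ := by
      rw [div_le_iff₀ (by positivity)]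
      linarith
    calc L ^ 2 / (100 * c) ^ 2 = L / (100 * c) * (L / (100 * c)) := by
          rw [← div_pow, sq]
      _ ≤ H₁ * H₂ := mul_le_mul h1 h2 (by positivity) (le_trans (by positivity) h1)
  have hmain : ((n : ℝ) / m + 1) / (H₁ * H₂) ≤
      2 * (200 * Real.exp 10) ^ 2 * (N / m) * L⁻¹ ^ 2 * l ^ 2 := by
    have h1 : (n : ℝ) / m + 1 ≤ 2 * (N / m) := by
      have : (n : ℝ) / m ≤ N / m := by gcongr
      linarith
    calc ((n : ℝ) / m + 1) / (H₁ * H₂) ≤ 2 * (N / m) / (L ^ 2 / (100 * c) ^ 2) :=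
          div_le_div₀ (by positivity) h1 (by positivity) hlow
      _ = 2 * (200 * Real.exp 10) ^ 2 * (N / m) * L⁻¹ ^ 2 * l ^ 2 := by
          rw [hc]
          field_simp
          ring
  have herr : (Z : ℝ) ^ 12 + 2 * (Z + 1) ≤ N / m * L⁻¹ ^ 2 * l ^ 2 := by
    have h1 : (1 : ℝ) ≤ Z := by exact_mod_cast hZ
    have h2 : (Z : ℝ) ≤ (Z : ℝ) ^ 12 := le_self_pow₀ h1 (by norm_num)
    have h3 : (Z : ℝ) ^ 12 ≤ (N : ℝ) ^ ((12 : ℝ) / 100) := by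
      refine (pow_le_pow_left₀ (by positivity) hZle 12).trans (le_of_eq ?_)
      rw [← Real.rpow_natCast, ← Real.rpow_mul hNpos.le]
      norm_num
    have h4 : 1 ≤ l ^ 2 := one_le_pow₀ (by linarith)
    have h5 : (N : ℝ) / m * L⁻¹ ^ 2 ≤ N / m * L⁻¹ ^ 2 * l ^ 2 :=
      le_mul_of_one_le_right (by positivity) h4
    linarith
  calc _ ≤ _ := hcount
    _ ≤ 2 * (200 * Real.exp 10) ^ 2 * (N / m) * L⁻¹ ^ 2 * l ^ 2 + N / m * L⁻¹ ^ 2 * l ^ 2 :=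
      add_le_add hmain herr
    _ = _ := by ring
end
end
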